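/- Let d = 7. For a general binary septimic E, the minimal generator dimensions of I_E are β_6 = 10, β_8 = 40, β_9 = 106, β_10 = 89, and β_m = 0 for all other m. -/

import Mathlib

/-!
Setup for the ideals of general binary orbits (Chipalkatti, "On the ideals of general
binary orbits: the low order cases").

A binary form `E = Σ_{i=0}^d binom(d,i) αᵢ x₁^{d−i} x₂^i` of order `d` over `ℂ` is
identified with its coefficient vector `α : Fin (d+1) → ℂ`.  `SL₂(ℂ)` acts on binary
`d`-ics by substitution of variables, inducing an action `actCoeff` on `ℂ^{d+1}` and an
action `actPoly` on `R = ℂ[a_0, …, a_d]` (the polynomial ring `MvPolynomial (Fin (d+1)) ℂ`).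

For `E ≠ 0`, `orbitVariety d E = X_E` is the Zariski closure of
`{λ • (g·E) : λ ∈ ℂ, g ∈ SL₂(ℂ)}` (the affine cone over the orbit closure `Ω_E ⊆ ℙ^d`),
and `orbitIdeal d E = I_E` is its vanishing ideal (automatically homogeneous).

`genPiece d m E = (I_E)_m`, `trivPiece d m E = (R₊·I_E)_m`, and
`minGenSpace d m E = B(0,m) = (I_E/(R₊·I_E))_m` is the space of minimal generators in
degree `m`, with `betti d m E = β_m` its dimension.

`RepSum l` models the direct sum `⊕ᵢ S_{l i}` of the irreducible `SL₂(ℂ)`-representations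
(binary forms of order `q`, via coefficient vectors), with action `repSumAct`.
-/

open MvPolynomial

noncomputable section

/-- The special linear group `SL₂(ℂ)`. -/
abbrev SL2 : Type := Matrix.SpecialLinearGroup (Fin 2) ℂ

/-- The binary form of order `d` with coefficient vector `α`:
`Σ_{i=0}^d binom(d,i) αᵢ x₁^{d−i} x₂^i`, with `x₁ = X 0`, `x₂ = X 1`. -/
def toForm (d : ℕ) (α : Fin (d + 1) → ℂ) : MvPolynomial (Fin 2) ℂ :=
  ∑ i : Fin (d + 1), C ((d.choose (i : ℕ) : ℂ) * α i) * (X 0 ^ (d - (i : ℕ)) * X 1 ^ (i : ℕ))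

/-- Substitution of variables by `g = [[p,q],[r,s]]`: `x₁ ↦ p x₁ + q x₂`, `x₂ ↦ r x₁ + s x₂`. -/
def substAction (g : SL2) (F : MvPolynomial (Fin 2) ℂ) : MvPolynomial (Fin 2) ℂ :=
  aeval (fun i : Fin 2 => C (g.1 i 0) * X 0 + C (g.1 i 1) * X 1) F

/-- The coefficient vector of `g·E`, where `E` is the binary `d`-ic with coefficient
vector `α`: the coefficient of `x₁^{d−i} x₂^i` in `g·E`, divided by `binom(d,i)`. -/
def actCoeff (d : ℕ) (g : SL2) (α : Fin (d + 1) → ℂ) : Fin (d + 1) → ℂ := fun i =>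
  coeff (Finsupp.single (0 : Fin 2) (d - (i : ℕ)) + Finsupp.single (1 : Fin 2) (i : ℕ))
      (substAction g (toForm d α)) / (d.choose (i : ℕ) : ℂ)

/-- The affine cone over the `SL₂(ℂ)`-orbit of `E`:
`{λ • (g·E) : λ ∈ ℂ, g ∈ SL₂(ℂ)} ⊆ ℂ^{d+1}`. -/
def orbitCone (d : ℕ) (E : Fin (d + 1) → ℂ) : Set (Fin (d + 1) → ℂ) :=
  {v | ∃ (c : ℂ) (g : SL2), v = c • actCoeff d g E}

/-- The Zariski closure of a subset of affine space `ℂⁿ`: the set of points at which every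
polynomial vanishing on `S` vanishes. -/
def zClosure {n : ℕ} (S : Set (Fin n → ℂ)) : Set (Fin n → ℂ) :=
  {v | ∀ f : MvPolynomial (Fin n) ℂ, (∀ w ∈ S, eval w f = 0) → eval v f = 0}

/-- A Zariski-open subset of `ℂⁿ`: the complement of the common zero locus of a family of
polynomials. -/
def IsZariskiOpen {n : ℕ} (U : Set (Fin n → ℂ)) : Prop :=
  ∃ T : Set (MvPolynomial (Fin n) ℂ), U = {v | ∃ f ∈ T, eval v f ≠ 0}

/-- A Zariski-dense subset of `ℂⁿ`. -/
def IsZariskiDense {n : ℕ} (U : Set (Fin n → ℂ)) : Prop :=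
  zClosure U = Set.univ

/-- A property `P` holds for a general `E ∈ ℂ^{d+1}` if it holds on some dense
Zariski-open subset of `ℂ^{d+1}`. -/
def ForGeneral (d : ℕ) (P : (Fin (d + 1) → ℂ) → Prop) : Prop :=
  ∃ U : Set (Fin (d + 1) → ℂ), IsZariskiOpen U ∧ IsZariskiDense U ∧ ∀ E ∈ U, P E

/-- `X_E`: the Zariski closure of the affine cone over the orbit of `E` (the affine cone
over the orbit closure `Ω_E ⊆ ℙ^d`). -/
def orbitVariety (d : ℕ) (E : Fin (d + 1) → ℂ) : Set (Fin (d + 1) → ℂ) :=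
  zClosure (orbitCone d E)

/-- `I_E`: the (homogeneous) vanishing ideal of `X_E` in `R = ℂ[a_0, …, a_d]`. -/
def orbitIdeal (d : ℕ) (E : Fin (d + 1) → ℂ) : Ideal (MvPolynomial (Fin (d + 1)) ℂ) where
  carrier := {f | ∀ v ∈ orbitVariety d E, eval v f = 0}
  zero_mem' := fun v _ => by simp
  add_mem' := fun hf hh v hv => by simp [hf v hv, hh v hv]
  smul_mem' := fun c f hf v hv => by simp [smul_eq_mul, hf v hv]

/-- The linear polynomial expressing the `i`-th coordinate of `g·v` in terms of the
coordinates of `v`. -/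
def actVarPoly (d : ℕ) (g : SL2) (i : Fin (d + 1)) : MvPolynomial (Fin (d + 1)) ℂ :=
  ∑ j : Fin (d + 1), C (actCoeff d g (Pi.single j 1) i) * X j

/-- The induced `SL₂(ℂ)`-action on `R = ℂ[a_0, …, a_d]`: `(g·f)(v) = f(g·v)`. -/
def actPoly (d : ℕ) (g : SL2) (f : MvPolynomial (Fin (d + 1)) ℂ) :
    MvPolynomial (Fin (d + 1)) ℂ :=
  aeval (actVarPoly d g) f

/-- The degree-`m` graded piece of an ideal of `R`, as a `ℂ`-subspace. -/
def idealPiece (d m : ℕ) (I : Ideal (MvPolynomial (Fin (d + 1)) ℂ)) :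
    Submodule ℂ (MvPolynomial (Fin (d + 1)) ℂ) :=
  Submodule.restrictScalars ℂ I ⊓ homogeneousSubmodule (Fin (d + 1)) ℂ m

/-- `(I_E)_m`, the degree-`m` graded piece of `I_E`. -/
def genPiece (d m : ℕ) (E : Fin (d + 1) → ℂ) :
    Submodule ℂ (MvPolynomial (Fin (d + 1)) ℂ) :=
  idealPiece d m (orbitIdeal d E)

/-- The irrelevant maximal ideal `R₊ = (a_0, …, a_d)`. -/
def irrelevantIdeal (d : ℕ) : Ideal (MvPolynomial (Fin (d + 1)) ℂ) :=
  Ideal.span (Set.range X)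

/-- `(R₊·I_E)_m`. -/
def trivPiece (d m : ℕ) (E : Fin (d + 1) → ℂ) :
    Submodule ℂ (MvPolynomial (Fin (d + 1)) ℂ) :=
  idealPiece d m (irrelevantIdeal d * orbitIdeal d E)

/-- `(R₊·I_E)_m` viewed inside `(I_E)_m`. -/
def minGenRel (d m : ℕ) (E : Fin (d + 1) → ℂ) : Submodule ℂ (genPiece d m E) :=
  (trivPiece d m E).comap (genPiece d m E).subtype

/-- `B(0,m) = (I_E/(R₊·I_E))_m`, the degree-`m` space of minimal generators of `I_E`. -/
abbrev minGenSpace (d m : ℕ) (E : Fin (d + 1) → ℂ) : Type :=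
  genPiece d m E ⧸ minGenRel d m E

/-- The canonical projection `(I_E)_m → B(0,m)`. -/
def minGenMk (d m : ℕ) (E : Fin (d + 1) → ℂ) : genPiece d m E →ₗ[ℂ] minGenSpace d m E :=
  (minGenRel d m E).mkQ

/-- `β_m = dim_ℂ B(0,m)`, the number of minimal generators of `I_E` in degree `m`. -/
def betti (d m : ℕ) (E : Fin (d + 1) → ℂ) : ℕ :=
  Module.finrank ℂ (minGenSpace d m E)

/-- The direct sum `⊕ᵢ S_{l i}` of irreducible `SL₂(ℂ)`-representations, where `S_q`
(binary forms of order `q`) is modeled by coefficient vectors `Fin (q+1) → ℂ`. -/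
abbrev RepSum (l : List ℕ) : Type :=
  ∀ i : Fin l.length, Fin (l.get i + 1) → ℂ

/-- The `SL₂(ℂ)`-action on `RepSum l`, by substitution on each binary form. -/
def repSumAct (l : List ℕ) (g : SL2) (v : RepSum l) : RepSum l :=
  fun i => actCoeff (l.get i) g (v i)

/-- `B(0,m) ≅ S_{l 0} ⊕ ⋯ ⊕ S_{l k}` as `SL₂(ℂ)`-representations: there is a
`ℂ`-linear isomorphism intertwining the action induced on `B(0,m)` by the action on
`(I_E)_m ⊆ R` with the action on `⊕ᵢ S_{l i}`. -/
def HasMinGens (d m : ℕ) (E : Fin (d + 1) → ℂ) (l : List ℕ) : Prop :=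
  ∃ e : minGenSpace d m E ≃ₗ[ℂ] RepSum l,
    ∀ (g : SL2) (f : MvPolynomial (Fin (d + 1)) ℂ)
      (hf : f ∈ genPiece d m E) (hgf : actPoly d g f ∈ genPiece d m E),
      e (minGenMk d m E ⟨actPoly d g f, hgf⟩) = repSumAct l g (e (minGenMk d m E ⟨f, hf⟩))

end

namespace Septimic

/-- Exponent vectors in `n` variables of weights `0, …, n - 1` with given degree and weight. -/
def expSet (n m w : ℕ) : Set (Fin n → ℕ) := {d | ∑ k, d k = m ∧ ∑ k, d k * (k : ℕ) = w}

theorem expSet_finite (n m w : ℕ) : (expSet n m w).Finite := by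
  refine Set.Finite.subset (Set.Finite.pi' (fun _ : Fin n => Set.finite_Iic m)) ?_
  rintro d ⟨h, -⟩ k
  rw [Set.mem_Iic, ← h]
  exact Finset.single_le_sum (f := d) (fun _ _ => Nat.zero_le _) (Finset.mem_univ k)

theorem ncard_expSet_zero (n w : ℕ) : (expSet n 0 w).ncard = if w = 0 then 1 else 0 := by
  have h : ∀ d ∈ expSet n 0 w, d = 0 := by
    rintro d ⟨h, -⟩
    funext k
    simpa using (Finset.sum_eq_zero_iff.1 h) k (Finset.mem_univ k)
  split_ifs with hw
  · have : expSet n 0 w = {0} := by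
      ext d
      refine ⟨fun hd => h d hd, ?_⟩
      rintro rfl
      simp [expSet, hw]
    simp [this]
  · have : expSet n 0 w = ∅ := by
      ext d
      refine ⟨fun hd => ?_, fun h => h.elim⟩
      have h0 := h d hd
      subst h0
      exact hw (by simpa [expSet, eq_comm] using hd)
    simp [this]

theorem ncard_expSet_nil (m w : ℕ) : (expSet 0 (m + 1) w).ncard = 0 := by
  simp [expSet]

theorem ncard_expSet_succ (n m w : ℕ) : (expSet (n + 1) (m + 1) w).ncard =
    (expSet n (m + 1) w).ncard + if n ≤ w then (expSet (n + 1) m (w - n)).ncard else 0 := by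
  have h1 : expSet (n + 1) (m + 1) w =
      (fun d : Fin n → ℕ => (Fin.snoc d 0 : Fin (n + 1) → ℕ)) '' expSet n (m + 1) w ∪
      (fun d : Fin (n + 1) → ℕ => d + Pi.single (Fin.last n) 1) ''
        (if n ≤ w then expSet (n + 1) m (w - n) else ∅) := by
    ext d
    constructor
    · rintro ⟨ha, hb⟩
      rw [Fin.sum_univ_castSucc] at ha hb
      simp only [Fin.val_castSucc, Fin.val_last] at hb
      rcases Nat.eq_zero_or_pos (d (Fin.last n)) with h0 | h0
      · left
        refine ⟨fun k => d k.castSucc, ⟨by simpa [h0] using ha, by simpa [h0] using hb⟩, ?_⟩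
        funext k
        refine Fin.lastCases ?_ (fun i => ?_) k
        · simp [h0]
        · simp
      · right
        obtain ⟨e, he⟩ : ∃ e, d (Fin.last n) = e + 1 := ⟨_, (Nat.succ_pred_eq_of_pos h0).symm⟩
        have hnw : n ≤ w := by
          rw [← hb, he]
          nlinarith [Nat.zero_le (∑ i : Fin n, d i.castSucc * (i : ℕ)), Nat.zero_le (e * n)]
        rw [if_pos hnw]
        refine ⟨fun k => d k - (Pi.single (Fin.last n) 1 : Fin (n + 1) → ℕ) k, ⟨?_, ?_⟩, ?_⟩
        · rw [Fin.sum_univ_castSucc]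
          have : ∀ i : Fin n, (Pi.single (Fin.last n) 1 : Fin (n + 1) → ℕ) i.castSucc = 0 :=
            fun i => Pi.single_eq_of_ne (Fin.castSucc_lt_last i).ne _
          simp only [this, Pi.single_eq_same]
          simp only [tsub_zero]
          omega
        · rw [Fin.sum_univ_castSucc]
          have : ∀ i : Fin n, (Pi.single (Fin.last n) 1 : Fin (n + 1) → ℕ) i.castSucc = 0 :=
            fun i => Pi.single_eq_of_ne (Fin.castSucc_lt_last i).ne _
          simp only [this, Pi.single_eq_same, Fin.val_castSucc, Fin.val_last, tsub_zero]
          rw [he] at hb ⊢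
          rw [Nat.add_mul, one_mul] at hb
          simp only [Nat.add_sub_cancel]
          omega
        · funext k
          refine Fin.lastCases ?_ (fun i => ?_) k
          · simp [he]
          · simp
    · rintro (⟨d, ⟨ha, hb⟩, rfl⟩ | ⟨d, hd, rfl⟩)
      · refine ⟨?_, ?_⟩
        · rw [Fin.sum_univ_castSucc]
          simpa using ha
        · rw [Fin.sum_univ_castSucc]
          simpa using hb
      · split_ifs at hd with hnw
        · obtain ⟨ha, hb⟩ := hd
          refine ⟨?_, ?_⟩
          · simp [Finset.sum_add_distrib, ha]
          · simp only [Pi.add_apply, add_mul, Finset.sum_add_distrib, hb]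
            rw [Finset.sum_eq_single (Fin.last n)]
            · simp [hnw]
            · intro i _ hi
              simp [Pi.single_eq_of_ne hi]
            · simp
        · exact hd.elim
  have hdisj : Disjoint
      ((fun d : Fin n → ℕ => (Fin.snoc d 0 : Fin (n + 1) → ℕ)) '' expSet n (m + 1) w)
      ((fun d : Fin (n + 1) → ℕ => d + Pi.single (Fin.last n) 1) ''
        (if n ≤ w then expSet (n + 1) m (w - n) else ∅)) := by
    rw [Set.disjoint_left]
    rintro _ ⟨a, -, rfl⟩ ⟨b, -, hb⟩
    have := congrFun hb (Fin.last n)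
    simp at this
  rw [h1, Set.ncard_union_eq hdisj ((expSet_finite _ _ _).image _)
      (by split_ifs; exacts [(expSet_finite _ _ _).image _, by simp]),
    Set.ncard_image_of_injective, Set.ncard_image_of_injective]
  · split_ifs <;> simp
  · exact fun a b h => add_right_cancel h
  · intro a b h
    have := congrArg (Fin.init (α := fun _ => ℕ)) h
    simpa using this

/-- Coefficientwise addition of rows, padding with zeros. -/
def rowAdd : List ℕ → List ℕ → List ℕ
  | [], l => l
  | x :: xs, [] => x :: xs
  | x :: xs, y :: ys => (x + y) :: rowAdd xs ys

theorem getD_rowAdd (l l' : List ℕ) (i : ℕ) :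
    (rowAdd l l').getD i 0 = l.getD i 0 + l'.getD i 0 := by
  induction l generalizing l' i with
  | nil => simp [rowAdd]
  | cons x xs ih =>
    cases l' with
    | nil => simp [rowAdd]
    | cons y ys => cases i with
      | zero => simp [rowAdd]
      | succ i => simpa [rowAdd] using ih ys i

theorem getD_replicate_append (n : ℕ) (l : List ℕ) (i : ℕ) :
    (List.replicate n 0 ++ l).getD i 0 = if n ≤ i then l.getD (i - n) 0 else 0 := by
  split_ifs with h
  · rw [List.getD_append_right _ _ _ _ (by simpa using h)]
    simp
  · rw [List.getD_append _ _ _ _ (by simpa using h)]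
    simp

/-- From the rows of the counting table in `n` variables, those in `n + 1` variables. -/
def nextRows (n : ℕ) : List ℕ → List (List ℕ) → List (List ℕ)
  | _, [] => []
  | prev, r :: rs =>
    let s := rowAdd r (List.replicate n 0 ++ prev)
    s :: nextRows n s rs

/-- The counting table: the `w`-th entry of its `m`-th row is the size of `expSet n m w`. -/
def countTable (N : ℕ) : ℕ → List (List ℕ)
  | 0 => [1] :: List.replicate N []
  | n + 1 => match countTable N n with
    | [] => []
    | r :: rs => r :: nextRows n r rs

theorem nextRows_spec (n m : ℕ) (prev : List ℕ) (rs : List (List ℕ))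
    (hp : ∀ w, prev.getD w 0 = (expSet (n + 1) m w).ncard)
    (hr : ∀ i < rs.length, ∀ w, (rs.getD i []).getD w 0 = (expSet n (m + 1 + i) w).ncard) :
    ∀ i < rs.length, ∀ w,
      ((nextRows n prev rs).getD i []).getD w 0 = (expSet (n + 1) (m + 1 + i) w).ncard := by
  induction rs generalizing m prev with
  | nil => intro i hi; simp at hi
  | cons r rs ih =>
    have h0 : ∀ w, (rowAdd r (List.replicate n 0 ++ prev)).getD w 0 =
        (expSet (n + 1) (m + 1) w).ncard := by
      intro w
      rw [getD_rowAdd, getD_replicate_append, ncard_expSet_succ, hp]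
      have := hr 0 (by simp) w
      simp only [List.getD_cons_zero, add_zero] at this
      rw [this]
    intro i hi w
    cases i with
    | zero => simpa [nextRows] using h0 w
    | succ i =>
      have := ih (m + 1) _ h0 (fun i hi w => by
        have := hr (i + 1) (by simpa using hi) w
        rw [List.getD_cons_succ] at this
        rw [this]; congr 2; ring) i (by simpa using hi) w
      simp only [nextRows, List.getD_cons_succ]
      rw [this]; congr 2; ring

theorem length_nextRows (n : ℕ) (prev : List ℕ) (rs : List (List ℕ)) :
    (nextRows n prev rs).length = rs.length := by
  induction rs generalizing prev with
  | nil => rfl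
  | cons r rs ih => simp [nextRows, ih]

theorem countTable_spec (N n : ℕ) : (countTable N n).length = N + 1 ∧ ∀ m ≤ N, ∀ w,
    ((countTable N n).getD m []).getD w 0 = (expSet n m w).ncard := by
  induction n with
  | zero =>
    refine ⟨by simp [countTable], fun m hm w => ?_⟩
    cases m with
    | zero =>
      rw [ncard_expSet_zero]
      cases w <;> simp [countTable]
    | succ m =>
      rw [ncard_expSet_nil]
      simp [countTable]
  | succ n ih =>
    obtain ⟨hl, ih⟩ := ih
    rcases h : countTable N n with _ | ⟨r, rs⟩
    · simp [h] at hl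
    · rw [h] at ih hl
      simp only [countTable, h]
      refine ⟨by simpa [length_nextRows] using hl, ?_⟩
      have h0 : ∀ w, r.getD w 0 = (expSet (n + 1) 0 w).ncard := by
        intro w
        rw [ncard_expSet_zero, ← ncard_expSet_zero n]
        simpa using ih 0 (Nat.zero_le _) w
      intro m hm w
      cases m with
      | zero => simpa using h0 w
      | succ m =>
        rw [List.getD_cons_succ]
        have hl' : rs.length = N := by simpa using hl
        have := nextRows_spec n 0 r rs h0 (fun i hi w => by
          have := ih (i + 1) (by omega) w
          rw [List.getD_cons_succ] at this
          rw [this]; congr 2; ring) m (by omega) w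
        rw [this]; congr 2; ring

/-- The exponents of the monomials of degree `m` and weight `w` in `a_0, …, a_7`. -/
def monSet (m : ℕ) (w : ℤ) : Set (Fin 8 →₀ ℕ) :=
  {d | ∑ k, d k = m ∧ ∑ k, (d k : ℤ) * ((k : ℕ) : ℤ) = w}

theorem monSet_eq (m w : ℕ) : monSet m w = Finsupp.equivFunOnFinite ⁻¹' expSet 8 m w := by
  ext d
  simp only [monSet, expSet, Set.mem_ofPred_eq, Set.mem_preimage, Finsupp.equivFunOnFinite_apply]
  norm_cast

theorem monSet_neg {m : ℕ} {w : ℤ} (hw : w < 0) : monSet m w = ∅ := by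
  ext d
  simp only [monSet, Set.mem_ofPred_eq, Set.mem_empty_iff_false, iff_false, not_and]
  rintro - h
  have : 0 ≤ ∑ k, (d k : ℤ) * ((k : ℕ) : ℤ) := Finset.sum_nonneg fun k _ => by positivity
  omega

theorem monSet_finite (m : ℕ) (w : ℤ) : (monSet m w).Finite := by
  rcases lt_or_ge w 0 with hw | hw
  · rw [monSet_neg hw]; exact Set.finite_empty
  · lift w to ℕ using hw
    rw [monSet_eq]
    exact (expSet_finite 8 m w).preimage Finsupp.equivFunOnFinite.injective.injOn

/-- The polynomials of degree `m` and weight `w`. -/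
noncomputable def Pol (m : ℕ) (w : ℤ) : Submodule ℂ (MvPolynomial (Fin 8) ℂ) :=
  restrictSupport ℂ (monSet m w)

noncomputable def basisPol (m : ℕ) (w : ℤ) : Module.Basis (monSet m w) ℂ (Pol m w) :=
  basisRestrictSupport ℂ (monSet m w)

instance (m : ℕ) (w : ℤ) : FiniteDimensional ℂ (Pol m w) :=
  have := (monSet_finite m w).to_subtype
  Module.Finite.of_basis (basisPol m w)

theorem finrank_Pol (m w : ℕ) (N : ℕ) (hm : m ≤ N) :
    Module.finrank ℂ (Pol m w) = ((countTable N 8).getD m []).getD w 0 := by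
  have := (monSet_finite m w).to_subtype
  rw [(countTable_spec N 8).2 m hm w, Module.finrank_eq_nat_card_basis (basisPol m w),
    Nat.card_coe_set_eq, monSet_eq,
    Set.ncard_preimage_of_injective_subset_range Finsupp.equivFunOnFinite.injective]
  intro x _
  exact Finsupp.equivFunOnFinite.surjective x

open Module

section Linear
variable {V W : Type*} [AddCommGroup V] [Module ℂ V] [AddCommGroup W] [Module ℂ W]

theorem finrank_eq_map_add_ker (T : V →ₗ[ℂ] W) (U : Submodule ℂ V) [FiniteDimensional ℂ U] :
    finrank ℂ U = finrank ℂ (U.map T) + finrank ℂ (U ⊓ LinearMap.ker T : Submodule ℂ V) := by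
  rw [← LinearMap.finrank_range_add_finrank_ker (T.domRestrict U), LinearMap.range_domRestrict]
  congr 1
  rw [LinearMap.ker_domRestrict, ← Submodule.map_comap_subtype,
    Submodule.finrank_map_subtype_eq]

theorem finrank_sub_le_of_surj (T : V →ₗ[ℂ] W) (A A' : Submodule ℂ V) (B B' : Submodule ℂ W)
    [FiniteDimensional ℂ A] [FiniteDimensional ℂ B'] (hA : A' ≤ A) (h : B ≤ A.map T)
    (h' : A'.map T ≤ B') : finrank ℂ A' + finrank ℂ B ≤ finrank ℂ A + finrank ℂ B' := by
  have : FiniteDimensional ℂ A' := Submodule.finiteDimensional_of_le hA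
  have e1 := finrank_eq_map_add_ker T A
  have e2 := finrank_eq_map_add_ker T A'
  have e3 : finrank ℂ B ≤ finrank ℂ (A.map T) := Submodule.finrank_mono h
  have e4 : finrank ℂ (A'.map T) ≤ finrank ℂ B' := Submodule.finrank_mono h'
  have : FiniteDimensional ℂ (A ⊓ LinearMap.ker T : Submodule ℂ V) :=
    Submodule.finiteDimensional_of_le inf_le_left
  have e5 : finrank ℂ (A' ⊓ LinearMap.ker T : Submodule ℂ V) ≤
      finrank ℂ (A ⊓ LinearMap.ker T : Submodule ℂ V) :=
    Submodule.finrank_mono (inf_le_inf_right _ hA)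
  omega

end Linear

/-- A family of weight spaces stable under a lowering operator `D` and a raising operator `Δ`
satisfying the `sl₂` relation, with weights in `0, …, h`. -/
structure IsSl2 {V : Type*} [AddCommGroup V] [Module ℂ V] (D Δ : V →ₗ[ℂ] V) (h : ℤ)
    (J : ℤ → Submodule ℂ V) : Prop where
  lower : ∀ w, ∀ v ∈ J w, D v ∈ J (w - 1)
  raise : ∀ w, ∀ v ∈ J w, Δ v ∈ J (w + 1)
  comm : ∀ w, ∀ v ∈ J w, D (Δ v) = Δ (D v) + ((h - 2 * w : ℤ) : ℂ) • v
  bot_of_neg : ∀ w, w < 0 → J w = ⊥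
  bot_of_lt : ∀ w, h < w → J w = ⊥

namespace IsSl2
variable {V : Type*} [AddCommGroup V] [Module ℂ V] {D Δ : V →ₗ[ℂ] V} {h : ℤ}
  {J J' : ℤ → Submodule ℂ V}

theorem lower_pow (S : IsSl2 D Δ h J) (n : ℕ) {w : ℤ} {v : V} (hv : v ∈ J w) :
    (D ^ n) v ∈ J (w - n) := by
  induction n with
  | zero => simpa using hv
  | succ n ih =>
    rw [pow_succ', Module.End.mul_apply]
    have := S.lower _ _ ih
    convert this using 2
    push_cast; ring

theorem raise_pow (S : IsSl2 D Δ h J) (n : ℕ) {w : ℤ} {v : V} (hv : v ∈ J w) :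
    (Δ ^ n) v ∈ J (w + n) := by
  induction n with
  | zero => simpa using hv
  | succ n ih =>
    rw [pow_succ', Module.End.mul_apply]
    have := S.raise _ _ ih
    convert this using 2
    push_cast; ring

theorem lower_pow_raise (S : IsSl2 D Δ h J) (n : ℕ) {w : ℤ} {v : V} (hv : v ∈ J w) :
    (D ^ (n + 1)) (Δ v) =
      Δ ((D ^ (n + 1)) v) + (((n + 1) * (h - 2 * w + n) : ℤ) : ℂ) • (D ^ n) v := by
  induction n with
  | zero => simpa using S.comm w v hv
  | succ n ih =>
    have e1 (k : ℕ) : D ((D ^ k) v) = (D ^ (k + 1)) v := by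
      rw [pow_succ', Module.End.mul_apply]
    rw [pow_succ', Module.End.mul_apply, ih, map_add, map_smul,
      S.comm _ _ (S.lower_pow (n + 1) hv), e1, ← pow_succ', e1, add_assoc, ← add_smul, ← Int.cast_add]
    congr 4
    push_cast; ring

theorem lower_raise_pow (S : IsSl2 D Δ h J) (n : ℕ) {w : ℤ} {v : V} (hv : v ∈ J w)
    (h0 : D v = 0) :
    D ((Δ ^ (n + 1)) v) = (((n + 1) * (h - 2 * w - n) : ℤ) : ℂ) • (Δ ^ n) v := by
  induction n with
  | zero => simpa [h0] using S.comm w v hv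
  | succ n ih =>
    rw [pow_succ', Module.End.mul_apply, S.comm _ _ (S.raise_pow (n + 1) hv), ih, map_smul,
      ← Module.End.mul_apply, ← pow_succ', ← add_smul]
    congr 1
    push_cast; ring

theorem exists_lower_eq (S : IsSl2 D Δ h J) {w : ℤ} (hw : 2 * w < h) {v : V} (hv : v ∈ J w) :
    ∃ u ∈ J (w + 1), D u = v := by
  have key : ∀ (n : ℕ) (v : V), v ∈ J w → (D ^ n) v = 0 → ∃ u ∈ J (w + 1), D u = v := by
    intro n
    induction n with
    | zero =>
      intro v _ h0
      exact ⟨0, zero_mem _, by simpa using h0.symm⟩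
    | succ n ih =>
      intro v hv h0
      have e := S.lower_pow_raise n hv
      rw [h0, map_zero, zero_add] at e
      set μ : ℂ := (((n + 1) * (h - 2 * w + n) : ℤ) : ℂ) with hμ
      have hμ0 : μ ≠ 0 := by
        rw [hμ, Int.cast_ne_zero]
        have : (0 : ℤ) < (n + 1) * (h - 2 * w + n) := by
          apply mul_pos <;> omega
        exact this.ne'
      have hm : D (Δ v) - μ • v ∈ J w := by
        refine sub_mem ?_ (Submodule.smul_mem _ _ hv)
        have := S.lower _ _ (S.raise _ _ hv)
        simpa using this
      obtain ⟨u, hu, hu'⟩ := ih _ hm (by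
        rw [map_sub, map_smul, ← Module.End.mul_apply, ← pow_succ, e, sub_self])
      refine ⟨μ⁻¹ • (Δ v - u), Submodule.smul_mem _ _ (sub_mem (S.raise _ _ hv) hu), ?_⟩
      rw [map_smul, map_sub, hu', sub_sub_cancel, smul_smul, inv_mul_cancel₀ hμ0, one_smul]
  refine key (w.toNat + 1) v hv ?_
  have := S.lower_pow (w.toNat + 1) hv
  rwa [S.bot_of_neg _ (by omega), Submodule.mem_bot] at this

theorem le_map_lower (S : IsSl2 D Δ h J) {w : ℤ} (hw : 2 * w < h) :
    J w ≤ (J (w + 1)).map D := fun _ hv => S.exists_lower_eq hw hv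

theorem map_lower (S : IsSl2 D Δ h J) {w : ℤ} (hw : 2 * w < h) : (J (w + 1)).map D = J w := by
  refine le_antisymm ?_ (S.le_map_lower hw)
  rintro _ ⟨v, hv, rfl⟩
  simpa using S.lower _ _ hv

theorem eq_zero_of_lower_eq_zero (S : IsSl2 D Δ h J) {w : ℤ} (hw : h < 2 * w) {v : V}
    (hv : v ∈ J w) (h0 : D v = 0) : v = 0 := by
  have key : ∀ n : ℕ, (Δ ^ n) v = 0 → v = 0 := by
    intro n
    induction n with
    | zero => intro h; simpa using h
    | succ n ih =>
      intro hn
      have e := S.lower_raise_pow n hv h0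
      rw [hn, map_zero, eq_comm, smul_eq_zero, Int.cast_eq_zero] at e
      refine ih (e.resolve_left ?_)
      have : (n + 1 : ℤ) * (h - 2 * w - n) < 0 := by
        apply mul_neg_of_pos_of_neg <;> omega
      exact this.ne
  have := S.raise_pow (h - w + 1).toNat hv
  rw [S.bot_of_lt _ (by omega), Submodule.mem_bot] at this
  exact key _ this

theorem raise_pow_eq_zero (S : IsSl2 D Δ h J) {w : ℤ} (k : ℕ) (hk : h = 2 * w + k) {v : V}
    (hv : v ∈ J w) (h0 : D v = 0) : (Δ ^ (k + 1)) v = 0 := by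
  refine S.eq_zero_of_lower_eq_zero (w := w + (k + 1 : ℕ)) (by push_cast; omega)
    (S.raise_pow (k + 1) hv) ?_
  rw [S.lower_raise_pow k hv h0, hk]
  simp

theorem finrank_mono (S : IsSl2 D Δ h J) [∀ w, FiniteDimensional ℂ (J w)] {w : ℤ}
    (hw : 2 * w < h) : finrank ℂ (J w) ≤ finrank ℂ (J (w + 1)) := by
  rw [← S.map_lower hw]
  exact Submodule.finrank_map_le _ _

/-- The multiplicity gap between a stable family and a subfamily grows towards the middle. -/
theorem finrank_gap_mono (S : IsSl2 D Δ h J) [∀ w, FiniteDimensional ℂ (J w)]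
    (hle : ∀ w, J' w ≤ J w) (hD : ∀ w, ∀ v ∈ J' w, D v ∈ J' (w - 1)) {w : ℤ} (hw : 2 * w < h) :
    finrank ℂ (J' (w + 1)) + finrank ℂ (J w) ≤ finrank ℂ (J (w + 1)) + finrank ℂ (J' w) := by
  have : FiniteDimensional ℂ (J' w) := Submodule.finiteDimensional_of_le (hle w)
  refine finrank_sub_le_of_surj D _ _ _ _ (hle _) (S.le_map_lower hw) ?_
  rintro _ ⟨v, hv, rfl⟩
  simpa using hD _ _ hv

/-- If highest weight vectors are tested for membership in a stable subfamily by `n` functionals,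
the multiplicity of the quotient is at most `n`. -/
theorem finrank_le_add_of_functionals (S : IsSl2 D Δ h J) (S' : IsSl2 D Δ h J')
    [∀ w, FiniteDimensional ℂ (J w)] (hle : ∀ w, J' w ≤ J w) {w : ℤ} (hw : 2 * w < h)
    {n : ℕ} (ℓ : Fin n → V →ₗ[ℂ] ℂ)
    (hℓ : ∀ v ∈ J (w + 1), D v = 0 → (∀ j, ℓ j v = 0) → v ∈ J' (w + 1)) :
    finrank ℂ (J (w + 1)) + finrank ℂ (J' w) ≤
      finrank ℂ (J w) + finrank ℂ (J' (w + 1)) + n := by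
  have i1 : ∀ w, FiniteDimensional ℂ (J' w) :=
    fun w => Submodule.finiteDimensional_of_le (hle w)
  have e1 := finrank_eq_map_add_ker D (J (w + 1))
  have e2 := finrank_eq_map_add_ker D (J' (w + 1))
  rw [S.map_lower hw] at e1
  rw [S'.map_lower hw] at e2
  set K := J (w + 1) ⊓ LinearMap.ker D with hK
  have : FiniteDimensional ℂ K := Submodule.finiteDimensional_of_le inf_le_left
  have e3 := finrank_eq_map_add_ker (LinearMap.pi ℓ) K
  have e4 : finrank ℂ (K.map (LinearMap.pi ℓ)) ≤ n := by
    refine (Submodule.finrank_le _).trans ?_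
    simp
  have : FiniteDimensional ℂ (J' (w + 1) ⊓ LinearMap.ker D : Submodule ℂ V) :=
    Submodule.finiteDimensional_of_le inf_le_left
  have e5 : finrank ℂ (K ⊓ LinearMap.ker (LinearMap.pi ℓ) : Submodule ℂ V) ≤
      finrank ℂ (J' (w + 1) ⊓ LinearMap.ker D : Submodule ℂ V) := by
    refine Submodule.finrank_mono ?_
    rintro v ⟨⟨h1, h2⟩, h3⟩
    refine ⟨hℓ v h1 h2 fun j => ?_, h2⟩
    exact congrFun (LinearMap.mem_ker.1 h3) j
  omega

end IsSl2

section Points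
variable {A : Type*} [CommRing A]

/-- The binary septic `∏ i, (u i + v i X)`, dehomogenized. -/
noncomputable def linProd (u v : Fin 7 → A) : Polynomial A :=
  ∏ i, (Polynomial.C (u i) + Polynomial.C (v i) * Polynomial.X)

/-- `105 / binom(7,k)`. -/
def nrm : Fin 8 → ℕ := ![105, 15, 5, 3, 3, 5, 15, 105]

theorem nrm_mul_choose (k : Fin 8) : nrm k * Nat.choose 7 k = 105 := by
  revert k; decide

theorem nrm_succ (k : Fin 8) (hk : k ≠ 7) :
    nrm k * ((k : ℕ) + 1) = (7 - (k : ℕ)) * nrm (k + 1) := by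
  revert k; decide

theorem nrm_pred (k : Fin 8) (hk : k ≠ 0) :
    nrm k * (7 - ((k : ℕ) - 1)) = (k : ℕ) * nrm (k - 1) := by
  revert k; decide

theorem nrm_rev (k : Fin 8) : nrm k.rev = nrm k := by
  revert k; decide

/-- Coefficient vector of the septic `105 ∏ i, (u i x₁ + v i x₂)`. -/
noncomputable def septic (u v : Fin 7 → A) (k : Fin 8) : A := nrm k * (linProd u v).coeff k

/-- Coefficient vector of `105 ∏ i, ((p x₁ + q x₂) - ρ i (r x₁ + s x₂))`. -/
noncomputable def pt (ρ : Fin 7 → A) (p q r s : A) : Fin 8 → A :=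
  septic (fun i => p - ρ i * r) (fun i => q - ρ i * s)

theorem map_linProd {A' : Type*} [CommRing A'] (φ : A →+* A') (u v : Fin 7 → A) :
    (linProd u v).map φ = linProd (fun i => φ (u i)) (fun i => φ (v i)) := by
  simp [linProd, Polynomial.map_prod]

theorem map_septic {A' : Type*} [CommRing A'] (φ : A →+* A') (u v : Fin 7 → A) (k : Fin 8) :
    φ (septic u v k) = septic (fun i => φ (u i)) (fun i => φ (v i)) k := by
  rw [septic, septic, ← map_linProd, Polynomial.coeff_map, map_mul, map_natCast]

theorem map_pt {A' : Type*} [CommRing A'] (φ : A →+* A') (ρ : Fin 7 → A) (p q r s : A)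
    (k : Fin 8) :
    φ (pt ρ p q r s k) = pt (fun i => φ (ρ i)) (φ p) (φ q) (φ r) (φ s) k := by
  simp [pt, map_septic]

theorem coeff_linProd (u v : Fin 7 → A) (k : ℕ) :
    (linProd u v).coeff k =
      ∑ S ∈ Finset.powersetCard k Finset.univ, (∏ i ∈ S, v i) * ∏ i ∈ Sᶜ, u i := by
  have : linProd u v = ∑ S : Finset (Fin 7),
      Polynomial.C ((∏ i ∈ S, v i) * ∏ i ∈ Sᶜ, u i) * Polynomial.X ^ S.card := by
    simp only [linProd]
    rw [Finset.prod_congr rfl fun i _ => add_comm _ _, Fintype.prod_add]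
    refine Finset.sum_congr rfl fun S _ => ?_
    rw [Finset.prod_mul_distrib, Finset.prod_const, map_mul, map_prod, map_prod]
    ring
  rw [this, Polynomial.finsetSum_coeff, ← Finset.univ_filter_card_eq, Finset.sum_filter]
  refine Finset.sum_congr rfl fun S _ => ?_
  rw [Polynomial.coeff_C_mul_X_pow]
  simp only [eq_comm]

theorem coeff_linProd_eq_zero (u v : Fin 7 → A) {k : ℕ} (hk : 7 < k) :
    (linProd u v).coeff k = 0 := by
  rw [coeff_linProd, Finset.powersetCard_eq_empty.2 (by simpa using hk), Finset.sum_empty]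

theorem septic_zero (u v : Fin 7 → A) : septic u v 0 = 105 * ∏ i, u i := by
  simp [septic, coeff_linProd, nrm]

theorem septic_last (u v : Fin 7 → A) : septic u v 7 = 105 * ∏ i, v i := by
  have : Finset.powersetCard 7 (Finset.univ : Finset (Fin 7)) = {Finset.univ} := by decide
  rw [septic, show ((7 : Fin 8) : ℕ) = 7 from rfl, coeff_linProd, this]
  simp [nrm]

theorem septic_smul (u v : Fin 7 → A) (a b : A) (k : Fin 8) :
    septic (fun i => a * u i) (fun i => b * v i) k =
      a ^ (7 - (k : ℕ)) * b ^ (k : ℕ) * septic u v k := by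
  simp only [septic, coeff_linProd, Finset.mul_sum]
  refine Finset.sum_congr rfl fun S hS => ?_
  have h := (Finset.mem_powersetCard.1 hS).2
  simp only [Finset.prod_mul_distrib, Finset.prod_const, Finset.card_compl, h, Fintype.card_fin]
  ring

theorem septic_rev (u v : Fin 7 → A) (k : Fin 8) : septic v u k = septic u v k.rev := by
  rw [septic, septic, nrm_rev, coeff_linProd, coeff_linProd]
  congr 1
  refine Finset.sum_bij' (fun S _ => Sᶜ) (fun S _ => Sᶜ) ?_ ?_ ?_ ?_ ?_
  · intro S hS
    have h := (Finset.mem_powersetCard.1 hS).2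
    refine Finset.mem_powersetCard.2 ⟨Finset.subset_univ _, ?_⟩
    rw [Finset.card_compl, h, Fin.val_rev, Fintype.card_fin]; omega
  · intro S hS
    have h := (Finset.mem_powersetCard.1 hS).2
    refine Finset.mem_powersetCard.2 ⟨Finset.subset_univ _, ?_⟩
    rw [Finset.card_compl, h, Fin.val_rev, Fintype.card_fin]; omega
  · simp
  · simp
  · intro S _
    simp [mul_comm]

theorem pt_smul (ρ : Fin 7 → A) (p q r s a b : A) (k : Fin 8) :
    pt ρ (a * p) (b * q) (a * r) (b * s) k =
      a ^ (7 - (k : ℕ)) * b ^ (k : ℕ) * pt ρ p q r s k := by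
  rw [pt, pt, ← septic_smul]
  congr 1 <;> ext i <;> ring

theorem pt_rev (ρ : Fin 7 → A) (p q r s : A) (k : Fin 8) :
    pt ρ q p s r k = pt ρ p q r s k.rev := septic_rev _ _ _

/-- A derivation sending `u i` to `v i` and killing `v i` raises coefficients. -/
theorem deriv_septic_raise {A : Type*} [CommRing A] (δ : Derivation ℤ A A) (u v : Fin 7 → A)
    (hu : ∀ i, δ (u i) = v i) (hv : ∀ i, δ (v i) = 0) (k : Fin 8) :
    δ (septic u v k) = ((7 - (k : ℕ) : ℕ) : A) * septic u v (k + 1) := by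
  have key : ∀ k, δ ((linProd u v).coeff k) = (Polynomial.derivative (linProd u v)).coeff k := by
    unfold linProd
    refine Finset.prod_induction _ (fun P : Polynomial A =>
      ∀ k, δ (P.coeff k) = (Polynomial.derivative P).coeff k) ?_ ?_ ?_
    · intro P Q hP hQ k
      rw [Polynomial.derivative_mul, Polynomial.coeff_add, Polynomial.coeff_mul,
        Polynomial.coeff_mul, Polynomial.coeff_mul, map_sum, ← Finset.sum_add_distrib]
      refine Finset.sum_congr rfl fun x _ => ?_
      rw [Derivation.leibniz, hP, hQ, smul_eq_mul, smul_eq_mul]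
      ring
    · intro k
      rw [Polynomial.coeff_one]
      split_ifs <;> simp
    · intro i _ k
      rcases k with _ | _ | k
      · simp [hu]
      · simp [Polynomial.coeff_C, hv]
      · simp
  have e : δ (septic u v k) = nrm k * δ ((linProd u v).coeff k) := by
    simp [septic, Derivation.leibniz]
  rw [e, key, Polynomial.coeff_derivative]
  by_cases hk : k = 7
  · subst hk
    rw [coeff_linProd_eq_zero _ _ (by decide)]
    simp
  · have h1 := nrm_succ k hk
    have h2 : ((k + 1 : Fin 8) : ℕ) = k + 1 := by
      clear h1 e
      revert k; decide
    rw [septic, h2]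
    have h3 : (nrm k : A) * ((k : ℕ) + 1) = ((7 - (k : ℕ) : ℕ) : A) * nrm (k + 1) := by
      exact_mod_cast congrArg (Nat.cast : ℕ → A) h1
    linear_combination ((linProd u v).coeff ((k : ℕ) + 1)) * h3

theorem deriv_septic_lower {A : Type*} [CommRing A] (δ : Derivation ℤ A A) (u v : Fin 7 → A)
    (hu : ∀ i, δ (u i) = 0) (hv : ∀ i, δ (v i) = u i) (k : Fin 8) :
    δ (septic u v k) = ((k : ℕ) : A) * septic u v (k - 1) := by
  have e : septic u v = fun k => septic v u k.rev := by
    ext k; rw [septic_rev v u]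
  rw [e]
  simp only
  rw [deriv_septic_raise δ v u hv hu, show (7 - (k.rev : ℕ) : ℕ) = k by
    rw [Fin.val_rev]; omega]
  congr 2
  revert k; decide
end Points

theorem mem_monSet {m : ℕ} {w : ℤ} {d : Fin 8 →₀ ℕ} :
    d ∈ monSet m w ↔ ∑ k, d k = m ∧ ∑ k, (d k : ℤ) * ((k : ℕ) : ℤ) = w := Iff.rfl

theorem mem_Pol {m : ℕ} {w : ℤ} {f : MvPolynomial (Fin 8) ℂ} :
    f ∈ Pol m w ↔ ∀ d, coeff d f ≠ 0 → d ∈ monSet m w := by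
  rw [Pol, mem_restrictSupport_iff]
  simp [Set.subset_def]

theorem monomial_mem_Pol {m : ℕ} {w : ℤ} {d : Fin 8 →₀ ℕ} (hd : d ∈ monSet m w) (c : ℂ) :
    monomial d c ∈ Pol m w := by
  rw [Pol, monomial_mem_restrictSupport]; exact Or.inl hd

theorem Pol_induction {m : ℕ} {w : ℤ} {P : MvPolynomial (Fin 8) ℂ → Prop}
    (h0 : P 0) (hadd : ∀ f g, P f → P g → P (f + g))
    (hm : ∀ d ∈ monSet m w, ∀ c, P (monomial d c)) {f : MvPolynomial (Fin 8) ℂ}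
    (hf : f ∈ Pol m w) : P f := by
  rw [f.as_sum]
  refine Finset.sum_induction _ P hadd h0 fun d hd => ?_
  exact hm d (mem_Pol.1 hf d (mem_support_iff.1 hd)) _

theorem monSet_add {m n : ℕ} {w u : ℤ} {d e : Fin 8 →₀ ℕ} (hd : d ∈ monSet m w)
    (he : e ∈ monSet n u) : d + e ∈ monSet (m + n) (w + u) := by
  rw [mem_monSet] at *
  simp only [Finsupp.add_apply, Finset.sum_add_distrib, Nat.cast_add, add_mul]
  exact ⟨by rw [hd.1, he.1], by rw [hd.2, he.2]⟩

theorem single_mem_monSet (k : Fin 8) : Finsupp.single k 1 ∈ monSet 1 ((k : ℕ) : ℤ) := by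
  rw [mem_monSet]
  constructor
  · simp [Finsupp.single_apply]
  · simp [Finsupp.single_apply]

theorem mul_mem_Pol {m n : ℕ} {w u : ℤ} {f g : MvPolynomial (Fin 8) ℂ} (hf : f ∈ Pol m w)
    (hg : g ∈ Pol n u) : f * g ∈ Pol (m + n) (w + u) := by
  refine Pol_induction (P := fun f => f * g ∈ Pol (m + n) (w + u)) (by simp)
    (fun f f' h h' => by rw [add_mul]; exact add_mem h h') (fun d hd c => ?_) hf
  refine Pol_induction (P := fun g => monomial d c * g ∈ Pol (m + n) (w + u)) (by simp)
    (fun f f' h h' => by rw [mul_add]; exact add_mem h h') (fun e he c' => ?_) hg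
  rw [monomial_mul]
  exact monomial_mem_Pol (monSet_add hd he) _

theorem X_mem_Pol (k : Fin 8) : (X k : MvPolynomial (Fin 8) ℂ) ∈ Pol 1 ((k : ℕ) : ℤ) :=
  monomial_mem_Pol (single_mem_monSet k) 1

theorem X_mul_mem_Pol {m : ℕ} {w : ℤ} (k : Fin 8) {f : MvPolynomial (Fin 8) ℂ}
    (hf : f ∈ Pol m (w - (k : ℕ))) : X k * f ∈ Pol (m + 1) w := by
  have := mul_mem_Pol (X_mem_Pol k) hf
  rwa [add_comm 1 m, add_sub_cancel] at this

theorem aeval_scale {A : Type*} [CommRing A] [Algebra ℂ A] {m : ℕ} {w : ℕ} (a b : A) (v : Fin 8 → A)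
    {f : MvPolynomial (Fin 8) ℂ} (hf : f ∈ Pol m w) :
    aeval (fun k : Fin 8 => a * b ^ (k : ℕ) * v k) f = a ^ m * b ^ w * aeval v f := by
  refine Pol_induction (P := fun f => aeval (fun k : Fin 8 => a * b ^ (k : ℕ) * v k) f =
    a ^ m * b ^ w * aeval v f) (by simp) (fun f g h h' => by
      rw [map_add, map_add, h, h', mul_add]) (fun d hd c => ?_) hf
  rw [aeval_monomial, aeval_monomial, Finsupp.prod_fintype _ _ (by simp),
    Finsupp.prod_fintype _ _ (by simp)]
  simp only [mul_pow, Finset.prod_mul_distrib]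
  rw [mem_monSet] at hd
  have h2 : ∑ k : Fin 8, (k : ℕ) * d k = w := by
    have := hd.2
    rw [Finset.sum_congr rfl fun (k : Fin 8) _ => mul_comm (k : ℕ) (d k)]
    exact_mod_cast this
  rw [Finset.prod_pow_eq_pow_sum, hd.1]
  simp only [← pow_mul]
  rw [Finset.prod_pow_eq_pow_sum, h2]
  ring

/-- The component of a polynomial of degree `m` and weight `w`. -/
noncomputable def proj (m w : ℕ) : MvPolynomial (Fin 8) ℂ →ₗ[ℂ] MvPolynomial (Fin 8) ℂ :=
  weightedHomogeneousComponent (fun k : Fin 8 => (k : ℕ)) w ∘ₗ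
    weightedHomogeneousComponent (fun _ : Fin 8 => 1) m

open Classical in
theorem coeff_proj (m w : ℕ) (f : MvPolynomial (Fin 8) ℂ) (d : Fin 8 →₀ ℕ) :
    coeff d (proj m w f) = if d ∈ monSet m w then coeff d f else 0 := by
  have h1 : Finsupp.weight (fun _ : Fin 8 => 1) d = ∑ k, d k := by
    rw [Finsupp.weight_apply, Finsupp.sum_fintype _ _ (by simp)]; simp
  have h2 : Finsupp.weight (fun k : Fin 8 => (k : ℕ)) d = ∑ k, d k * (k : ℕ) := by
    rw [Finsupp.weight_apply, Finsupp.sum_fintype _ _ (by simp)]; simp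
  rw [proj, LinearMap.comp_apply, coeff_weightedHomogeneousComponent,
    coeff_weightedHomogeneousComponent, h1, h2, mem_monSet, ← ite_and]
  have h3 : (∑ k, d k * (k : ℕ) = w ∧ ∑ k, d k = m) ↔
      ∑ k, d k = m ∧ ∑ k, (d k : ℤ) * ((k : ℕ) : ℤ) = w := by
    rw [and_comm]; norm_cast
  by_cases h : ∑ k, d k * (k : ℕ) = w ∧ ∑ k, d k = m
  · rw [if_pos h, if_pos (h3.1 h)]
  · rw [if_neg h, if_neg (fun h' => h (h3.2 h'))]

theorem proj_mem (m w : ℕ) (f : MvPolynomial (Fin 8) ℂ) : proj m w f ∈ Pol m w := by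
  classical
  rw [mem_Pol]
  intro d hd
  rw [coeff_proj] at hd
  by_contra h
  exact hd (if_neg h)

theorem proj_of_mem {m w : ℕ} {f : MvPolynomial (Fin 8) ℂ} (hf : f ∈ Pol m w) :
    proj m w f = f := by
  classical
  ext d
  rw [coeff_proj]
  split_ifs with h
  · rfl
  · by_contra h'
    exact h (mem_Pol.1 hf d (Ne.symm h'))

theorem proj_of_mem_ne {m w : ℕ} {m' : ℕ} {w' : ℤ} {f : MvPolynomial (Fin 8) ℂ}
    (hf : f ∈ Pol m' w') (hne : m ≠ m' ∨ (w : ℤ) ≠ w') : proj m w f = 0 := by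
  classical
  ext d
  rw [coeff_proj, coeff_zero]
  split_ifs with h
  · by_contra h'
    have h2 := mem_Pol.1 hf d h'
    rw [mem_monSet] at h h2
    rcases hne with h3 | h3
    · exact h3 (h.1.symm.trans h2.1)
    · exact h3 (h.2.symm.trans h2.2)
  · rfl

theorem proj_X_mul (m w : ℕ) (k : Fin 8) (f : MvPolynomial (Fin 8) ℂ) :
    proj (m + 1) w (X k * f) = if (k : ℕ) ≤ w then X k * proj m (w - k) f else 0 := by
  induction f using MvPolynomial.induction_on' with
  | add f g hf hg =>
    rw [mul_add, map_add, hf, hg]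
    split_ifs
    · rw [map_add, mul_add]
    · rw [add_zero]
  | monomial d a =>
    have hd : d ∈ monSet (∑ k, d k) (∑ k, (d k : ℤ) * ((k : ℕ) : ℤ)) := ⟨rfl, rfl⟩
    have h1 := monomial_mem_Pol hd a
    have h2 := mul_mem_Pol (X_mem_Pol k) h1
    by_cases h : (m = ∑ k, d k) ∧ (w : ℤ) = ((k : ℕ) : ℤ) + ∑ k, (d k : ℤ) * ((k : ℕ) : ℤ)
    · have h3 : (0 : ℤ) ≤ ∑ k, (d k : ℤ) * ((k : ℕ) : ℤ) :=
        Finset.sum_nonneg fun k _ => by positivity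
      rw [if_pos (by omega), proj_of_mem, proj_of_mem]
      · have h5 : ((w - (k : ℕ) : ℕ) : ℤ) = ∑ k, (d k : ℤ) * ((k : ℕ) : ℤ) := by omega
        rw [h.1, h5]
        exact h1
      · rw [h.1, h.2, add_comm _ 1]
        exact h2
    · rw [not_and_or] at h
      rw [proj_of_mem_ne h2 (h.imp (by omega) id)]
      split_ifs with h4
      · rw [proj_of_mem_ne h1 (h.imp id (by omega)), mul_zero]
      · rfl

theorem proj_zero_X_mul (w : ℕ) (k : Fin 8) (f : MvPolynomial (Fin 8) ℂ) :
    proj 0 w (X k * f) = 0 := by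
  induction f using MvPolynomial.induction_on' with
  | add f g hf hg => rw [mul_add, map_add, hf, hg, add_zero]
  | monomial d a =>
    have hd : d ∈ monSet (∑ k, d k) (∑ k, (d k : ℤ) * ((k : ℕ) : ℤ)) := ⟨rfl, rfl⟩
    exact proj_of_mem_ne (mul_mem_Pol (X_mem_Pol k) (monomial_mem_Pol hd a)) (by omega)

theorem sum_proj {m : ℕ} {f : MvPolynomial (Fin 8) ℂ} (hf : f.IsHomogeneous m) :
    ∑ w ∈ Finset.range (7 * m + 1), proj m w f = f := by
  classical
  ext d
  rw [coeff_sum]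
  simp only [coeff_proj]
  by_cases h : coeff d f = 0
  · simp [h]
  have h1 : ∑ k, d k = m := by
    have := hf h
    rw [Finsupp.weight_apply, Finsupp.sum_fintype _ _ (by simp)] at this
    simpa using this
  rw [Finset.sum_eq_single (∑ k, d k * (k : ℕ))]
  · rw [if_pos]
    exact ⟨h1, by norm_cast⟩
  · intro b _ hb
    rw [if_neg]
    rintro ⟨_, h2⟩
    exact hb (by exact_mod_cast h2.symm)
  · intro hb
    refine absurd (Finset.mem_range.2 (Nat.lt_succ_of_le ?_)) hb
    rw [← h1, Finset.mul_sum]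
    refine Finset.sum_le_sum fun k _ => ?_
    rw [mul_comm]
    exact Nat.mul_le_mul_right _ (by omega)

theorem Pol_le_homogeneous (m : ℕ) (w : ℤ) : Pol m w ≤ homogeneousSubmodule (Fin 8) ℂ m := by
  intro f hf
  rw [mem_homogeneousSubmodule]
  intro d hd
  rw [Finsupp.weight_apply, Finsupp.sum_fintype _ _ (by simp)]
  simpa using (mem_Pol.1 hf d hd).1

/-- The dimension of a subspace compatible with the weight decomposition. -/
theorem finrank_eq_sum {m : ℕ} (S : Submodule ℂ (MvPolynomial (Fin 8) ℂ))
    (h1 : S ≤ homogeneousSubmodule (Fin 8) ℂ m)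
    (h2 : ∀ f ∈ S, ∀ w, proj m w f ∈ S) :
    finrank ℂ S = ∑ w ∈ Finset.range (7 * m + 1),
      finrank ℂ (S ⊓ Pol m w : Submodule ℂ (MvPolynomial (Fin 8) ℂ)) := by
  let T : S →ₗ[ℂ] ((w : Fin (7 * m + 1)) →
      (S ⊓ Pol m (w : ℕ) : Submodule ℂ (MvPolynomial (Fin 8) ℂ))) :=
    LinearMap.pi fun w => ((proj m w).comp S.subtype).codRestrict _
      fun f => ⟨h2 f f.2 w, proj_mem m w f⟩
  have hT : Function.Bijective T := by
    constructor
    · rw [← LinearMap.ker_eq_bot, LinearMap.ker_eq_bot']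
      intro f hf
      ext1
      rw [← sum_proj (h1 f.2), ZeroMemClass.coe_zero]
      refine Finset.sum_eq_zero fun w hw => ?_
      exact congrArg Subtype.val (congrFun hf ⟨w, Finset.mem_range.1 hw⟩)
    · intro g
      refine ⟨⟨∑ w, (g w : MvPolynomial (Fin 8) ℂ), sum_mem fun w _ => (g w).2.1⟩, ?_⟩
      ext1 w
      ext1
      change proj m w (∑ w, (g w : MvPolynomial (Fin 8) ℂ)) = g w
      rw [map_sum, Finset.sum_eq_single w, proj_of_mem (g w).2.2]
      · intro b _ hb
        refine proj_of_mem_ne (g b).2.2 (Or.inr ?_)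
        rw [Ne, Nat.cast_inj]
        exact fun h => hb (Fin.ext h.symm)
      · simp
  have i1 (w : ℕ) : FiniteDimensional ℂ (S ⊓ Pol m w : Submodule ℂ (MvPolynomial (Fin 8) ℂ)) :=
    Submodule.finiteDimensional_of_le inf_le_right
  rw [(LinearEquiv.ofBijective T hT).finrank_eq, Module.finrank_pi_fintype,
    Fin.sum_univ_eq_sum_range
      (fun w => finrank ℂ (S ⊓ Pol m w : Submodule ℂ (MvPolynomial (Fin 8) ℂ)))]

section Form
variable (u v : Fin 7 → ℂ)

theorem prod_form_eq_sum :
    ∏ i, (C (u i) * X 0 + C (v i) * X 1 : MvPolynomial (Fin 2) ℂ) =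
      ∑ k : Fin 8, C ((linProd u v).coeff k) * (X 0 ^ (7 - (k : ℕ)) * X 1 ^ (k : ℕ)) := by
  rw [Finset.prod_congr rfl fun i _ => add_comm _ _, Fintype.prod_add,
    Fin.sum_univ_eq_sum_range
      (fun k => C ((linProd u v).coeff k) *
        (X 0 ^ (7 - k) * X 1 ^ k : MvPolynomial (Fin 2) ℂ)) 8]
  have e (k : ℕ) : C ((linProd u v).coeff k) * (X 0 ^ (7 - k) * X 1 ^ k) =
      ∑ S ∈ Finset.powersetCard k Finset.univ,
        (∏ i ∈ S, (C (v i) * X 1 : MvPolynomial (Fin 2) ℂ)) * ∏ i ∈ Sᶜ, (C (u i) * X 0) := by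
    rw [coeff_linProd, map_sum, Finset.sum_mul]
    refine Finset.sum_congr rfl fun S hS => ?_
    have h := (Finset.mem_powersetCard.1 hS).2
    simp only [Finset.prod_mul_distrib, Finset.prod_const, Finset.card_compl, h,
      Fintype.card_fin, map_mul, map_prod]
    ring
  rw [Finset.sum_congr rfl fun k _ => e k, ← Finset.powerset_univ, Finset.sum_powerset]
  simp

theorem coeff_prod_form (k : Fin 8) :
    coeff (Finsupp.single (0 : Fin 2) (7 - (k : ℕ)) + Finsupp.single (1 : Fin 2) (k : ℕ))
      (∏ i, (C (u i) * X 0 + C (v i) * X 1 : MvPolynomial (Fin 2) ℂ)) =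
      (linProd u v).coeff k := by
  rw [prod_form_eq_sum, coeff_sum, Finset.sum_eq_single k]
  · rw [coeff_C_mul, X_pow_eq_monomial, X_pow_eq_monomial, monomial_mul, coeff_monomial,
      if_pos rfl]
    simp
  · intro j _ hj
    rw [coeff_C_mul, X_pow_eq_monomial, X_pow_eq_monomial, monomial_mul, coeff_monomial, if_neg]
    · simp
    · intro h
      have := DFunLike.congr_fun h 1
      simp at this
      exact hj (Fin.ext this)
  · simp

end Form

/-- The points of the cone over the closure of the orbit of `105 ∏ i, (x₁ - ρ i x₂)`. -/
def Z0 (ρ : Fin 7 → ℂ) : Set (Fin 8 → ℂ) := {z | ∃ p q r s, z = pt ρ p q r s}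

theorem toForm_pt (ρ : Fin 7 → ℂ) (c : ℂ) :
    toForm 7 (fun k => c * pt ρ 1 0 0 1 k) =
      C (105 * c) * ∏ i, (C 1 * X 0 + C (-ρ i) * X 1) := by
  have h := prod_form_eq_sum (fun _ => 1) (fun i => -ρ i)
  rw [h, toForm, Finset.mul_sum]
  refine Finset.sum_congr rfl fun k _ => ?_
  rw [← mul_assoc (C (105 * c)), ← C_mul]
  congr 2
  have aux (x y z : ℂ) (h : y * x = 105) : x * (c * (y * z)) = 105 * c * z := by
    linear_combination (c * z) * h
  have h2 : (nrm k : ℂ) * (Nat.choose 7 k : ℕ) = 105 := by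
    exact_mod_cast congrArg (Nat.cast : ℕ → ℂ) (nrm_mul_choose k)
  rw [pt, septic]
  simp only [mul_zero, sub_zero, mul_one, zero_sub]
  exact aux _ _ _ h2

theorem substAction_factor (g : SL2) (a b : ℂ) :
    substAction g (C a * X 0 + C b * X 1) =
      C (a * g.1 0 0 + b * g.1 1 0) * X 0 + C (a * g.1 0 1 + b * g.1 1 1) * X 1 := by
  rw [substAction, map_add, map_mul, map_mul, algHom_C, algHom_C, aeval_X, aeval_X, algebraMap_eq,
    C_add, C_add, C_mul, C_mul, C_mul, C_mul]
  ring

theorem substAction_prod (g : SL2) (a : ℂ) (u v : Fin 7 → ℂ) :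
    substAction g (C a * ∏ i, (C (u i) * X 0 + C (v i) * X 1)) =
      C a * ∏ i, (C (u i * g.1 0 0 + v i * g.1 1 0) * X 0 +
        C (u i * g.1 0 1 + v i * g.1 1 1) * X 1) := by
  simp only [← substAction_factor]
  rw [substAction, map_mul, map_prod, algHom_C, algebraMap_eq]
  rfl

theorem substAction_pt (ρ : Fin 7 → ℂ) (c : ℂ) (g : SL2) :
    substAction g (toForm 7 (fun k => c * pt ρ 1 0 0 1 k)) =
      C (105 * c) * ∏ i, (C (g.1 0 0 - ρ i * g.1 1 0) * X 0 +
        C (g.1 0 1 - ρ i * g.1 1 1) * X 1) := by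
  rw [toForm_pt, substAction_prod g (105 * c) (fun _ => 1) (fun i => -ρ i)]
  simp only [one_mul, neg_mul, sub_eq_add_neg]

theorem actCoeff_pt (ρ : Fin 7 → ℂ) (c : ℂ) (g : SL2) (k : Fin (7 + 1)) :
    actCoeff 7 g (fun k => c * pt ρ 1 0 0 1 k) k =
      c * pt ρ (g.1 0 0) (g.1 0 1) (g.1 1 0) (g.1 1 1) k := by
  have h := coeff_prod_form (fun i => g.1 0 0 - ρ i * g.1 1 0)
    (fun i => g.1 0 1 - ρ i * g.1 1 1) k
  rw [actCoeff, substAction_pt, coeff_C_mul, h, pt, septic, div_eq_iff]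
  · have aux (x y z : ℂ) (h : y * x = 105) : 105 * c * z = c * (y * z) * x := by
      linear_combination (-c * z) * h
    have h2 : (nrm k : ℂ) * (Nat.choose 7 k : ℕ) = 105 := by
      exact_mod_cast congrArg (Nat.cast : ℕ → ℂ) (nrm_mul_choose k)
    exact aux _ _ _ h2
  · exact_mod_cast (Nat.choose_pos (by omega)).ne'

/-- A polynomial vanishing off the zeros of a nonzero polynomial is zero. -/
theorem eq_zero_of_generic {F G : Polynomial ℂ} (hG : G ≠ 0)
    (h : ∀ t, G.eval t ≠ 0 → F.eval t = 0) : F = 0 := by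
  have : F * G = 0 := by
    refine Polynomial.funext fun t => ?_
    rw [Polynomial.eval_mul, Polynomial.eval_zero]
    by_cases ht : G.eval t = 0
    · rw [ht, mul_zero]
    · rw [h t ht, zero_mul]
  exact (mul_eq_zero.1 this).resolve_right hG

theorem eval_aeval (v : Fin 8 → Polynomial ℂ) (t : ℂ) (f : MvPolynomial (Fin 8) ℂ) :
    (aeval v f).eval t = aeval (fun k => (v k).eval t) f := by
  rw [← Polynomial.coe_aeval_eq_eval, ← AlgHom.comp_apply, comp_aeval]

/-- A polynomial family of points. -/
noncomputable def ptPoly (ρ : Fin 7 → ℂ) (p q r s : Polynomial ℂ) : Fin 8 → Polynomial ℂ :=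
  pt (fun i => Polynomial.C (ρ i)) p q r s

theorem eval_aeval_ptPoly (ρ : Fin 7 → ℂ) (p q r s : Polynomial ℂ) (t : ℂ)
    (f : MvPolynomial (Fin 8) ℂ) :
    (aeval (ptPoly ρ p q r s) f).eval t =
      aeval (pt ρ (p.eval t) (q.eval t) (r.eval t) (s.eval t)) f := by
  rw [eval_aeval]
  congr 2
  ext k
  rw [ptPoly, ← Polynomial.coe_evalRingHom, map_pt]
  simp

/-- A polynomial vanishing at `pt ρ p q r s` for generic parameters vanishes everywhere. -/
theorem aeval_pt_eq_zero (ρ : Fin 7 → ℂ) {f : MvPolynomial (Fin 8) ℂ}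
    (h : ∀ p q r s, p ≠ 0 → p * s - q * r ≠ 0 → aeval (pt ρ p q r s) f = 0) (p q r s : ℂ) :
    aeval (pt ρ p q r s) f = 0 := by
  have key : aeval (ptPoly ρ (Polynomial.X + Polynomial.C p) (Polynomial.C q) (Polynomial.C r)
      (Polynomial.X + Polynomial.C s)) f = 0 := by
    refine eq_zero_of_generic (G := (Polynomial.X + Polynomial.C p) *
      (Polynomial.X ^ 2 + Polynomial.C (p + s) * Polynomial.X + Polynomial.C (p * s - q * r)))
      (mul_ne_zero (Polynomial.X_add_C_ne_zero p) ?_) fun t ht => ?_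
    · intro h0
      have := congrArg (fun P => Polynomial.coeff P 2) h0
      simp at this
    · rw [eval_aeval_ptPoly]
      rw [Polynomial.eval_mul] at ht
      refine h _ _ _ _ ?_ ?_
      · simpa using left_ne_zero_of_mul ht
      · have := right_ne_zero_of_mul ht
        intro h0
        apply this
        simp at h0 ⊢
        linear_combination h0
  have := eval_aeval_ptPoly ρ (Polynomial.X + Polynomial.C p) (Polynomial.C q) (Polynomial.C r)
      (Polynomial.X + Polynomial.C s) 0 f
  rw [key] at this
  simpa using this.symm

theorem exists_pow_seven (a : ℂ) : ∃ c : ℂ, c ^ 7 = a :=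
  IsAlgClosed.exists_pow_nat_eq a (by norm_num)

theorem smul_pt_mem (ρ : Fin 7 → ℂ) (a b p q r s : ℂ) :
    ∃ c, (fun k : Fin 8 => a * b ^ (k : ℕ) * pt ρ p q r s k) =
      pt ρ (c * p) (c * b * q) (c * r) (c * b * s) := by
  obtain ⟨c, hc⟩ := exists_pow_seven a
  refine ⟨c, funext fun k => ?_⟩
  rw [pt_smul, mul_pow, ← mul_assoc, ← pow_add, Nat.sub_add_cancel (by omega), hc]

theorem orbitIdeal_eq (ρ : Fin 7 → ℂ) {c : ℂ} (hc : c ≠ 0) :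
    orbitIdeal 7 (fun k => c * pt ρ 1 0 0 1 k) = vanishingIdeal ℂ (Z0 ρ) := by
  have h0 (f : MvPolynomial (Fin 8) ℂ) : f ∈ orbitIdeal 7 (fun k => c * pt ρ 1 0 0 1 k) ↔
      ∀ v ∈ orbitCone 7 (fun k => c * pt ρ 1 0 0 1 k), eval v f = 0 :=
    ⟨fun h v hv => h v fun g hg => hg v hv, fun h v hv => hv f h⟩
  ext f
  rw [h0, mem_vanishingIdeal_iff]
  constructor
  · rintro h _ ⟨p, q, r, s, rfl⟩
    refine aeval_pt_eq_zero ρ (fun p q r s _ hd => ?_) p q r s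
    obtain ⟨e, he⟩ := IsAlgClosed.exists_pow_nat_eq (p * s - q * r) (n := 2) (by norm_num)
    have he0 : e ≠ 0 := by rintro rfl; exact hd (by simpa using he.symm)
    have hdet : (!![p / e, q / e; r / e, s / e] : Matrix (Fin 2) (Fin 2) ℂ).det = 1 := by
      rw [Matrix.det_fin_two_of]; field_simp; exact he.symm
    have := h (fun k => pt ρ p q r s k) ⟨e ^ 7 / c, (⟨_, hdet⟩ : SL2), ?_⟩
    · rw [aeval_eq_eval]; exact this
    · ext k
      rw [Pi.smul_apply, smul_eq_mul]
      refine Eq.trans ?_ (congrArg _ (actCoeff_pt ρ c (⟨_, hdet⟩ : SL2) k).symm)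
      have e1 := pt_smul ρ (p / e) (q / e) (r / e) (s / e) e e k
      rw [← pow_add, Nat.sub_add_cancel (by omega)] at e1
      simp only [mul_div_cancel₀ _ he0] at e1
      rw [e1]
      simp
      field_simp
  · rintro h _ ⟨a, g, rfl⟩
    obtain ⟨d, hd⟩ := smul_pt_mem ρ (a * c) 1 (g.1 0 0) (g.1 0 1) (g.1 1 0) (g.1 1 1)
    rw [← aeval_eq_eval]
    refine h _ ⟨_, _, _, _, Eq.trans ?_ hd⟩
    ext k
    rw [Pi.smul_apply, actCoeff_pt, smul_eq_mul]
    ring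

/-- The polynomials of degree `m` and weight `w` vanishing on `Z`. -/
noncomputable def Van (Z : Set (Fin 8 → ℂ)) (m : ℕ) (w : ℤ) :
    Submodule ℂ (MvPolynomial (Fin 8) ℂ) :=
  (vanishingIdeal ℂ Z).restrictScalars ℂ ⊓ Pol m w

theorem mem_Van {Z : Set (Fin 8 → ℂ)} {m : ℕ} {w : ℤ} {f : MvPolynomial (Fin 8) ℂ} :
    f ∈ Van Z m w ↔ (∀ z ∈ Z, aeval z f = 0) ∧ f ∈ Pol m w := Iff.rfl

theorem Van_le_Pol (Z : Set (Fin 8 → ℂ)) (m : ℕ) (w : ℤ) : Van Z m w ≤ Pol m w := inf_le_right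

instance (Z : Set (Fin 8 → ℂ)) (m : ℕ) (w : ℤ) : FiniteDimensional ℂ (Van Z m w) :=
  Submodule.finiteDimensional_of_le (Van_le_Pol Z m w)

theorem X_mul_mem_Van {Z : Set (Fin 8 → ℂ)} {m : ℕ} {w : ℤ} (k : Fin 8)
    {f : MvPolynomial (Fin 8) ℂ} (hf : f ∈ Van Z m (w - (k : ℕ))) : X k * f ∈ Van Z (m + 1) w :=
  ⟨fun z hz => by rw [map_mul, hf.1 z hz, mul_zero], X_mul_mem_Pol k hf.2⟩

/-- `g ↦ ∑ a_k g_k`. -/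
noncomputable def mulSum : (Fin 8 → MvPolynomial (Fin 8) ℂ) →ₗ[ℂ] MvPolynomial (Fin 8) ℂ :=
  ∑ k, LinearMap.mulLeft ℂ (X k) ∘ₗ LinearMap.proj k

theorem mulSum_apply (g : Fin 8 → MvPolynomial (Fin 8) ℂ) : mulSum g = ∑ k, X k * g k := by
  simp [mulSum]

/-- The part of `Van Z m w` generated by lower degree. -/
noncomputable def Dec (Z : Set (Fin 8 → ℂ)) : ℕ → ℤ → Submodule ℂ (MvPolynomial (Fin 8) ℂ)
  | 0, _ => ⊥
  | m + 1, w => (Submodule.pi Set.univ fun k : Fin 8 => Van Z m (w - (k : ℕ))).map mulSum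

theorem mem_Dec_succ {Z : Set (Fin 8 → ℂ)} {m : ℕ} {w : ℤ} {f : MvPolynomial (Fin 8) ℂ} :
    f ∈ Dec Z (m + 1) w ↔
      ∃ g : Fin 8 → MvPolynomial (Fin 8) ℂ, (∀ k : Fin 8, g k ∈ Van Z m (w - (k : ℕ))) ∧
        f = ∑ k, X k * g k := by
  simp only [Dec, Submodule.mem_map, Submodule.mem_pi, Set.mem_univ, true_imp_iff, mulSum_apply,
    eq_comm]

theorem Dec_le_Van (Z : Set (Fin 8 → ℂ)) (m : ℕ) (w : ℤ) : Dec Z m w ≤ Van Z m w := by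
  cases m with
  | zero => exact bot_le
  | succ m =>
    intro f hf
    obtain ⟨g, hg, rfl⟩ := mem_Dec_succ.1 hf
    exact sum_mem fun k _ => X_mul_mem_Van k (hg k)

theorem X_mul_mem_Dec {Z : Set (Fin 8 → ℂ)} {m : ℕ} {w : ℤ} (k : Fin 8)
    {f : MvPolynomial (Fin 8) ℂ} (hf : f ∈ Van Z m (w - (k : ℕ))) : X k * f ∈ Dec Z (m + 1) w := by
  classical
  refine mem_Dec_succ.2 ⟨Pi.single k f, fun j => ?_, ?_⟩
  · by_cases h : j = k
    · subst h; simpa using hf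
    · simp [h]
  · rw [Finset.sum_eq_single k]
    · simp
    · intro j _ hj; simp [hj]
    · simp

instance (Z : Set (Fin 8 → ℂ)) (m : ℕ) (w : ℤ) : FiniteDimensional ℂ (Dec Z m w) :=
  Submodule.finiteDimensional_of_le (Dec_le_Van Z m w)

/-- Stability under the torus of weight and degree. -/
def IsTorusStable (Z : Set (Fin 8 → ℂ)) : Prop :=
  ∀ z ∈ Z, ∀ a b : ℂ, a ≠ 0 → b ≠ 0 → (fun k : Fin 8 => a * b ^ (k : ℕ) * z k) ∈ Z

theorem coeff_aeval_weight (v : Fin 8 → ℕ) (z : Fin 8 → ℂ) (n : ℕ) (f : MvPolynomial (Fin 8) ℂ) :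
    (aeval (fun k => Polynomial.C (z k) * Polynomial.X ^ v k) f).coeff n =
      aeval z (weightedHomogeneousComponent v n f) := by
  classical
  induction f using MvPolynomial.induction_on' with
  | add f g hf hg => simp only [map_add, Polynomial.coeff_add, hf, hg]
  | monomial d a =>
    have h : Finsupp.weight v d = ∑ k, d k * v k := by
      rw [Finsupp.weight_apply, Finsupp.sum_fintype _ _ (by simp)]; rfl
    rw [aeval_monomial, Finsupp.prod_fintype _ _ (by simp)]
    simp only [mul_pow, ← pow_mul, Finset.prod_mul_distrib, Finset.prod_pow_eq_pow_sum,
      ← map_pow, ← map_prod]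
    rw [Polynomial.algebraMap_apply, Algebra.algebraMap_self_apply, ← mul_assoc,
      ← Polynomial.C_mul, Polynomial.coeff_C_mul_X_pow]
    simp only [mul_comm (v _)]
    by_cases hn : n = ∑ k, d k * v k
    · rw [if_pos hn, (isWeightedHomogeneous_monomial v d a
        (by rw [h, ← hn])).weightedHomogeneousComponent_same, aeval_monomial,
        Finsupp.prod_fintype _ _ (by simp), Algebra.algebraMap_self_apply]
    · rw [if_neg hn, (isWeightedHomogeneous_monomial v d a h).weightedHomogeneousComponent_ne _
        hn, map_zero]

theorem aeval_component_eq_zero {Z : Set (Fin 8 → ℂ)} (v : Fin 8 → ℕ)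
    (hZ : ∀ z ∈ Z, ∀ t : ℂ, t ≠ 0 → (fun k => z k * t ^ v k) ∈ Z)
    {f : MvPolynomial (Fin 8) ℂ} (hf : ∀ z ∈ Z, aeval z f = 0) (n : ℕ) :
    ∀ z ∈ Z, aeval z (weightedHomogeneousComponent v n f) = 0 := by
  intro z hz
  have h0 : aeval (fun k => Polynomial.C (z k) * Polynomial.X ^ v k) f = 0 := by
    refine eq_zero_of_generic Polynomial.X_ne_zero fun t ht => ?_
    rw [eval_aeval]
    simpa using hf _ (hZ z hz t (by simpa using ht))
  rw [← coeff_aeval_weight, h0, Polynomial.coeff_zero]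

theorem proj_mem_Van {Z : Set (Fin 8 → ℂ)} (hZ : IsTorusStable Z) (m w : ℕ)
    {f : MvPolynomial (Fin 8) ℂ} (hf : f ∈ vanishingIdeal ℂ Z) : proj m w f ∈ Van Z m w := by
  refine ⟨?_, proj_mem m w f⟩
  refine aeval_component_eq_zero _ (fun z hz t ht => ?_)
    (aeval_component_eq_zero _ (fun z hz t ht => ?_) hf m) w
  · simpa [mul_comm] using hZ z hz 1 t one_ne_zero ht
  · simpa [mul_comm] using hZ z hz t 1 ht one_ne_zero

theorem isTorusStable_Z0 (ρ : Fin 7 → ℂ) : IsTorusStable (Z0 ρ) := by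
  rintro _ ⟨p, q, r, s, rfl⟩ a b _ _
  obtain ⟨c, hc⟩ := smul_pt_mem ρ a b p q r s
  exact ⟨_, _, _, _, hc⟩

theorem mem_irrelevant_mul {Z : Set (Fin 8 → ℂ)} {f : MvPolynomial (Fin 8) ℂ} :
    f ∈ irrelevantIdeal 7 * vanishingIdeal ℂ Z ↔
      ∃ g : Fin 8 → MvPolynomial (Fin 8) ℂ, (∀ k, g k ∈ vanishingIdeal ℂ Z) ∧
        f = ∑ k, X k * g k := by
  constructor
  · intro hf
    refine Submodule.mul_induction_on hf ?_ ?_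
    · intro a ha b hb
      rw [irrelevantIdeal, Ideal.mem_span_range_iff_exists_fun] at ha
      obtain ⟨c, rfl⟩ := ha
      refine ⟨fun k => c k * b, fun k => Ideal.mul_mem_left _ _ hb, ?_⟩
      rw [Finset.sum_mul]
      exact Finset.sum_congr rfl fun k _ => by ring
    · rintro _ _ ⟨g, hg, rfl⟩ ⟨g', hg', rfl⟩
      refine ⟨g + g', fun k => add_mem (hg k) (hg' k), ?_⟩
      rw [← Finset.sum_add_distrib]
      exact Finset.sum_congr rfl fun k _ => by rw [Pi.add_apply, mul_add]
  · rintro ⟨g, hg, rfl⟩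
    exact sum_mem fun k _ => Ideal.mul_mem_mul (Ideal.subset_span ⟨k, rfl⟩) (hg k)

theorem proj_mem_Dec {Z : Set (Fin 8 → ℂ)} (hZ : IsTorusStable Z) (m w : ℕ)
    {f : MvPolynomial (Fin 8) ℂ} (hf : f ∈ irrelevantIdeal 7 * vanishingIdeal ℂ Z) :
    proj m w f ∈ Dec Z m w := by
  obtain ⟨g, hg, rfl⟩ := mem_irrelevant_mul.1 hf
  rw [map_sum]
  refine sum_mem fun k _ => ?_
  cases m with
  | zero => rw [proj_zero_X_mul]; exact zero_mem _
  | succ m =>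
    rw [proj_X_mul]
    split_ifs with h
    · refine X_mul_mem_Dec k ?_
      rw [← Nat.cast_sub h]
      exact proj_mem_Van hZ _ _ (hg k)
    · exact zero_mem _

theorem Dec_le_irrelevant_mul (Z : Set (Fin 8 → ℂ)) (m : ℕ) (w : ℤ) :
    Dec Z m w ≤ (irrelevantIdeal 7 * vanishingIdeal ℂ Z).restrictScalars ℂ := by
  cases m with
  | zero => exact bot_le
  | succ m =>
    intro f hf
    obtain ⟨g, hg, rfl⟩ := mem_Dec_succ.1 hf
    exact mem_irrelevant_mul.2 ⟨g, fun k => (hg k).1, rfl⟩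

theorem finrank_genPiece {E : Fin 8 → ℂ} {Z : Set (Fin 8 → ℂ)} (hZ : IsTorusStable Z)
    (hE : orbitIdeal 7 E = vanishingIdeal ℂ Z) (m : ℕ) :
    finrank ℂ (genPiece 7 m E) = ∑ w ∈ Finset.range (7 * m + 1), finrank ℂ (Van Z m w) := by
  have h : genPiece 7 m E =
      (vanishingIdeal ℂ Z).restrictScalars ℂ ⊓ homogeneousSubmodule (Fin 8) ℂ m := by
    rw [genPiece, idealPiece, hE]
  rw [h, finrank_eq_sum _ inf_le_right]
  · refine Finset.sum_congr rfl fun w _ => ?_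
    rw [inf_assoc, inf_eq_right.2 (Pol_le_homogeneous m w)]
    rfl
  · intro f hf w
    have := proj_mem_Van hZ m w hf.1
    exact ⟨this.1, Pol_le_homogeneous m w this.2⟩

theorem finrank_trivPiece {E : Fin 8 → ℂ} {Z : Set (Fin 8 → ℂ)} (hZ : IsTorusStable Z)
    (hE : orbitIdeal 7 E = vanishingIdeal ℂ Z) (m : ℕ) :
    finrank ℂ (trivPiece 7 m E) = ∑ w ∈ Finset.range (7 * m + 1), finrank ℂ (Dec Z m w) := by
  have h : trivPiece 7 m E = (irrelevantIdeal 7 * vanishingIdeal ℂ Z).restrictScalars ℂ ⊓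
      homogeneousSubmodule (Fin 8) ℂ m := by
    rw [trivPiece, idealPiece, hE]
  rw [h, finrank_eq_sum _ inf_le_right]
  · refine Finset.sum_congr rfl fun w _ => ?_
    rw [inf_assoc, inf_eq_right.2 (Pol_le_homogeneous m w)]
    have e : (irrelevantIdeal 7 * vanishingIdeal ℂ Z).restrictScalars ℂ ⊓ Pol m w =
        Dec Z m w := by
      ext f
      constructor
      · rintro ⟨h1, h2⟩
        rw [← proj_of_mem h2]
        exact proj_mem_Dec hZ m w h1
      · intro hf
        exact ⟨Dec_le_irrelevant_mul Z m w hf, (Dec_le_Van Z m w hf).2⟩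
    rw [e]
  · intro f hf w
    have := proj_mem_Dec hZ m w hf.1
    exact ⟨Dec_le_irrelevant_mul Z m w this,
      Pol_le_homogeneous m w (Dec_le_Van Z m w this).2⟩

theorem finiteDimensional_homogeneous (m : ℕ) :
    FiniteDimensional ℂ (homogeneousSubmodule (Fin 8) ℂ m) := by
  have : Finite {d : Fin 8 →₀ ℕ | d.degree = m} := by
    refine Set.Finite.to_subtype ?_
    refine ((Set.finite_Iic (fun _ : Fin 8 => m)).preimage
      (f := fun d : Fin 8 →₀ ℕ => (d : Fin 8 → ℕ)) DFunLike.coe_injective.injOn).subset ?_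
    intro d hd k
    rw [← (hd : d.degree = m)]
    exact Finsupp.le_degree k d
  rw [homogeneousSubmodule_eq_finsupp_supported]
  exact Module.Finite.of_basis (basisRestrictSupport ℂ _)

instance (m : ℕ) (E : Fin 8 → ℂ) : FiniteDimensional ℂ (genPiece 7 m E) :=
  have := finiteDimensional_homogeneous m
  Submodule.finiteDimensional_of_le (S₂ := homogeneousSubmodule (Fin 8) ℂ m) inf_le_right

theorem betti_add {E : Fin 8 → ℂ} {Z : Set (Fin 8 → ℂ)} (hZ : IsTorusStable Z)
    (hE : orbitIdeal 7 E = vanishingIdeal ℂ Z) (m : ℕ) :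
    betti 7 m E + ∑ w ∈ Finset.range (7 * m + 1), finrank ℂ (Dec Z m w) =
      ∑ w ∈ Finset.range (7 * m + 1), finrank ℂ (Van Z m w) := by
  rw [← finrank_genPiece hZ hE, ← finrank_trivPiece hZ hE, betti]
  have hle : trivPiece 7 m E ≤ genPiece 7 m E :=
    inf_le_inf_right _ fun _ h => Ideal.mul_le_right h
  have e : finrank ℂ (minGenRel 7 m E) = finrank ℂ (trivPiece 7 m E) := by
    rw [minGenRel]
    exact (Submodule.comapSubtypeEquivOfLe hle).finrank_eq
  rw [← e]
  exact Submodule.finrank_quotient_add_finrank _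

theorem subsingleton_of_betti_eq_zero {E : Fin 8 → ℂ} {m : ℕ} (h : betti 7 m E = 0) :
    Subsingleton (minGenSpace 7 m E) :=
  Module.finrank_zero_iff.1 h

/-- The weight-lowering derivation. -/
noncomputable def lowerD : Derivation ℂ (MvPolynomial (Fin 8) ℂ) (MvPolynomial (Fin 8) ℂ) :=
  mkDerivation ℂ fun k => C ((k : ℕ) : ℂ) * X (k - 1)

/-- The weight-raising derivation. -/
noncomputable def raiseD : Derivation ℂ (MvPolynomial (Fin 8) ℂ) (MvPolynomial (Fin 8) ℂ) :=
  mkDerivation ℂ fun k => C ((7 - (k : ℕ) : ℕ) : ℂ) * X (k + 1)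

/-- The weight derivation. -/
noncomputable def weightD : Derivation ℂ (MvPolynomial (Fin 8) ℂ) (MvPolynomial (Fin 8) ℂ) :=
  mkDerivation ℂ fun k => C (7 - 2 * ((k : ℕ) : ℂ)) * X k

theorem lowerD_X (k : Fin 8) : lowerD (X k) = C ((k : ℕ) : ℂ) * X (k - 1) := by
  rw [lowerD, mkDerivation_X]

theorem raiseD_X (k : Fin 8) : raiseD (X k) = C ((7 - (k : ℕ) : ℕ) : ℂ) * X (k + 1) := by
  rw [raiseD, mkDerivation_X]

theorem weightD_X (k : Fin 8) : weightD (X k) = C (7 - 2 * ((k : ℕ) : ℂ)) * X k := by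
  rw [weightD, mkDerivation_X]

theorem derivation_C_mul (T : Derivation ℂ (MvPolynomial (Fin 8) ℂ) (MvPolynomial (Fin 8) ℂ))
    (c : ℂ) (f : MvPolynomial (Fin 8) ℂ) : T (C c * f) = C c * T f := by
  rw [← smul_eq_C_mul, T.map_smul, smul_eq_C_mul]

theorem lower_raise (f : MvPolynomial (Fin 8) ℂ) :
    lowerD (raiseD f) = raiseD (lowerD f) + weightD f := by
  have h : ⁅lowerD, raiseD⁆ = weightD := by
    refine derivation_ext fun k => ?_
    rw [Derivation.commutator_apply, lowerD_X, raiseD_X, weightD_X, derivation_C_mul,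
      derivation_C_mul, lowerD_X, raiseD_X, add_sub_cancel_right, sub_add_cancel,
      ← mul_assoc, ← mul_assoc, ← C_mul, ← C_mul, ← sub_mul, ← C_sub]
    congr 2
    have e : ∀ k : Fin 8, ((7 - (k : ℕ) : ℕ) : ℤ) * (((k + 1 : Fin 8) : ℕ) : ℤ) -
        ((k : ℕ) : ℤ) * ((7 - ((k - 1 : Fin 8) : ℕ) : ℕ) : ℤ) = 7 - 2 * ((k : ℕ) : ℤ) := by decide
    exact_mod_cast congrArg (Int.cast (R := ℂ)) (e k)
  rw [← h, Derivation.commutator_apply, add_sub_cancel]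

theorem exists_of_mem_monSet {m : ℕ} {w : ℤ} {d : Fin 8 →₀ ℕ} (hd : d ∈ monSet m w) {k : Fin 8}
    (hk : d k ≠ 0) :
    ∃ n, m = n + 1 ∧ ∃ e ∈ monSet n (w - (k : ℕ)), d = e + Finsupp.single k 1 := by
  have e0 : d = (d - Finsupp.single k 1) + Finsupp.single k 1 := by
    rw [tsub_add_cancel_of_le]
    rw [Finsupp.single_le_iff]
    omega
  generalize d - Finsupp.single k 1 = e at e0
  subst e0
  rw [mem_monSet] at hd
  have h1 := mem_monSet.1 (single_mem_monSet k)
  simp only [Finsupp.add_apply, Finset.sum_add_distrib, Nat.cast_add, add_mul, h1] at hd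
  exact ⟨_, hd.1.symm, e, mem_monSet.2 ⟨rfl, by linarith [hd.2]⟩, rfl⟩

theorem mkDerivation_mem_Pol (a : Fin 8 → ℂ) (σ : Fin 8 → Fin 8) (n : ℤ)
    (h : ∀ k, a k ≠ 0 → ((σ k : ℕ) : ℤ) = (k : ℕ) + n) {m : ℕ} {w : ℤ}
    {f : MvPolynomial (Fin 8) ℂ} (hf : f ∈ Pol m w) :
    mkDerivation ℂ (fun k => C (a k) * X (σ k)) f ∈ Pol m (w + n) := by
  refine Pol_induction (P := fun f => mkDerivation ℂ (fun k => C (a k) * X (σ k)) f ∈ Pol m (w + n))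
    (by simp) (fun f g hf hg => by rw [map_add]; exact add_mem hf hg) (fun d hd c => ?_) hf
  rw [mkDerivation_monomial]
  refine Submodule.smul_mem _ _ (sum_mem fun k hk => ?_)
  obtain ⟨m', rfl, e, he, rfl⟩ := exists_of_mem_monSet hd (Finsupp.mem_support_iff.1 hk)
  simp only [add_tsub_cancel_right]
  by_cases ha : a k = 0
  · simp [ha]
  · rw [smul_eq_mul, mul_left_comm, ← smul_eq_C_mul]
    refine Submodule.smul_mem _ _ ?_
    have := mul_mem_Pol (monomial_mem_Pol he (((e + Finsupp.single k 1 : Fin 8 →₀ ℕ) k : ℕ) : ℂ)) (X_mem_Pol (σ k))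
    rwa [h k ha, show w - ((k : ℕ) : ℤ) + ((k : ℕ) + n) = w + n by ring] at this

theorem lowerD_mem_Pol {m : ℕ} {w : ℤ} {f : MvPolynomial (Fin 8) ℂ} (hf : f ∈ Pol m w) :
    lowerD f ∈ Pol m (w - 1) := by
  refine mkDerivation_mem_Pol _ _ (-1) (fun k hk => ?_) hf
  have : k ≠ 0 := by rintro rfl; simp at hk
  clear hk; revert k; decide

theorem raiseD_mem_Pol {m : ℕ} {w : ℤ} {f : MvPolynomial (Fin 8) ℂ} (hf : f ∈ Pol m w) :
    raiseD f ∈ Pol m (w + 1) := by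
  refine mkDerivation_mem_Pol _ _ 1 (fun k hk => ?_) hf
  have : k ≠ 7 := by rintro rfl; simp at hk
  clear hk; revert k; decide

theorem weightD_of_mem {m : ℕ} {w : ℤ} {f : MvPolynomial (Fin 8) ℂ} (hf : f ∈ Pol m w) :
    weightD f = ((7 * m - 2 * w : ℤ) : ℂ) • f := by
  refine Pol_induction (P := fun f => weightD f = ((7 * m - 2 * w : ℤ) : ℂ) • f)
    (by simp) (fun f g hf hg => by rw [map_add, smul_add, hf, hg]) (fun d hd c => ?_) hf
  rw [weightD, mkDerivation_monomial, Finsupp.sum]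
  have e (k) (hk : k ∈ d.support) : monomial (d - Finsupp.single k 1) ((d k : ℕ) : ℂ) •
      (C (7 - 2 * ((k : ℕ) : ℂ)) * X k) =
      monomial d ((d k : ℂ) * (7 - 2 * ((k : ℕ) : ℂ))) := by
    rw [smul_eq_mul, C_mul_X_eq_monomial, monomial_mul, tsub_add_cancel_of_le]
    rw [Finsupp.single_le_iff]
    exact Nat.one_le_iff_ne_zero.2 (Finsupp.mem_support_iff.1 hk)
  rw [Finset.sum_congr rfl e, ← map_sum, Finset.sum_subset (Finset.subset_univ _)]
  · rw [smul_monomial, smul_monomial, smul_eq_mul, smul_eq_mul, mul_comm c]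
    congr 2
    have := mem_monSet.1 hd
    rw [← this.1, ← this.2]
    push_cast
    simp only [Finset.mul_sum, mul_sub, Finset.sum_sub_distrib]
    congr 1 <;> exact Finset.sum_congr rfl fun _ _ => by ring
  · intro k _ hk
    rw [Finsupp.notMem_support_iff.1 hk]
    simp

theorem Pol_eq_bot {m : ℕ} {w : ℤ} (h : w < 0 ∨ 7 * m < w) : Pol m w = ⊥ := by
  rw [eq_bot_iff]
  intro f hf
  refine Pol_induction (P := fun f => f ∈ (⊥ : Submodule ℂ (MvPolynomial (Fin 8) ℂ)))
    (zero_mem _) (fun _ _ => add_mem) (fun d hd c => ?_) hf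
  exfalso
  obtain ⟨h1, h2⟩ := mem_monSet.1 hd
  have h3 : 0 ≤ ∑ k, (d k : ℤ) * ((k : ℕ) : ℤ) := Finset.sum_nonneg fun _ _ => by positivity
  have h4 : ∑ k, (d k : ℤ) * ((k : ℕ) : ℤ) ≤ 7 * m := by
    rw [← h1, Nat.cast_sum, Finset.mul_sum]
    refine Finset.sum_le_sum fun k _ => ?_
    have : ((k : ℕ) : ℤ) ≤ 7 := by omega
    nlinarith
  omega

theorem isSl2_of_stable {m : ℕ} (J : ℤ → Submodule ℂ (MvPolynomial (Fin 8) ℂ))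
    (hJ : ∀ w, J w ≤ Pol m w) (h1 : ∀ w, ∀ v ∈ J w, lowerD v ∈ J (w - 1))
    (h2 : ∀ w, ∀ v ∈ J w, raiseD v ∈ J (w + 1)) :
    IsSl2 (lowerD : MvPolynomial (Fin 8) ℂ →ₗ[ℂ] MvPolynomial (Fin 8) ℂ) raiseD (7 * m) J where
  lower := h1
  raise := h2
  comm w v hv := by
    simp only [Derivation.coeFn_coe]
    rw [lower_raise, weightD_of_mem (hJ w hv)]
  bot_of_neg w hw := by
    rw [eq_bot_iff, ← Pol_eq_bot (m := m) (Or.inl hw)]; exact hJ w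
  bot_of_lt w hw := by
    rw [eq_bot_iff, ← Pol_eq_bot (m := m) (Or.inr hw)]; exact hJ w

theorem isSl2_Pol (m : ℕ) :
    IsSl2 (lowerD : MvPolynomial (Fin 8) ℂ →ₗ[ℂ] MvPolynomial (Fin 8) ℂ) raiseD (7 * m) (Pol m) :=
  isSl2_of_stable _ (fun _ => le_rfl) (fun _ _ => lowerD_mem_Pol) fun _ _ => raiseD_mem_Pol

theorem derivation_aeval {A : Type*} [CommRing A] [Algebra ℂ A] (δ : Derivation ℂ A A)
    (T : Derivation ℂ (MvPolynomial (Fin 8) ℂ) (MvPolynomial (Fin 8) ℂ)) (v : Fin 8 → A)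
    (h : ∀ k, δ (v k) = aeval v (T (X k))) (f : MvPolynomial (Fin 8) ℂ) :
    δ (aeval v f) = aeval v (T f) := by
  induction f using MvPolynomial.induction_on with
  | C a => rw [algHom_C, δ.map_algebraMap, derivation_C, map_zero]
  | add f g hf hg => simp only [map_add, hf, hg]
  | mul_X f k hf =>
    rw [map_mul, aeval_X, Derivation.leibniz, Derivation.leibniz, hf, h]
    simp [aeval_X]

theorem derivative_aeval_raise (ρ : Fin 7 → ℂ) (p q r s : ℂ) (f : MvPolynomial (Fin 8) ℂ) :
    Polynomial.derivative (aeval (ptPoly ρ (Polynomial.C p + Polynomial.C q * Polynomial.X)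
      (Polynomial.C q) (Polynomial.C r + Polynomial.C s * Polynomial.X) (Polynomial.C s)) f) =
    aeval (ptPoly ρ (Polynomial.C p + Polynomial.C q * Polynomial.X)
      (Polynomial.C q) (Polynomial.C r + Polynomial.C s * Polynomial.X) (Polynomial.C s))
      (raiseD f) := by
  refine derivation_aeval Polynomial.derivative' raiseD _ (fun k => ?_) f
  rw [raiseD_X, map_mul, algHom_C, aeval_X, ptPoly, pt]
  have := deriv_septic_raise ((Polynomial.derivative' (R := ℂ)).restrictScalars ℤ)
    (fun i => (Polynomial.C p + Polynomial.C q * Polynomial.X) -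
      Polynomial.C (ρ i) * (Polynomial.C r + Polynomial.C s * Polynomial.X))
    (fun i => Polynomial.C q - Polynomial.C (ρ i) * Polynomial.C s) (fun i => ?_) (fun i => ?_) k
  · rw [map_natCast]; exact this
  · change Polynomial.derivative _ = _
    simp
  · change Polynomial.derivative _ = _
    simp

theorem derivative_aeval_lower (ρ : Fin 7 → ℂ) (p q r s : ℂ) (f : MvPolynomial (Fin 8) ℂ) :
    Polynomial.derivative (aeval (ptPoly ρ (Polynomial.C p)
      (Polynomial.C q + Polynomial.C p * Polynomial.X) (Polynomial.C r)
      (Polynomial.C s + Polynomial.C r * Polynomial.X)) f) =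
    aeval (ptPoly ρ (Polynomial.C p) (Polynomial.C q + Polynomial.C p * Polynomial.X)
      (Polynomial.C r) (Polynomial.C s + Polynomial.C r * Polynomial.X)) (lowerD f) := by
  refine derivation_aeval Polynomial.derivative' lowerD _ (fun k => ?_) f
  rw [lowerD_X, map_mul, algHom_C, aeval_X, ptPoly, pt]
  have := deriv_septic_lower ((Polynomial.derivative' (R := ℂ)).restrictScalars ℤ)
    (fun i => Polynomial.C p - Polynomial.C (ρ i) * Polynomial.C r)
    (fun i => (Polynomial.C q + Polynomial.C p * Polynomial.X) -
      Polynomial.C (ρ i) * (Polynomial.C s + Polynomial.C r * Polynomial.X))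
    (fun i => ?_) (fun i => ?_) k
  · rw [map_natCast]; exact this
  · change Polynomial.derivative _ = _
    simp
  · change Polynomial.derivative _ = _
    simp

theorem raiseD_vanish {ρ : Fin 7 → ℂ} {f : MvPolynomial (Fin 8) ℂ}
    (hf : ∀ z ∈ Z0 ρ, aeval z f = 0) : ∀ z ∈ Z0 ρ, aeval z (raiseD f) = 0 := by
  rintro _ ⟨p, q, r, s, rfl⟩
  have h := derivative_aeval_raise ρ p q r s f
  have h0 : aeval (ptPoly ρ (Polynomial.C p + Polynomial.C q * Polynomial.X)
      (Polynomial.C q) (Polynomial.C r + Polynomial.C s * Polynomial.X) (Polynomial.C s)) f = 0 := by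
    refine Polynomial.funext fun t => ?_
    rw [eval_aeval_ptPoly, Polynomial.eval_zero]
    exact hf _ ⟨_, _, _, _, rfl⟩
  rw [h0, map_zero] at h
  have h2 := congrArg (Polynomial.eval 0) h.symm
  rw [eval_aeval_ptPoly] at h2
  simpa using h2

theorem lowerD_vanish {ρ : Fin 7 → ℂ} {f : MvPolynomial (Fin 8) ℂ}
    (hf : ∀ z ∈ Z0 ρ, aeval z f = 0) : ∀ z ∈ Z0 ρ, aeval z (lowerD f) = 0 := by
  rintro _ ⟨p, q, r, s, rfl⟩
  have h := derivative_aeval_lower ρ p q r s f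
  have h0 : aeval (ptPoly ρ (Polynomial.C p) (Polynomial.C q + Polynomial.C p * Polynomial.X)
      (Polynomial.C r) (Polynomial.C s + Polynomial.C r * Polynomial.X)) f = 0 := by
    refine Polynomial.funext fun t => ?_
    rw [eval_aeval_ptPoly, Polynomial.eval_zero]
    exact hf _ ⟨_, _, _, _, rfl⟩
  rw [h0, map_zero] at h
  have h2 := congrArg (Polynomial.eval 0) h.symm
  rw [eval_aeval_ptPoly] at h2
  simpa using h2

theorem isSl2_Van (ρ : Fin 7 → ℂ) (m : ℕ) :
    IsSl2 (lowerD : MvPolynomial (Fin 8) ℂ →ₗ[ℂ] MvPolynomial (Fin 8) ℂ) raiseD (7 * m)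
      (Van (Z0 ρ) m) :=
  isSl2_of_stable _ (fun w => Van_le_Pol _ _ w)
    (fun _ _ hv => ⟨lowerD_vanish hv.1, lowerD_mem_Pol hv.2⟩)
    fun _ _ hv => ⟨raiseD_vanish hv.1, raiseD_mem_Pol hv.2⟩

theorem lowerD_mem_Dec {ρ : Fin 7 → ℂ} {m : ℕ} {w : ℤ} {f : MvPolynomial (Fin 8) ℂ}
    (hf : f ∈ Dec (Z0 ρ) m w) : lowerD f ∈ Dec (Z0 ρ) m (w - 1) := by
  cases m with
  | zero =>
    have : f = 0 := hf
    rw [this, map_zero]; exact zero_mem _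
  | succ m =>
    obtain ⟨g, hg, rfl⟩ := mem_Dec_succ.1 hf
    rw [map_sum]
    refine sum_mem fun k _ => ?_
    rw [Derivation.leibniz, lowerD_X, smul_eq_mul, smul_eq_mul]
    refine add_mem (X_mul_mem_Dec k ?_) ?_
    · rw [sub_right_comm]
      exact (isSl2_Van ρ m).lower _ _ (hg k)
    · by_cases hk : k = 0
      · subst hk; simp
      · rw [mul_left_comm, ← smul_eq_C_mul]
        refine Submodule.smul_mem _ _ ?_
        rw [mul_comm]
        refine X_mul_mem_Dec _ ?_
        have e : (((k - 1 : Fin 8) : ℕ) : ℤ) = ((k : ℕ) : ℤ) - 1 := by revert k; decide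
        rw [e, show w - 1 - (((k : ℕ) : ℤ) - 1) = w - (k : ℕ) by ring]
        exact hg k

theorem raiseD_mem_Dec {ρ : Fin 7 → ℂ} {m : ℕ} {w : ℤ} {f : MvPolynomial (Fin 8) ℂ}
    (hf : f ∈ Dec (Z0 ρ) m w) : raiseD f ∈ Dec (Z0 ρ) m (w + 1) := by
  cases m with
  | zero =>
    have : f = 0 := hf
    rw [this, map_zero]; exact zero_mem _
  | succ m =>
    obtain ⟨g, hg, rfl⟩ := mem_Dec_succ.1 hf
    rw [map_sum]
    refine sum_mem fun k _ => ?_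
    rw [Derivation.leibniz, raiseD_X, smul_eq_mul, smul_eq_mul]
    refine add_mem (X_mul_mem_Dec k ?_) ?_
    · rw [← sub_add_eq_add_sub]
      exact (isSl2_Van ρ m).raise _ _ (hg k)
    · by_cases hk : k = 7
      · subst hk; simp
      · rw [mul_left_comm, ← smul_eq_C_mul]
        refine Submodule.smul_mem _ _ ?_
        rw [mul_comm]
        refine X_mul_mem_Dec _ ?_
        have e : (((k + 1 : Fin 8) : ℕ) : ℤ) = ((k : ℕ) : ℤ) + 1 := by revert k; decide
        rw [e, show w + 1 - (((k : ℕ) : ℤ) + 1) = w - (k : ℕ) by ring]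
        exact hg k

/-- `b(w) ≤ b(w + 1)` below the middle, where `b = dim Van - dim Dec`. -/
theorem gap_mono (ρ : Fin 7 → ℂ) (m : ℕ) {w : ℤ} (hw : 2 * w < 7 * m) :
    finrank ℂ (Dec (Z0 ρ) m (w + 1)) + finrank ℂ (Van (Z0 ρ) m w) ≤
      finrank ℂ (Van (Z0 ρ) m (w + 1)) + finrank ℂ (Dec (Z0 ρ) m w) :=
  (isSl2_Van ρ m).finrank_gap_mono (Dec_le_Van _ _) (fun _ _ => lowerD_mem_Dec) hw

theorem isSl2_Dec (ρ : Fin 7 → ℂ) (m : ℕ) :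
    IsSl2 (lowerD : MvPolynomial (Fin 8) ℂ →ₗ[ℂ] MvPolynomial (Fin 8) ℂ) raiseD (7 * m)
      (Dec (Z0 ρ) m) :=
  isSl2_of_stable _ (fun w => (Dec_le_Van _ _ w).trans (Van_le_Pol _ _ _))
    (fun _ _ => lowerD_mem_Dec) fun _ _ => raiseD_mem_Dec

/-- `raiseD` as a linear map. -/
noncomputable abbrev raiseL : MvPolynomial (Fin 8) ℂ →ₗ[ℂ] MvPolynomial (Fin 8) ℂ := raiseD

/-- `lowerD` as a linear map. -/
noncomputable abbrev lowerL : MvPolynomial (Fin 8) ℂ →ₗ[ℂ] MvPolynomial (Fin 8) ℂ := lowerD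

/-- The functional `f ↦ (Δ^j f)(E)`. -/
noncomputable def ell (ρ : Fin 7 → ℂ) (j : ℕ) : MvPolynomial (Fin 8) ℂ →ₗ[ℂ] ℂ :=
  (aeval (pt ρ 1 0 0 1)).toLinearMap ∘ₗ raiseL ^ j

theorem ell_apply (ρ : Fin 7 → ℂ) (j : ℕ) (f : MvPolynomial (Fin 8) ℂ) :
    ell ρ j f = aeval (pt ρ 1 0 0 1) ((raiseL ^ j) f) := rfl

theorem vanish_raise_curve {ρ : Fin 7 → ℂ} {f : MvPolynomial (Fin 8) ℂ} (h : ∀ j, ell ρ j f = 0)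
    (t : ℂ) : aeval (pt ρ 1 0 t 1) f = 0 := by
  set P : MvPolynomial (Fin 8) ℂ → Polynomial ℂ := fun g =>
    aeval (ptPoly ρ (Polynomial.C 1 + Polynomial.C 0 * Polynomial.X)
      (Polynomial.C 0) (Polynomial.C 0 + Polynomial.C 1 * Polynomial.X) (Polynomial.C 1)) g with hP
  have h1 (j : ℕ) : Polynomial.derivative^[j] (P f) = P ((raiseL ^ j) f) := by
    induction j with
    | zero => simp
    | succ j ih =>
      rw [Function.iterate_succ_apply', ih, pow_succ', Module.End.mul_apply]
      exact derivative_aeval_raise ρ 1 0 0 1 _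
  have h2 (g : MvPolynomial (Fin 8) ℂ) (t : ℂ) : (P g).eval t = aeval (pt ρ 1 0 t 1) g := by
    rw [hP]; simp only; rw [eval_aeval_ptPoly]; simp
  have h3 : P f = 0 := by
    ext j
    have e := Polynomial.coeff_iterate_derivative (p := P f) (k := j) 0
    rw [Polynomial.coeff_zero_eq_eval_zero, h1, h2, ← ell_apply, h, zero_add,
      Nat.descFactorial_self, nsmul_eq_mul, eq_comm, mul_eq_zero] at e
    exact e.resolve_left (Nat.cast_ne_zero.2 j.factorial_ne_zero)
  rw [← h2, h3, Polynomial.eval_zero]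

theorem vanish_lower_curve {ρ : Fin 7 → ℂ} {f : MvPolynomial (Fin 8) ℂ} (hD : lowerD f = 0)
    (p q r s c : ℂ) :
    aeval (pt ρ p (q + p * c) r (s + r * c)) f = aeval (pt ρ p q r s) f := by
  have h := derivative_aeval_lower ρ p q r s f
  rw [hD, map_zero] at h
  have h1 := Polynomial.derivative_eq_zero.1 h
  rw [Polynomial.natDegree_eq_zero] at h1
  obtain ⟨a, ha⟩ := h1
  have e (t : ℂ) := congrArg (Polynomial.eval t) ha
  simp only [Polynomial.eval_C, eval_aeval_ptPoly] at e
  have e1 := (e c).symm.trans (e 0)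
  simpa using e1

theorem mem_Van_of_ell {ρ : Fin 7 → ℂ} {m : ℕ} {w : ℤ} {k : ℕ} (hk : (7 * m : ℤ) = 2 * w + k)
    {f : MvPolynomial (Fin 8) ℂ} (hf : f ∈ Pol m w) (hD : lowerD f = 0)
    (h : ∀ j ≤ k, ell ρ j f = 0) : f ∈ Van (Z0 ρ) m w := by
  rcases lt_or_ge w 0 with hw | hw
  · rw [Pol_eq_bot (Or.inl hw)] at hf
    rw [(Submodule.mem_bot ℂ).1 hf]; exact zero_mem _
  lift w to ℕ using hw
  have h0 : (raiseL ^ (k + 1)) f = 0 := (isSl2_Pol m).raise_pow_eq_zero k hk hf hD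
  have h1 (j : ℕ) : ell ρ j f = 0 := by
    rcases le_or_gt j k with hj | hj
    · exact h j hj
    · obtain ⟨i, rfl⟩ := Nat.exists_eq_add_of_lt hj
      rw [ell_apply, show k + i + 1 = i + (k + 1) by ring, pow_add, Module.End.mul_apply, h0,
        map_zero, map_zero]
  refine ⟨?_, hf⟩
  rintro _ ⟨p, q, r, s, rfl⟩
  refine aeval_pt_eq_zero ρ (fun p q r s hp hd => ?_) p q r s
  obtain ⟨d, hdp⟩ : ∃ d, d * p = p * s - q * r := ⟨_, div_mul_cancel₀ _ hp⟩
  have hd0 : d ≠ 0 := by rintro rfl; exact hd (by rw [← hdp, zero_mul])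
  have e2 : aeval (pt ρ 1 (q / d) (r / p) (s / d)) f = 0 := by
    have := vanish_lower_curve hD (ρ := ρ) 1 0 (r / p) 1 (q / d)
    rw [vanish_raise_curve h1] at this
    have es : 1 + r / p * (q / d) = s / d := by
      field_simp
      linear_combination hdp
    rwa [zero_add, one_mul, es] at this
  have e3 : pt ρ p q r s = fun k : Fin 8 =>
      p ^ 7 * (d / p) ^ (k : ℕ) * pt ρ 1 (q / d) (r / p) (s / d) k := by
    ext k
    have := pt_smul ρ 1 (q / d) (r / p) (s / d) p d k
    rw [mul_one, mul_div_cancel₀ _ hd0, mul_div_cancel₀ _ hp, mul_div_cancel₀ _ hd0] at this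
    rw [this]
    congr 1
    have hk7 : (k : ℕ) ≤ 7 := by omega
    rw [← pow_sub_mul_pow p hk7, div_pow]
    field_simp
  rw [e3, aeval_scale _ _ _ hf, e2, mul_zero]

/-- The basic lower bound for the growth of `dim Van`. -/
theorem pig (ρ : Fin 7 → ℂ) (m k : ℕ) {w : ℤ} (hk : (7 * m : ℤ) = 2 * (w + 1) + k) :
    finrank ℂ (Pol m (w + 1)) + finrank ℂ (Van (Z0 ρ) m w) ≤
      finrank ℂ (Pol m w) + finrank ℂ (Van (Z0 ρ) m (w + 1)) + (k + 1) :=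
  (isSl2_Pol m).finrank_le_add_of_functionals (isSl2_Van ρ m) (Van_le_Pol _ _) (by omega)
    (fun j : Fin (k + 1) => ell ρ j) fun f hf hD h =>
      mem_Van_of_ell hk hf hD fun j hj => h ⟨j, Nat.lt_succ_of_le hj⟩

/-- The alternating pairing of two highest weight strings is killed by `lowerD`. -/
theorem lowerD_pairing {m n k : ℕ} {w u : ℤ} (hk : (7 * m : ℤ) = 2 * w + k)
    (hk' : (7 * n : ℤ) = 2 * u + k) {f v : MvPolynomial (Fin 8) ℂ} (hf : f ∈ Pol m w)
    (hv : v ∈ Pol n u) (hDf : lowerD f = 0) (hDv : lowerD v = 0) :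
    lowerD (∑ i ∈ Finset.range (k + 1), (-1) ^ i * ((raiseL ^ i) f * (raiseL ^ (k - i)) v)) = 0 := by
  have low (n : ℕ) (u : ℤ) (hk' : (7 * n : ℤ) = 2 * u + k) (v : MvPolynomial (Fin 8) ℂ)
      (hv : v ∈ Pol n u) (hDv : lowerD v = 0) (i : ℕ) :
      lowerD ((raiseL ^ (i + 1)) v) = C (((i + 1) * (k - i) : ℤ) : ℂ) * (raiseL ^ i) v := by
    have := (isSl2_Pol n).lower_raise_pow i hv hDv
    rw [smul_eq_C_mul, hk', show (2 * u + k - 2 * u - i : ℤ) = k - i by ring] at this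
    exact this
  set T : ℕ → MvPolynomial (Fin 8) ℂ := fun i =>
    (-1) ^ i * (C ((i * (k + 1 - i) : ℤ) : ℂ) * ((raiseL ^ (i - 1)) f * (raiseL ^ (k - i)) v)) with hT
  have e (i : ℕ) (hi : i ∈ Finset.range (k + 1)) :
      lowerD ((-1) ^ i * ((raiseL ^ i) f * (raiseL ^ (k - i)) v)) = T i - T (i + 1) := by
    have hi' : i ≤ k := Nat.lt_succ_iff.1 (Finset.mem_range.1 hi)
    have e1 : lowerD ((raiseL ^ i) f) = C ((i * (k + 1 - i) : ℤ) : ℂ) * (raiseL ^ (i - 1)) f := by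
      cases i with
      | zero => simpa using hDf
      | succ i =>
        rw [low m w hk f hf hDf, Nat.add_sub_cancel]
        congr 3; push_cast; ring
    have e2 : lowerD ((raiseL ^ (k - i)) v) =
        C (((i + 1) * (k - i) : ℤ) : ℂ) * (raiseL ^ (k - (i + 1))) v := by
      rcases Nat.eq_zero_or_pos (k - i) with h0 | h0
      · have : (k : ℤ) - i = 0 := by omega
        rw [h0, this]; simpa using hDv
      · obtain ⟨j, hj⟩ : ∃ j, k - i = j + 1 := ⟨k - i - 1, by omega⟩
        rw [hj, low n u hk' v hv hDv, show k - (i + 1) = j by omega]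
        congr 3
        rw [show (k : ℤ) = i + j + 1 by omega]; ring
    have e3 : lowerD ((-1 : MvPolynomial (Fin 8) ℂ) ^ i) = 0 := by
      rw [show (-1 : MvPolynomial (Fin 8) ℂ) ^ i = C ((-1) ^ i) by simp, derivation_C]
    rw [Derivation.leibniz, Derivation.leibniz, e1, e2, e3]
    simp only [hT, smul_eq_mul, Nat.add_sub_cancel]
    have : (((i + 1 : ℕ) : ℤ) * (k + 1 - (i + 1 : ℕ)) : ℤ) = (i + 1) * (k - i) := by
      push_cast; ring
    rw [this]
    ring
  rw [map_sum, Finset.sum_congr rfl e, Finset.sum_range_sub']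
  simp [hT]

theorem ell_pairing {ρ : Fin 7 → ℂ} {m n k : ℕ} {w u : ℤ} (hk : (7 * m : ℤ) = 2 * w + k)
    (hk' : (7 * n : ℤ) = 2 * u + k) {f v : MvPolynomial (Fin 8) ℂ} (hf : f ∈ Pol m w)
    (hv : v ∈ Pol n u) (hDf : lowerD f = 0) (hDv : lowerD v = 0)
    (hinj : ∀ F ∈ Pol (m + n) (w + u + k), lowerD F = 0 → F = 0) :
    ∑ i ∈ Finset.range (k + 1), (-1) ^ i * (ell ρ i f * ell ρ (k - i) v) = 0 := by
  have h := hinj _ (sum_mem fun i hi => ?_) (lowerD_pairing hk hk' hf hv hDf hDv)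
  · have := congrArg (aeval (pt ρ 1 0 0 1)) h
    simpa [ell_apply, map_sum] using this
  · have hi' : i ≤ k := Nat.lt_succ_iff.1 (Finset.mem_range.1 hi)
    have := mul_mem_Pol ((isSl2_Pol m).raise_pow i hf) ((isSl2_Pol n).raise_pow (k - i) hv)
    rw [show (-1 : MvPolynomial (Fin 8) ℂ) ^ i = C ((-1) ^ i) by simp, ← smul_eq_C_mul]
    refine Submodule.smul_mem _ _ ?_
    convert this using 2
    omega

/-- The growth bound improved by one through an auxiliary highest weight vector. -/
theorem pig_pairing (ρ : Fin 7 → ℂ) {m n k : ℕ} {w u : ℤ} (hk : (7 * m : ℤ) = 2 * (w + 1) + k)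
    (hk' : (7 * n : ℤ) = 2 * u + k) {v : MvPolynomial (Fin 8) ℂ} (hv : v ∈ Pol n u)
    (hDv : lowerD v = 0) (hv0 : v ∉ Van (Z0 ρ) n u)
    (hinj : ∀ F ∈ Pol (m + n) (w + 1 + u + k), lowerD F = 0 → F = 0) :
    finrank ℂ (Pol m (w + 1)) + finrank ℂ (Van (Z0 ρ) m w) ≤
      finrank ℂ (Pol m w) + finrank ℂ (Van (Z0 ρ) m (w + 1)) + k := by
  obtain ⟨j, hj, hne⟩ : ∃ j ≤ k, ell ρ j v ≠ 0 := by
    by_contra! hcon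
    exact hv0 (mem_Van_of_ell hk' hv hDv hcon)
  set i0 : Fin (k + 1) := ⟨k - j, by omega⟩ with hi0
  refine (isSl2_Pol m).finrank_le_add_of_functionals (isSl2_Van ρ m) (Van_le_Pol _ _) (by omega)
    (fun i : Fin k => ell ρ (i0.succAbove i)) fun f hf hD h => ?_
  have h' (i : Fin (k + 1)) (hi : i ≠ i0) : ell ρ i f = 0 := by
    obtain ⟨a, rfl⟩ := Fin.exists_succAbove_eq hi
    exact h a
  refine mem_Van_of_ell hk hf hD fun i hi => ?_
  by_cases hii : i = k - j
  · have e := ell_pairing (ρ := ρ) hk hk' hf hv hD hDv hinj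
    rw [Finset.sum_eq_single i] at e
    · rw [show k - i = j by omega] at e
      simpa [hne] using e
    · intro b hb hbi
      rw [h' ⟨b, Finset.mem_range.1 hb⟩ (by rw [Ne, Fin.ext_iff]; simpa [hi0, ← hii] using hbi)]
      simp
    · intro hcon; exact absurd (Finset.mem_range.2 (by omega)) hcon
  · exact h' ⟨i, by omega⟩ (by rw [Ne, Fin.ext_iff]; simpa [hi0] using hii)

theorem lowerD_injective_of_finrank_eq {m : ℕ} {w : ℤ} (hw : 2 * w < 7 * m)
    (h : finrank ℂ (Pol m (w + 1)) = finrank ℂ (Pol m w)) :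
    ∀ F ∈ Pol m (w + 1), lowerD F = 0 → F = 0 := by
  intro F hF hD
  have e := finrank_eq_map_add_ker lowerL (Pol m (w + 1))
  rw [(isSl2_Pol m).map_lower hw, h] at e
  have : FiniteDimensional ℂ (Pol m (w + 1) ⊓ LinearMap.ker lowerL :
      Submodule ℂ (MvPolynomial (Fin 8) ℂ)) := Submodule.finiteDimensional_of_le inf_le_left
  have e0 : finrank ℂ (Pol m (w + 1) ⊓ LinearMap.ker lowerL :
      Submodule ℂ (MvPolynomial (Fin 8) ℂ)) = 0 := by omega
  have e1 := Submodule.finrank_eq_zero.1 e0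
  have : F ∈ Pol m (w + 1) ⊓ LinearMap.ker lowerL := ⟨hF, hD⟩
  rwa [e1, Submodule.mem_bot] at this

/-- The number of conditions imposed by `Z` in degree `m` and weight `w`. -/
noncomputable def cod (Z : Set (Fin 8 → ℂ)) (m : ℕ) (w : ℤ) : ℕ :=
  finrank ℂ (Pol m w) - finrank ℂ (Van Z m w)

theorem cod_add (Z : Set (Fin 8 → ℂ)) (m : ℕ) (w : ℤ) :
    cod Z m w + finrank ℂ (Van Z m w) = finrank ℂ (Pol m w) :=
  Nat.sub_add_cancel (Submodule.finrank_mono (Van_le_Pol Z m w))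

theorem Van_empty (m : ℕ) (w : ℤ) : Van ∅ m w = Pol m w :=
  le_antisymm (Van_le_Pol _ _ _) fun _ hf => ⟨fun _ hz => hz.elim, hf⟩

theorem cod_empty (m : ℕ) (w : ℤ) : cod ∅ m w = 0 := by
  rw [cod, Van_empty, Nat.sub_self]

/-- Multiplication by a variable. -/
noncomputable def mulX (k : Fin 8) : MvPolynomial (Fin 8) ℂ →ₗ[ℂ] MvPolynomial (Fin 8) ℂ :=
  LinearMap.mulLeft ℂ (X k)

theorem mulX_apply (k : Fin 8) (f : MvPolynomial (Fin 8) ℂ) : mulX k f = X k * f := rfl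

theorem mulX_injective (k : Fin 8) : Function.Injective (mulX k) := fun _ _ h =>
  mul_left_cancel₀ (X_ne_zero k) h

theorem finrank_map_mulX (k : Fin 8) (S : Submodule ℂ (MvPolynomial (Fin 8) ℂ)) :
    finrank ℂ (S.map (mulX k)) = finrank ℂ S :=
  (Submodule.equivMapOfInjective (mulX k) (mulX_injective k) S).finrank_eq.symm

theorem chain {Z Z' : Set (Fin 8 → ℂ)} {k : Fin 8} (hZ : Z' ⊆ Z) (hk : ∀ z ∈ Z', z k = 0)
    {n : ℕ} {w : ℤ}
    (hreg : ∀ f : MvPolynomial (Fin 8) ℂ, (∀ z ∈ Z, aeval z (X k * f) = 0) → ∀ z ∈ Z, aeval z f = 0) :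
    cod Z n (w - (k : ℕ)) + cod Z' (n + 1) w ≤ cod Z (n + 1) w ∧
    (cod Z (n + 1) w ≤ cod Z n (w - (k : ℕ)) + cod Z' (n + 1) w →
      Van Z' (n + 1) w ≤ Van Z (n + 1) w ⊔ (Pol n (w - (k : ℕ))).map (mulX k)) := by
  have e1 : Van Z (n + 1) w ⊓ (Pol n (w - (k : ℕ))).map (mulX k) =
      (Van Z n (w - (k : ℕ))).map (mulX k) := by
    ext f
    constructor
    · rintro ⟨h1, g, hg, rfl⟩
      exact ⟨g, ⟨hreg g h1.1, hg⟩, rfl⟩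
    · rintro ⟨g, hg, rfl⟩
      exact ⟨X_mul_mem_Van k hg, g, hg.2, rfl⟩
  have e2 := Submodule.finrank_sup_add_finrank_inf_eq (Van Z (n + 1) w)
    ((Pol n (w - (k : ℕ))).map (mulX k))
  rw [e1, finrank_map_mulX, finrank_map_mulX] at e2
  have hle : Van Z (n + 1) w ⊔ (Pol n (w - (k : ℕ))).map (mulX k) ≤ Van Z' (n + 1) w := by
    refine sup_le (fun f hf => ⟨fun z hz => hf.1 z (hZ hz), hf.2⟩) ?_
    rintro _ ⟨g, hg, rfl⟩
    refine ⟨fun z hz => ?_, X_mul_mem_Pol k hg⟩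
    rw [mulX_apply, map_mul, aeval_X, hk z hz, zero_mul]
  have c1 := cod_add Z (n + 1) w
  have c2 := cod_add Z' (n + 1) w
  have c3 := cod_add Z n (w - (k : ℕ))
  have hle' := Submodule.finrank_mono hle
  refine ⟨by omega, fun h => ?_⟩
  exact (Submodule.eq_of_le_of_finrank_le hle (by omega)).ge

/-! ### Restriction to `a_0 = 0` and `a_7 = 0` -/

/-- Points of the orbit closure with `a_0 = 0`. -/
def Z1 (ρ : Fin 7 → ℂ) : Set (Fin 8 → ℂ) := {z ∈ Z0 ρ | z 0 = 0}

/-- Points of the orbit closure with `a_0 = a_7 = 0`. -/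
def Z2 (ρ : Fin 7 → ℂ) : Set (Fin 8 → ℂ) := {z ∈ Z1 ρ | z 7 = 0}

theorem eq_zero_of_curve {ρ : Fin 7 → ℂ} {f : MvPolynomial (Fin 8) ℂ} {k : Fin 8}
    (P Q R S : Polynomial ℂ) (h0 : ptPoly ρ P Q R S k ≠ 0)
    (h : ∀ t, aeval (pt ρ (P.eval t) (Q.eval t) (R.eval t) (S.eval t)) (X k * f) = 0) (t : ℂ) :
    aeval (pt ρ (P.eval t) (Q.eval t) (R.eval t) (S.eval t)) f = 0 := by
  have e : aeval (ptPoly ρ P Q R S) (X k * f) = 0 :=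
    Polynomial.funext fun t => by rw [eval_aeval_ptPoly, h, Polynomial.eval_zero]
  rw [map_mul, aeval_X, mul_eq_zero] at e
  rw [← eval_aeval_ptPoly, e.resolve_left h0, Polynomial.eval_zero]

theorem prod_X_add_C_ne_zero (a b : Fin 7 → ℂ) :
    (105 : Polynomial ℂ) * ∏ i, ((Polynomial.X + Polynomial.C (a i)) -
      Polynomial.C (b i)) ≠ 0 := by
  refine mul_ne_zero (by norm_num) (Finset.prod_ne_zero_iff.2 fun i _ => ?_)
  rw [add_sub_assoc, ← Polynomial.C_sub]
  exact Polynomial.X_add_C_ne_zero _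

theorem regular_Z0 (ρ : Fin 7 → ℂ) (f : MvPolynomial (Fin 8) ℂ)
    (h : ∀ z ∈ Z0 ρ, aeval z (X 0 * f) = 0) : ∀ z ∈ Z0 ρ, aeval z f = 0 := by
  rintro _ ⟨p, q, r, s, rfl⟩
  have := eq_zero_of_curve (ρ := ρ) (f := f) (k := 0) (Polynomial.X + Polynomial.C p)
    (Polynomial.C q) (Polynomial.C r) (Polynomial.C s) ?_ (fun t => h _ ⟨_, _, _, _, rfl⟩) 0
  · simpa using this
  · rw [ptPoly, pt, septic_zero]
    simp only [← Polynomial.C_mul]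
    exact prod_X_add_C_ne_zero _ _

theorem pt_zero_eq_zero_iff {ρ : Fin 7 → ℂ} {p q r s : ℂ} :
    pt ρ p q r s 0 = 0 ↔ ∃ i, p = ρ i * r := by
  rw [pt, septic_zero, mul_eq_zero, or_iff_right (by norm_num), Finset.prod_eq_zero_iff]
  simp [sub_eq_zero]

theorem pt_seven_eq_zero_iff {ρ : Fin 7 → ℂ} {p q r s : ℂ} :
    pt ρ p q r s 7 = 0 ↔ ∃ i, q = ρ i * s := by
  rw [pt, septic_last, mul_eq_zero, or_iff_right (by norm_num), Finset.prod_eq_zero_iff]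
  simp [sub_eq_zero]

theorem mem_Z1 {ρ : Fin 7 → ℂ} {z : Fin 8 → ℂ} :
    z ∈ Z1 ρ ↔ ∃ i q r s, z = pt ρ (ρ i * r) q r s := by
  constructor
  · rintro ⟨⟨p, q, r, s, rfl⟩, h⟩
    obtain ⟨i, rfl⟩ := pt_zero_eq_zero_iff.1 h
    exact ⟨i, q, r, s, rfl⟩
  · rintro ⟨i, q, r, s, rfl⟩
    exact ⟨⟨_, _, _, _, rfl⟩, pt_zero_eq_zero_iff.2 ⟨i, rfl⟩⟩

theorem mem_Z2 {ρ : Fin 7 → ℂ} {z : Fin 8 → ℂ} :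
    z ∈ Z2 ρ ↔ ∃ i j r s, z = pt ρ (ρ i * r) (ρ j * s) r s := by
  constructor
  · rintro ⟨h, h7⟩
    obtain ⟨i, q, r, s, rfl⟩ := mem_Z1.1 h
    obtain ⟨j, rfl⟩ := pt_seven_eq_zero_iff.1 h7
    exact ⟨i, j, r, s, rfl⟩
  · rintro ⟨i, j, r, s, rfl⟩
    exact ⟨mem_Z1.2 ⟨_, _, _, _, rfl⟩, pt_seven_eq_zero_iff.2 ⟨j, rfl⟩⟩

theorem regular_Z1 (ρ : Fin 7 → ℂ) (f : MvPolynomial (Fin 8) ℂ)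
    (h : ∀ z ∈ Z1 ρ, aeval z (X 7 * f) = 0) : ∀ z ∈ Z1 ρ, aeval z f = 0 := by
  intro z hz
  obtain ⟨i, q, r, s, rfl⟩ := mem_Z1.1 hz
  have := eq_zero_of_curve (ρ := ρ) (f := f) (k := 7) (Polynomial.C (ρ i * r))
    (Polynomial.X + Polynomial.C q) (Polynomial.C r) (Polynomial.C s) ?_
    (fun t => h _ (mem_Z1.2 ⟨i, t + q, r, s, by simp⟩)) 0
  · simpa using this
  · rw [ptPoly, pt, septic_last]
    simp only [← Polynomial.C_mul]
    exact prod_X_add_C_ne_zero _ _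

theorem septic_one {A : Type*} [CommRing A] (u v : Fin 7 → A) :
    septic u v 1 = 15 * ∑ l, v l * ∏ i ∈ {l}ᶜ, u i := by
  rw [septic, show ((1 : Fin 8) : ℕ) = 1 from rfl, coeff_linProd, Finset.powersetCard_one,
    Finset.sum_map]
  simp [nrm]

theorem septic_one_of_eq_zero {A : Type*} [CommRing A] {u : Fin 7 → A} (v : Fin 7 → A) {i : Fin 7}
    (hi : u i = 0) : septic u v 1 = 15 * (v i * ∏ j ∈ {i}ᶜ, u j) := by
  rw [septic_one, Finset.sum_eq_single i _ (by simp)]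
  intro l _ hl
  rw [Finset.prod_eq_zero (i := i) (by simpa using hl.symm) hi, mul_zero]

theorem pt_eq_zero_of_eq {A : Type*} [CommRing A] {ρ : Fin 7 → A} (i : Fin 7) (r s : A) :
    pt ρ (ρ i * r) (ρ i * s) r s = 0 := by
  ext k
  rw [pt, septic, linProd, Finset.prod_eq_zero (Finset.mem_univ i) (by simp)]
  simp

theorem regular_Z2 {ρ : Fin 7 → ℂ} (hρ : Function.Injective ρ) (f : MvPolynomial (Fin 8) ℂ)
    (h : ∀ z ∈ Z2 ρ, aeval z (X 1 * f) = 0) : ∀ z ∈ Z2 ρ, aeval z f = 0 := by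
  have key (i j : Fin 7) (hij : i ≠ j) (r s : ℂ) :
      aeval (pt ρ (ρ i * r) (ρ j * s) r s) f = 0 := by
    have := eq_zero_of_curve (ρ := ρ) (f := f) (k := 1)
      (Polynomial.C (ρ i) * (Polynomial.X + Polynomial.C r))
      (Polynomial.C (ρ j) * (Polynomial.X + Polynomial.C s)) (Polynomial.X + Polynomial.C r)
      (Polynomial.X + Polynomial.C s) ?_
      (fun t => h _ (mem_Z2.2 ⟨i, j, t + r, t + s, by simp⟩)) 0
    · simpa using this
    · rw [ptPoly, pt, septic_one_of_eq_zero (i := i) _ (sub_self _)]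
      simp only [← sub_mul, ← Polynomial.C_sub]
      refine mul_ne_zero (by norm_num) (mul_ne_zero (mul_ne_zero ?_ (Polynomial.X_add_C_ne_zero _))
        (Finset.prod_ne_zero_iff.2 fun l hl => mul_ne_zero ?_ (Polynomial.X_add_C_ne_zero _)))
      · rw [Ne, Polynomial.C_eq_zero, sub_eq_zero]; exact fun h => hij (hρ h.symm)
      · rw [Ne, Polynomial.C_eq_zero, sub_eq_zero]
        intro h
        rw [Finset.mem_compl, Finset.mem_singleton] at hl
        exact hl (hρ h.symm)
  intro z hz
  obtain ⟨i, j, r, s, rfl⟩ := mem_Z2.1 hz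
  by_cases hij : i = j
  · subst hij
    have e : pt ρ (ρ i * r) (ρ i * s) r s = pt ρ (ρ i * 0) (ρ (i + 1) * 0) 0 0 := by
      rw [pt_eq_zero_of_eq]
      simpa using (pt_eq_zero_of_eq (ρ := ρ) i 0 0).symm
    rw [e]
    have hne : ∀ i : Fin 7, i ≠ i + 1 := by decide
    exact key i (i + 1) (hne i) 0 0
  · exact key i j hij r s

/-! ### Reflection -/

theorem rev_cast : ∀ k : Fin 8, ((k.rev : ℕ) : ℤ) = 7 - (k : ℕ) := by decide

theorem rename_rev_mem_Pol {m : ℕ} {w : ℤ} {f : MvPolynomial (Fin 8) ℂ} (hf : f ∈ Pol m w) :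
    rename Fin.rev f ∈ Pol m (7 * m - w) := by
  refine Pol_induction (P := fun f => rename Fin.rev f ∈ Pol m (7 * m - w)) (by simp)
    (fun f g hf hg => by rw [map_add]; exact add_mem hf hg) (fun d hd c => ?_) hf
  rw [rename_monomial]
  refine monomial_mem_Pol ?_ c
  obtain ⟨h1, h2⟩ := mem_monSet.1 hd
  have e (k : Fin 8) : (d.mapDomain Fin.rev) k = d k.rev := by
    conv_lhs => rw [← Fin.rev_rev k]
    exact Finsupp.mapDomain_apply Fin.rev_injective _ _
  have e2 : ∑ k : Fin 8, (d k.rev : ℤ) * ((k : ℕ) : ℤ) = ∑ k : Fin 8, (d k : ℤ) * ((k.rev : ℕ) : ℤ) :=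
    Fintype.sum_equiv Fin.revPerm _ _ fun k => by simp
  rw [mem_monSet]
  simp only [e]
  refine ⟨by rw [← h1]; exact Fintype.sum_equiv Fin.revPerm _ _ fun k => by simp, ?_⟩
  rw [e2, ← h2, ← h1, Nat.cast_sum, Finset.mul_sum, ← Finset.sum_sub_distrib]
  refine Finset.sum_congr rfl fun k _ => ?_
  rw [rev_cast]; ring

/-- Stability under reversal of coordinates. -/
def IsRevStable (Z : Set (Fin 8 → ℂ)) : Prop := ∀ z ∈ Z, z ∘ Fin.rev ∈ Z

theorem isRevStable_Z0 (ρ : Fin 7 → ℂ) : IsRevStable (Z0 ρ) := by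
  rintro _ ⟨p, q, r, s, rfl⟩
  exact ⟨q, p, s, r, funext fun k => (pt_rev ρ p q r s k).symm⟩

theorem isRevStable_Z2 (ρ : Fin 7 → ℂ) : IsRevStable (Z2 ρ) := fun z hz =>
  ⟨⟨isRevStable_Z0 ρ z hz.1.1, hz.2⟩, hz.1.2⟩

theorem rename_rev_mem_Van {Z : Set (Fin 8 → ℂ)} (hZ : IsRevStable Z) {m : ℕ} {w : ℤ}
    {f : MvPolynomial (Fin 8) ℂ} (hf : f ∈ Van Z m w) :
    rename Fin.rev f ∈ Van Z m (7 * m - w) :=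
  ⟨fun z hz => by rw [aeval_rename]; exact hf.1 _ (hZ z hz), rename_rev_mem_Pol hf.2⟩

theorem rename_rev_mem_Dec {Z : Set (Fin 8 → ℂ)} (hZ : IsRevStable Z) {m : ℕ} {w : ℤ}
    {f : MvPolynomial (Fin 8) ℂ} (hf : f ∈ Dec Z m w) :
    rename Fin.rev f ∈ Dec Z m (7 * m - w) := by
  cases m with
  | zero =>
    have : f = 0 := hf
    rw [this, map_zero]; exact zero_mem _
  | succ m =>
    obtain ⟨g, hg, rfl⟩ := mem_Dec_succ.1 hf
    rw [map_sum]
    refine sum_mem fun k _ => ?_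
    rw [map_mul, rename_X]
    refine X_mul_mem_Dec _ ?_
    have := rename_rev_mem_Van hZ (hg k)
    convert this using 2
    push_cast
    rw [rev_cast]; ring

theorem rename_rev_rev (f : MvPolynomial (Fin 8) ℂ) : rename Fin.rev (rename Fin.rev f) = f := by
  rw [rename_rename]
  have : (Fin.rev ∘ Fin.rev : Fin 8 → Fin 8) = id := funext Fin.rev_rev
  rw [this, rename_id_apply]

theorem finrank_eq_of_rename {J J' : Submodule ℂ (MvPolynomial (Fin 8) ℂ)}
    [FiniteDimensional ℂ J] [FiniteDimensional ℂ J'] (h : ∀ f ∈ J, rename Fin.rev f ∈ J')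
    (h' : ∀ f ∈ J', rename Fin.rev f ∈ J) : finrank ℂ J = finrank ℂ J' := by
  have key (J J' : Submodule ℂ (MvPolynomial (Fin 8) ℂ)) [FiniteDimensional ℂ J']
      (h : ∀ f ∈ J, rename Fin.rev f ∈ J') : finrank ℂ J ≤ finrank ℂ J' := by
    rw [(Submodule.equivMapOfInjective (rename (R := ℂ) (Fin.rev (n := 8))).toLinearMap
      (rename_injective _ Fin.rev_injective) J).finrank_eq]
    refine Submodule.finrank_mono ?_
    rintro _ ⟨f, hf, rfl⟩
    exact h f hf
  exact le_antisymm (key _ _ h) (key _ _ h')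

theorem finrank_Van_rev {Z : Set (Fin 8 → ℂ)} (hZ : IsRevStable Z) (m : ℕ) (w : ℤ) :
    finrank ℂ (Van Z m (7 * m - w)) = finrank ℂ (Van Z m w) := by
  refine finrank_eq_of_rename (fun f hf => ?_) fun f hf => rename_rev_mem_Van hZ hf
  have := rename_rev_mem_Van hZ hf
  rwa [sub_sub_cancel] at this

theorem finrank_Dec_rev {Z : Set (Fin 8 → ℂ)} (hZ : IsRevStable Z) (m : ℕ) (w : ℤ) :
    finrank ℂ (Dec Z m (7 * m - w)) = finrank ℂ (Dec Z m w) := by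
  refine finrank_eq_of_rename (fun f hf => ?_) fun f hf => rename_rev_mem_Dec hZ hf
  have := rename_rev_mem_Dec hZ hf
  rwa [sub_sub_cancel] at this

theorem cod_rev {Z : Set (Fin 8 → ℂ)} (hZ : IsRevStable Z) (m : ℕ) (w : ℤ) :
    cod Z m (7 * m - w) = cod Z m w := by
  have h := finrank_Van_rev (Z := ∅) (fun _ h => h) m w
  rw [Van_empty, Van_empty] at h
  rw [cod, cod, h, finrank_Van_rev hZ]

/-! ### Digits -/

/-- The `i`-th digit of `A` in base `b`. -/
def dg (b A i : ℕ) : ℕ := A / b ^ i % b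

theorem dg_lt {b : ℕ} (hb : 0 < b) (A i : ℕ) : dg b A i < b := Nat.mod_lt _ hb

theorem mod_pow_succ_dg (b A i : ℕ) : A % b ^ (i + 1) = A % b ^ i + b ^ i * dg b A i := by
  rw [dg, pow_succ, Nat.mod_mul]

theorem add_mod_lt {b A C : ℕ} (h : ∀ i, dg b A i + dg b C i < b) (i : ℕ) :
    A % b ^ i + C % b ^ i < b ^ i := by
  induction i with
  | zero => simp [Nat.mod_one]
  | succ i ih =>
    rw [mod_pow_succ_dg, mod_pow_succ_dg, pow_succ]
    have := h i
    have : b ^ i * (dg b A i + dg b C i + 1) ≤ b ^ i * b := Nat.mul_le_mul_left _ this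
    nlinarith

theorem add_div_of_mod_lt {A C n : ℕ} (h : A % n + C % n < n) : (A + C) / n = A / n + C / n := by
  have hn : 0 < n := by omega
  rw [Nat.add_div hn, if_neg (by omega), add_zero]

theorem dg_add {b A C : ℕ} (h : ∀ i, dg b A i + dg b C i < b) (i : ℕ) :
    dg b (A + C) i = dg b A i + dg b C i := by
  have h1 := h i
  unfold dg at *
  rw [add_div_of_mod_lt (add_mod_lt h i), Nat.add_mod, Nat.mod_eq_of_lt h1]

theorem mul_mod_lt {b A c : ℕ} (h : ∀ i, dg b A i * c < b) (i : ℕ) :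
    A % b ^ i * c < b ^ i := by
  induction i with
  | zero => simp [Nat.mod_one]
  | succ i ih =>
    rw [mod_pow_succ_dg, pow_succ]
    have : b ^ i * (dg b A i * c + 1) ≤ b ^ i * b := Nat.mul_le_mul_left _ (h i)
    nlinarith

theorem dg_mul {b A c : ℕ} (hb : 0 < b) (h : ∀ i, dg b A i * c < b) (i : ℕ) :
    dg b (A * c) i = dg b A i * c := by
  have h2 : A * c / b ^ i = A / b ^ i * c := by
    have hp : 0 < b ^ i := by positivity
    conv_lhs => rw [← Nat.div_add_mod A (b ^ i), add_mul, mul_assoc]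
    rw [Nat.mul_add_div hp, Nat.div_eq_of_lt (mul_mod_lt h i), add_zero]
  have h1 := h i
  unfold dg at *
  rw [h2, ← Nat.mod_eq_of_lt h1, Nat.mod_mul_mod]

theorem mod_le_of_dg_le {b A C : ℕ} (h : ∀ i, dg b C i ≤ dg b A i) (i : ℕ) :
    C % b ^ i ≤ A % b ^ i := by
  induction i with
  | zero => simp [Nat.mod_one]
  | succ i ih =>
    rw [mod_pow_succ_dg, mod_pow_succ_dg]
    exact Nat.add_le_add ih (Nat.mul_le_mul_left _ (h i))

theorem dg_sub {b A C : ℕ} (hb : 0 < b) (hCA : C ≤ A) (h : ∀ i, dg b C i ≤ dg b A i) (i : ℕ) :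
    dg b (A - C) i = dg b A i - dg b C i := by
  obtain ⟨D, rfl⟩ := Nat.exists_eq_add_of_le hCA
  have hp : 0 < b ^ i := by positivity
  have h1 := mod_le_of_dg_le h i
  have h2 := mod_le_of_dg_le h (i + 1)
  have key : ∀ n, 0 < n → C % n ≤ (C + D) % n → C % n + D % n < n := by
    intro n hn hle
    by_contra hcon
    rw [Nat.add_mod] at hle
    have hc := Nat.mod_lt C hn
    have hd := Nat.mod_lt D hn
    generalize C % n = x at *
    generalize D % n = y at *
    have : (x + y) % n = x + y - n := by
      rw [Nat.mod_eq_sub_mod (by omega), Nat.mod_eq_of_lt (by omega)]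
    omega
  have k1 := add_div_of_mod_lt (key _ hp h1)
  have k2 := key (b ^ (i + 1)) (by positivity) h2
  have k3 := h i
  rw [mod_pow_succ_dg, mod_pow_succ_dg, pow_succ] at k2
  have k4 : dg b C i + dg b D i < b := by
    have : b ^ i * (dg b C i + dg b D i) < b ^ i * b := by
      rw [mul_add]
      linarith [Nat.zero_le (C % b ^ i), Nat.zero_le (D % b ^ i)]
    exact Nat.lt_of_mul_lt_mul_left this
  have k5 : dg b (C + D) i = dg b C i + dg b D i := by
    unfold dg at *
    rw [k1, Nat.add_mod, Nat.mod_eq_of_lt k4]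
  rw [k5]
  simp

theorem dg_land {k A C i : ℕ} : dg (2 ^ k) (A &&& C) i = dg (2 ^ k) A i &&& dg (2 ^ k) C i := by
  simp only [dg, ← pow_mul, ← Nat.shiftRight_eq_div_pow, Nat.shiftRight_and_distrib,
    Nat.and_mod_two_pow]

theorem dg_shift (b A n i : ℕ) : dg b (A / b ^ n) i = dg b A (n + i) := by
  simp only [dg, Nat.div_div_eq_div_mul, pow_add]

theorem dg_mod {b A n i : ℕ} (h : i < n) : dg b (A % b ^ n) i = dg b A i := by
  obtain ⟨m, rfl⟩ := Nat.exists_eq_add_of_lt h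
  unfold dg
  rw [show b ^ (i + m + 1) = b ^ i * (b * b ^ m) by ring, Nat.mod_mul_right_div_self,
    Nat.mod_mul_right_mod]

theorem dg_mod_of_le {b A n i : ℕ} (hb : 0 < b) (h : n ≤ i) : dg b (A % b ^ n) i = 0 := by
  unfold dg
  rw [Nat.div_eq_of_lt, Nat.zero_mod]
  exact (Nat.mod_lt _ (by positivity)).trans_le (Nat.pow_le_pow_right hb h)

theorem dg_dg {b R A t j : ℕ} (h : j < R) : dg b (dg (b ^ R) A t) j = dg b A (R * t + j) := by
  conv_lhs => rw [dg.eq_def (b ^ R)]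
  rw [dg_mod h, ← pow_mul, dg_shift]

theorem dg_sum {b : ℕ} (hb : 1 < b) (n c i : ℕ) (hc : c < b) :
    dg b (c * ∑ j ∈ Finset.range n, b ^ j) i = if i < n then c else 0 := by
  induction n generalizing i with
  | zero => simp [dg]
  | succ n ih =>
    have e : c * ∑ j ∈ Finset.range (n + 1), b ^ j =
        c + b * (c * ∑ j ∈ Finset.range n, b ^ j) := by
      rw [Finset.sum_range_succ']
      simp only [pow_succ, ← Finset.sum_mul]
      ring
    cases i with
    | zero =>
      rw [e, if_pos (by omega)]
      simp [dg, Nat.mod_eq_of_lt hc]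
    | succ i =>
      have := dg_shift b (c * ∑ j ∈ Finset.range (n + 1), b ^ j) 1 i
      rw [add_comm 1 i] at this
      rw [← this, e, pow_one, Nat.add_mul_div_left _ _ (by omega), Nat.div_eq_of_lt hc, zero_add,
        ih]
      simp

/-! ### Vectors over `ZMod 127` packed into natural numbers -/

instance fact_prime : Fact (Nat.Prime 127) := ⟨by norm_num⟩

/-- The digits of a natural number in base `2 ^ 14`. -/
def dig (A i : ℕ) : ℕ := dg (2 ^ 14) A i

theorem dig_lt (A i : ℕ) : dig A i < 16384 := dg_lt (by norm_num) A i

theorem dig_land (A C i : ℕ) : dig (A &&& C) i = dig A i &&& dig C i := dg_land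

theorem dig_shift (A n i : ℕ) : dig (A / 2 ^ (14 * n)) i = dig A (n + i) := by
  rw [pow_mul]; exact dg_shift _ _ _ _

theorem dig_mod (A n i : ℕ) : dig (A % 2 ^ (14 * n)) i = if i < n then dig A i else 0 := by
  rw [pow_mul]
  split_ifs with h
  · exact dg_mod h
  · exact dg_mod_of_le (by norm_num) (by omega)

theorem dig_add {A C : ℕ} (h : ∀ i, dig A i + dig C i < 16384) (i : ℕ) :
    dig (A + C) i = dig A i + dig C i := dg_add h i

theorem dig_mul {A c : ℕ} (h : ∀ i, dig A i * c < 16384) (i : ℕ) :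
    dig (A * c) i = dig A i * c := dg_mul (by norm_num) h i

theorem lt_of_dig {A n : ℕ} (h : ∀ i, n ≤ i → dig A i = 0) : A < 2 ^ (14 * n) := by
  have key : ∀ C : ℕ, (∀ i, dig C i = 0) → C = 0 := by
    intro C
    induction C using Nat.strong_induction_on with
    | _ C ih =>
      intro hC
      by_contra h0
      have h1 : C / 2 ^ (14 * 1) = 0 :=
        ih _ (Nat.div_lt_self (by omega) (by norm_num)) fun i => by rw [dig_shift, hC]
      have h2 := hC 0
      simp only [dig, dg, pow_zero, Nat.div_one] at h2
      omega
  have := key (A / 2 ^ (14 * n)) fun i => by rw [dig_shift, h _ (by omega)]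
  rwa [Nat.div_eq_zero_iff_lt (by positivity)] at this

/-- The number with `n` digits equal to one in base `2 ^ w`. -/
def ones (w n : ℕ) : ℕ := Nat.div (Nat.sub (Nat.pow 2 (Nat.mul w n)) 1) (Nat.sub (Nat.pow 2 w) 1)

theorem ones_eq {w : ℕ} (hw : 0 < w) (n : ℕ) :
    ones w n = ∑ j ∈ Finset.range n, (2 ^ w) ^ j := by
  rw [Nat.geomSum_eq (Nat.one_lt_two_pow hw.ne'), ← pow_mul]
  rfl

theorem dig_ones {c : ℕ} (hc : c < 16384) (n i : ℕ) :
    dig (c * ones 14 n) i = if i < n then c else 0 := by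
  rw [ones_eq (by norm_num)]
  exact dg_sum (by norm_num) n c i hc

/-- One step of the reduction of all digits modulo `127`. -/
def fold (M A : ℕ) : ℕ := Nat.add (Nat.land A M) (Nat.land (Nat.shiftRight A 7) M)

/-- Reduction of all digits modulo `127` to at most `127`. -/
def norm2 (M A : ℕ) : ℕ := fold M (fold M A)

/-- Reduction of all digits from at most `127` to at most `126`. -/
def canon (M O v : ℕ) : ℕ := Nat.sub (fold M (Nat.add v O)) O

theorem and_127 (x : ℕ) : x &&& 127 = x % 128 := Nat.and_two_pow_sub_one_eq_mod x 7

theorem dig_fold (n A i : ℕ) : dig (fold (127 * ones 14 n) A) i =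
    if i < n then dig A i % 128 + dig A i / 128 else 0 := by
  have e1 : ∀ i, dig (A &&& 127 * ones 14 n) i = if i < n then dig A i % 128 else 0 := by
    intro i
    rw [dig_land, dig_ones (by norm_num)]
    split_ifs <;> simp [and_127]
  have e2 : ∀ i, dig (A >>> 7 &&& 127 * ones 14 n) i = if i < n then dig A i / 128 else 0 := by
    intro i
    rw [dig_land, dig_ones (by norm_num)]
    split_ifs
    · rw [and_127, Nat.shiftRight_eq_div_pow]
      simp only [dig, dg]
      rw [Nat.div_div_eq_div_mul, mul_comm, ← Nat.div_div_eq_div_mul]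
      generalize A / (2 ^ 14) ^ i = x
      omega
    · simp
  change dig ((A &&& 127 * ones 14 n) + (A >>> 7 &&& 127 * ones 14 n)) i = _
  rw [dig_add]
  · rw [e1, e2]; split_ifs <;> simp
  · intro i
    rw [e1, e2]
    have := dig_lt A i
    split_ifs <;> omega

theorem dig_norm2_le (n A i : ℕ) : dig (norm2 (127 * ones 14 n) A) i ≤ 127 := by
  rw [norm2, dig_fold]
  have := dig_lt A i
  split_ifs
  · rw [dig_fold]
    split_ifs <;> omega
  · omega

theorem cast_fold (x : ℕ) : ((x % 128 + x / 128 : ℕ) : ZMod 127) = x := by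
  conv_rhs => rw [← Nat.div_add_mod x 128]
  push_cast
  have : (128 : ZMod 127) = 1 := by decide
  rw [this]; ring

theorem cast_dig_norm2 (n A i : ℕ) : (dig (norm2 (127 * ones 14 n) A) i : ZMod 127) =
    if i < n then (dig A i : ZMod 127) else 0 := by
  rw [norm2, dig_fold]
  split_ifs with h
  · rw [cast_fold, dig_fold, if_pos h, cast_fold]
  · simp

theorem dig_norm2_of_le {n i : ℕ} (A : ℕ) (h : n ≤ i) : dig (norm2 (127 * ones 14 n) A) i = 0 := by
  rw [norm2, dig_fold, if_neg (by omega)]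

theorem dig_canon {n v : ℕ} (hv : ∀ i, dig v i ≤ 127) (i : ℕ) :
    dig (canon (127 * ones 14 n) (ones 14 n) v) i = if i < n then dig v i % 127 else 0 := by
  have h1 : ∀ i, dig (ones 14 n) i = if i < n then 1 else 0 := fun i => by
    simpa using dig_ones (c := 1) (by norm_num) n i
  have h2 : ∀ i, dig (v + ones 14 n) i = dig v i + dig (ones 14 n) i := by
    refine dig_add fun i => ?_
    have := hv i
    rw [h1]; split_ifs <;> omega
  have h3 : ∀ i, dig (ones 14 n) i ≤ dig (fold (127 * ones 14 n) (v + ones 14 n)) i := by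
    intro i
    rw [dig_fold, h2, h1]
    split_ifs <;> omega
  have h4 : ones 14 n ≤ fold (127 * ones 14 n) (v + ones 14 n) := by
    have h5 : ones 14 n < 2 ^ (14 * n) := lt_of_dig fun i hi => by rw [h1, if_neg (by omega)]
    rw [pow_mul] at h5
    exact (Nat.mod_eq_of_lt h5).symm.le.trans ((mod_le_of_dg_le h3 n).trans (Nat.mod_le _ _))
  change dig (fold (127 * ones 14 n) (v + ones 14 n) - ones 14 n) i = _
  have := dg_sub (by norm_num) h4 h3 i
  refine this.trans ?_
  change dig _ i - dig _ i = _
  rw [dig_fold, h2, h1]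
  have := hv i
  split_ifs <;> omega

/-- The vector of the digits with indices `R * t + j`, `j < R`. -/
def row (R A t : ℕ) : Fin R → ZMod 127 := fun j => dig A (R * t + j)

/-- A number packing a vector with `R` entries. -/
def Good (R A : ℕ) : Prop := ∀ i, dig A i ≤ 127 ∧ (R ≤ i → dig A i = 0)

theorem good_norm2 (R A : ℕ) : Good R (norm2 (127 * ones 14 R) A) :=
  fun i => ⟨dig_norm2_le R A i, fun h => dig_norm2_of_le A h⟩

theorem good_ones {R n : ℕ} (h : n ≤ R) : Good R (ones 14 n) := by
  intro i
  have := dig_ones (c := 1) (by norm_num) n i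
  rw [one_mul] at this
  rw [this]
  constructor
  · split_ifs <;> omega
  · intro _
    rw [if_neg (by omega)]

/-- The result of eliminating with a pivot vector packed in `c` and entries in position `i`. -/
theorem dig_elim {R A1 c i r : ℕ} (hA : ∀ i, dig A1 i ≤ 127) (hc : Good R c) {t j : ℕ}
    (ht : t < r) (hj : j < R) :
    (dig (norm2 (127 * ones 14 (R * r)) (A1 + ((A1 / 2 ^ (14 * i)) &&& 127 * ones (14 * R) r) * c))
      (R * t + j) : ZMod 127) = dig A1 (R * t + j) + dig A1 (R * t + i) * dig c j := by
  set X := (A1 / 2 ^ (14 * i)) &&& 127 * ones (14 * R) r with hX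
  have hR : 0 < R := by omega
  have e1 : ∀ t, dg (2 ^ (14 * R)) X t = if t < r then dig A1 (R * t + i) else 0 := by
    intro t
    rw [hX, dg_land, ones_eq (by omega), dg_sum (Nat.one_lt_two_pow (by omega)) _ _ _
      (lt_of_lt_of_le (by norm_num) (Nat.pow_le_pow_right (n := 2) (by norm_num)
        (by omega : 14 ≤ 14 * R)))]
    split_ifs
    · rw [and_127]
      have h1 := hA (R * t + i)
      have h2 : (dg (2 ^ (14 * R)) (A1 / 2 ^ (14 * i)) t) % 128 = dig A1 (R * t + i) % 128 := by
        rw [pow_mul, pow_mul]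
        unfold dig dg
        rw [Nat.mod_mod_of_dvd _ (dvd_pow (by norm_num) (by omega) : 128 ∣ (2 ^ 14) ^ R),
          Nat.mod_mod_of_dvd _ (by norm_num : 128 ∣ 2 ^ 14), Nat.div_div_eq_div_mul]
        congr 2
        ring
      rw [h2]; omega
    · simp
  have e2 : ∀ t, dg (2 ^ (14 * R)) X t ≤ 127 := by
    intro t; rw [e1]; split_ifs
    · exact hA _
    · omega
  have e3 : ∀ t i, dig (dg (2 ^ (14 * R)) X t * c) i = dg (2 ^ (14 * R)) X t * dig c i := by
    intro t i
    rw [mul_comm, dig_mul, mul_comm]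
    intro i
    have := e2 t
    have := (hc i).1
    nlinarith
  have e4 : ∀ t, dg (2 ^ (14 * R)) X t * c < 2 ^ (14 * R) := fun t =>
    lt_of_dig fun i h => by rw [e3, (hc i).2 h, mul_zero]
  have e5 : ∀ t j, j < R → dig (X * c) (R * t + j) = dg (2 ^ (14 * R)) X t * dig c j := by
    intro t j hj
    rw [← e3, ← dg_mul (by positivity) e4, pow_mul]
    exact (dg_dg hj).symm
  have e6 : ∀ i, dig A1 i + dig (X * c) i < 16384 := by
    intro i
    have := e5 (i / R) (i % R) (Nat.mod_lt _ hR)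
    rw [Nat.div_add_mod] at this
    rw [this]
    have := e2 (i / R)
    have := (hc (i % R)).1
    have := hA i
    nlinarith
  have hlt : R * t + j < R * r := by
    have : R * (t + 1) ≤ R * r := Nat.mul_le_mul_left _ ht
    nlinarith
  rw [cast_dig_norm2, if_pos hlt, dig_add e6, e5 t j hj, e1, if_pos ht]
  push_cast
  ring

/-- Evaluation of `f x` after evaluation of `x` to a literal. -/
def force {α : Type} (x : ℕ) (f : ℕ → α) : α := match Nat.add x 1 with
  | 0 => f 0
  | n + 1 => f n

theorem force_eq {α : Type} (x : ℕ) (f : ℕ → α) : force x f = f x := rfl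

/-- Search for the highest nonzero digit. -/
def find (low : ℕ) : ℕ → ℕ → (ℕ → Bool) → Bool
  | 0, i, k => k i
  | f + 1, i, k =>
    match Nat.ble (Nat.pow 2 (Nat.mul 14 (Nat.add i (Nat.pow 2 f)))) low with
    | true => force (Nat.add i (Nat.pow 2 f)) fun i => find low f i k
    | false => find low f i k

/-- The position of a nonzero digit, with a guess. -/
def pivot (low p : ℕ) (k : ℕ → Bool) : Bool :=
  match Nat.land (Nat.shiftRight low (Nat.mul 14 p)) 127 with
  | 0 => find low 9 0 k
  | _ + 1 => k p

/-- Gaussian elimination on the rows of `A` with pivots in the lowest `cut` bits; the continuation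
gets the number of pivots and the reduced rows without pivots. -/
def elim (cut w O M S MA : ℕ) : ℕ → ℕ → ℕ → ℕ → List ℕ → (ℕ → List ℕ → Bool) → Bool
  | 0, _, _, c, l, k => k c l
  | f + 1, p, A, c, l, k =>
    force (canon M O (Nat.mod A (Nat.pow 2 w))) fun v =>
    force (Nat.shiftRight A w) fun A1 =>
    force (Nat.mod v (Nat.pow 2 cut)) fun low =>
    match low with
    | 0 => force (Nat.shiftRight v cut) fun r => elim cut w O M S MA f p A1 c (r :: l) k
    | _ + 1 =>
      pivot low p fun i => force (Nat.mul 14 i) fun sh =>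
      force (Nat.land (Nat.shiftRight low sh) 127) fun d =>
      force (Nat.mod (Nat.pow d 125) 127) fun inv =>
      match Nat.beq (Nat.mod (Nat.mul inv d) 127) 1 with
      | false => false
      | true =>
        force (norm2 M (Nat.mul v (Nat.sub 127 inv))) fun c' =>
        force (norm2 MA (Nat.add A1 (Nat.mul (Nat.land (Nat.shiftRight A1 sh) S) c'))) fun A2 =>
        elim cut w O M S MA f (Nat.sub p 1) A2 (Nat.add c 1) l k

theorem of_find (low f i : ℕ) (k : ℕ → Bool) (h : find low f i k = true) : ∃ i, k i = true := by
  induction f generalizing i with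
  | zero => exact ⟨i, h⟩
  | succ f ih =>
    rw [find] at h
    split at h
    · exact ih _ h
    · exact ih _ h

theorem of_pivot (low p : ℕ) (k : ℕ → Bool) (h : pivot low p k = true) : ∃ i, k i = true := by
  rw [pivot] at h
  split at h
  · exact of_find _ _ _ _ h
  · exact ⟨p, h⟩

theorem dig_div_lt {v n i : ℕ} (h : n ≤ i) : dig (v % 2 ^ (14 * n)) i = 0 := by
  rw [dig_mod, if_neg (by omega)]

/-- The outcome of the elimination for rows lying in a subspace. -/
theorem of_elim {n q r : ℕ} (f p A c : ℕ) (l : List ℕ) (k : ℕ → List ℕ → Bool)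
    (hf : f ≤ r) (hA : ∀ i, dig A i ≤ 127)
    (h : elim (14 * n) (14 * (n + q)) (ones 14 (n + q)) (127 * ones 14 (n + q))
      (127 * ones (14 * (n + q)) r) (127 * ones 14 ((n + q) * r)) f p A c l k = true) :
    ∃ (N : ℕ) (L : List ℕ), k (c + N) (L ++ l) = true ∧
      ∀ (V : Type) [AddCommGroup V] [Module (ZMod 127) V] [FiniteDimensional (ZMod 127) V]
        (E : (Fin (n + q) → ZMod 127) →ₗ[ZMod 127] V) (ε : Fin n → V →ₗ[ZMod 127] ZMod 127)
        (_ : ∀ i u, ε i (E u) = u (Fin.castAdd q i)) (W : Submodule (ZMod 127) V),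
        (∀ t < f, E (row (n + q) A t) ∈ W) →
        N + finrank (ZMod 127) ↥(W ⊓ ⨅ i, LinearMap.ker (ε i)) ≤ finrank (ZMod 127) W ∧
        ∀ y ∈ L, Good q y ∧ E (fun j => Fin.addCases (fun _ => 0) (fun j => (dig y j : ZMod 127)) j)
          ∈ W ⊓ ⨅ i, LinearMap.ker (ε i) := by
  induction f generalizing p A c l with
  | zero =>
    refine ⟨0, [], h, ?_⟩
    intro V _ _ _ E ε hε W hW
    refine ⟨?_, by simp⟩
    rw [zero_add]
    exact Submodule.finrank_mono inf_le_left
  | succ f ih =>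
    simp only [elim, force_eq] at h
    set R := n + q with hR
    set O := ones 14 R with hO
    change (match canon (127 * O) O (A % 2 ^ (14 * R)) % 2 ^ (14 * n) with
      | 0 => _
      | _ + 1 => _) = true at h
    set v := canon (127 * O) O (A % 2 ^ (14 * R)) with hv
    have hv1 : ∀ i, dig v i = if i < R then dig A i % 127 else 0 := by
      intro i
      rw [hv, hO, dig_canon]
      · rw [dig_mod]; split_ifs <;> rfl
      · intro i
        rw [dig_mod]
        have := hA i
        split_ifs <;> omega
    have hv2 : ∀ i, i < R → (dig v i : ZMod 127) = dig A i := by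
      intro i hi
      rw [hv1, if_pos hi]
      simp
    have hvg : Good R v := by
      intro i
      rw [hv1]
      constructor
      · split_ifs <;> omega
      · intro hi
        rw [if_neg (by omega)]
    have hrow : ∀ t, row R (A >>> (14 * R)) t = row R A (t + 1) := by
      intro t
      ext j
      rw [row, row, Nat.shiftRight_eq_div_pow, dig_shift]
      congr 2
      ring
    have hA1 : ∀ i, dig (A >>> (14 * R)) i ≤ 127 := by
      intro i
      rw [Nat.shiftRight_eq_div_pow, dig_shift]
      exact hA _
    split at h
    · rename_i hlow
      obtain ⟨N, L, hk, hL⟩ := ih _ _ _ _ (by omega) hA1 h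
      refine ⟨N, L ++ [v >>> (14 * n)], by rw [List.append_assoc]; exact hk, ?_⟩
      intro V _ _ _ E ε hε W hW
      have hl := hL V E ε hε W fun t ht => by
        rw [hrow]; exact hW _ (by omega)
      refine ⟨hl.1, ?_⟩
      intro y hy
      rw [List.mem_append, List.mem_singleton] at hy
      rcases hy with hy | rfl
      · exact hl.2 y hy
      · have hz : ∀ i < n, dig v i = 0 := by
          intro i hi
          have := dig_mod v n i
          rw [hlow, if_pos hi] at this
          rw [← this]
          simp [dig, dg]
        have he : (fun j => Fin.addCases (fun _ => 0)
            (fun j => (dig (v >>> (14 * n)) j : ZMod 127)) j) = row R A 0 := by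
          ext j
          refine Fin.addCases (fun i => ?_) (fun i => ?_) j
          · rw [Fin.addCases_left]
            simp only [row, mul_zero, zero_add]
            rw [← hv2 _ (by simp [hR]; omega)]
            simp [hz]
          · rw [Fin.addCases_right]
            simp only [row, mul_zero, zero_add]
            rw [← hv2 _ (by simp [hR]), Nat.shiftRight_eq_div_pow, dig_shift]
            rfl
        refine ⟨fun i => ?_, ?_⟩
        · rw [Nat.shiftRight_eq_div_pow, dig_shift]
          exact ⟨(hvg _).1, fun hi => (hvg _).2 (by omega)⟩
        · refine ⟨by rw [he]; exact hW 0 (by omega), ?_⟩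
          rw [SetLike.mem_coe, Submodule.mem_iInf]
          intro i
          rw [LinearMap.mem_ker, hε, Fin.addCases_left]
    · obtain ⟨i, h⟩ := of_pivot _ _ _ h
      split at h
      · exact absurd h (by simp)
      · rename_i hlow _ hinv
        set low := v % 2 ^ (14 * n) with hlowdef
        set d := (low >>> (14 * i)) &&& 127 with hd
        set inv := d ^ 125 % 127 with hinvd
        have hinv1 : (inv : ZMod 127) * d = 1 := by
          have := Nat.eq_of_beq_eq_true hinv
          change inv * d % 127 = 1 at this
          have h2 := ZMod.natCast_mod (inv * d) 127
          rw [this] at h2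
          push_cast at h2
          exact h2.symm
        have hdi : d = dig low i := by
          have : dig low i ≤ 127 := by
            rw [hlowdef, dig_mod]
            split_ifs
            · exact (hvg _).1
            · omega
          rw [hd, and_127, Nat.shiftRight_eq_div_pow]
          unfold dig dg at *
          rw [pow_mul]
          omega
        have hin : i < n := by
          by_contra hcon
          rw [hdi, hlowdef, dig_mod, if_neg hcon] at hinv1
          simp at hinv1
        have hiR : i < R := by omega
        have hdv : d = dig v i := by rw [hdi, hlowdef, dig_mod, if_pos hin]
        have hinv127 : inv < 127 := Nat.mod_lt _ (by norm_num)
        set c' := norm2 (127 * O) (v * (127 - inv)) with hc'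
        have hc'g : Good R c' := good_norm2 R _
        have hc'd : ∀ j < R, (dig c' j : ZMod 127) = - (inv * dig A j) := by
          intro j hj
          rw [hc', hO, cast_dig_norm2, if_pos hj, dig_mul, Nat.cast_mul, hv2 j hj,
            Nat.cast_sub hinv127.le]
          · have : ((127 : ℕ) : ZMod 127) = 0 := by decide
            rw [this]; ring
          · intro i
            have h1 := hv1 i
            have : dig v i ≤ 126 := by rw [h1]; split_ifs <;> omega
            have h3 : 127 - inv ≤ 127 := by omega
            calc dig v i * (127 - inv) ≤ 126 * 127 := Nat.mul_le_mul this h3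
              _ < _ := by norm_num
        set A2 := norm2 (127 * ones 14 (R * r)) (A >>> (14 * R) +
          (((A >>> (14 * R)) >>> (14 * i)) &&& 127 * ones (14 * R) r) * c') with hA2
        obtain ⟨N, L, hk, hL⟩ := ih _ A2 (c + 1) l (by omega) (fun i => dig_norm2_le _ _ _) h
        refine ⟨N + 1, L, by rw [← hk]; congr 1; omega, ?_⟩
        intro V _ _ _ E ε hε W hW
        have h0 := hW 0 (by omega)
        set ei := ε ⟨i, hin⟩ with hei
        have hrow2 : ∀ t < f, row R A2 t = row R A (t + 1) -
            (inv * row R A (t + 1) ⟨i, hiR⟩) • row R A 0 := by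
          intro t ht
          rw [← hrow]
          ext j
          have := dig_elim (i := i) hA1 hc'g (show t < r by omega) j.2
          rw [← Nat.shiftRight_eq_div_pow (A >>> (14 * R))] at this
          simp only [row, Pi.sub_apply, Pi.smul_apply, smul_eq_mul, mul_zero, zero_add]
          rw [hA2, this, hc'd j j.2]
          ring
        have hA0 : (inv : ZMod 127) * row R A 0 ⟨i, hiR⟩ = 1 := by
          rw [← hinv1, hdv, hv2 i hiR]
          simp [row]
        have hl := hL V E ε hε (W ⊓ LinearMap.ker ei) fun t ht => by
          rw [hrow2 t ht]
          refine ⟨?_, ?_⟩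
          · rw [map_sub, map_smul]
            exact W.sub_mem (hW _ (by omega)) (W.smul_mem _ h0)
          · rw [SetLike.mem_coe, LinearMap.mem_ker, hei, hε]
            change row R A (t + 1) ⟨i, hiR⟩ - (inv * row R A (t + 1) ⟨i, hiR⟩) * row R A 0 ⟨i, hiR⟩ = 0
            linear_combination (- row R A (t + 1) ⟨i, hiR⟩) * hA0
        have hle : W ⊓ LinearMap.ker ei ⊓ ⨅ i, LinearMap.ker (ε i) =
            W ⊓ ⨅ i, LinearMap.ker (ε i) := by
          rw [inf_assoc, inf_eq_right.mpr (iInf_le (fun i => LinearMap.ker (ε i)) _)]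
        have hlt : finrank (ZMod 127) ↥(W ⊓ LinearMap.ker ei) < finrank (ZMod 127) W := by
          refine Submodule.finrank_lt_finrank_of_lt (lt_of_le_of_ne inf_le_left fun he => ?_)
          rw [← he] at h0
          have h1 := h0.2
          rw [SetLike.mem_coe, LinearMap.mem_ker, hei, hε] at h1
          have h2 : row R A 0 ⟨i, hiR⟩ = 0 := h1
          rw [h2, mul_zero] at hA0
          exact zero_ne_one hA0
        rw [hle] at hl
        exact ⟨by omega, hl.2⟩

/-- A mask for the `i`-th bits of all digits of `x`. -/
def bit (O x i : ℕ) : ℕ := Nat.mul 127 (Nat.land (Nat.shiftRight x i) O)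

/-- Entrywise product of a vector with a vector given by its bit masks. -/
def prod (M : ℕ) (bs : List ℕ) (a : ℕ) : ℕ :=
  norm2 M (bs.foldr (fun m acc => Nat.add (Nat.land a m) (Nat.mul 2 acc)) 0)

theorem dig_bit (R x i j : ℕ) (hi : i < 7) :
    dig (bit (ones 14 R) x i) j = if j < R then 127 * (dig x j / 2 ^ i % 2) else 0 := by
  have h1 : ∀ j, dig (x >>> i &&& ones 14 R) j = if j < R then dig x j / 2 ^ i % 2 else 0 := by
    intro j
    have := dig_ones (c := 1) (by norm_num) R j
    rw [one_mul] at this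
    rw [dig_land, this, Nat.shiftRight_eq_div_pow]
    split_ifs
    · rw [Nat.and_one_is_mod]
      unfold dig dg
      rw [Nat.div_div_eq_div_mul, mul_comm, ← Nat.div_div_eq_div_mul]
      generalize x / (2 ^ 14) ^ j = y
      interval_cases i <;> omega
    · simp
  change dig (127 * (x >>> i &&& ones 14 R)) j = _
  rw [mul_comm, dig_mul, h1]
  · split_ifs <;> ring
  · intro j
    rw [h1]
    split_ifs <;> omega

theorem dig_prod_step {R x a acc y i : ℕ} (hi : i < 7) (ha : Good R a) (hy : ∀ j, dig acc j =
    if j < R then dig a j * (dig x j / 2 ^ (i + 1) % 2 ^ (6 - i)) else 0) (hye : y = 7 - i) (j : ℕ) :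
    dig (Nat.add (Nat.land a (bit (ones 14 R) x i)) (Nat.mul 2 acc)) j =
      if j < R then dig a j * (dig x j / 2 ^ i % 2 ^ y) else 0 := by
  subst hye
  have h1 : ∀ j, dig (a &&& bit (ones 14 R) x i) j =
      if j < R then dig a j * (dig x j / 2 ^ i % 2) else 0 := by
    intro j
    rw [dig_land, dig_bit _ _ _ _ hi]
    split_ifs
    · rcases Nat.mod_two_eq_zero_or_one (dig x j / 2 ^ i) with h | h
      · simp [h]
      · rw [h, mul_one, mul_one, and_127]
        have := (ha j).1
        omega
    · simp
  have hb : ∀ j, dig acc j ≤ 127 * 63 := by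
    intro j
    rw [hy]
    split_ifs
    · refine Nat.mul_le_mul (ha j).1 ?_
      have : dig x j / 2 ^ (i + 1) % 2 ^ (6 - i) < 2 ^ (6 - i) := Nat.mod_lt _ (by positivity)
      have : 2 ^ (6 - i) ≤ 2 ^ 6 := Nat.pow_le_pow_right (by norm_num) (by omega)
      omega
    · omega
  have h2 : ∀ j, dig (acc * 2) j = dig acc j * 2 := dig_mul fun j => by
    have := hb j
    omega
  change dig ((a &&& bit (ones 14 R) x i) + 2 * acc) j = _
  rw [mul_comm 2, dig_add, h1, h2, hy]
  · split_ifs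
    · rw [mul_assoc, ← mul_add, show 7 - i = (6 - i) + 1 by omega, pow_succ' 2 (6 - i), Nat.mod_mul, pow_succ 2 i,
        Nat.div_div_eq_div_mul]
      ring
    · rfl
  · intro j
    rw [h1, h2]
    have h3 := hb j
    have h4 := (ha j).1
    have h5 : dig x j / 2 ^ i % 2 ≤ 1 := by omega
    split_ifs
    · nlinarith
    · omega

/-- The bit masks of a vector. -/
def bits (O x : ℕ) : List ℕ :=
  [bit O x 0, bit O x 1, bit O x 2, bit O x 3, bit O x 4, bit O x 5, bit O x 6]

theorem cast_dig_prod {R x a : ℕ} (hx : Good R x) (ha : Good R a) (j : ℕ) (hj : j < R) :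
    (dig (prod (127 * ones 14 R) (bits (ones 14 R) x) a) j : ZMod 127) = dig x j * dig a j := by
  rw [prod, cast_dig_norm2, if_pos hj]
  have h7 : ∀ j, dig 0 j = if j < R then dig a j * (dig x j / 2 ^ (6 + 1) % 2 ^ (6 - 6)) else 0 := by
    intro j; simp [dig, dg, Nat.mod_one]
  have h6 := dig_prod_step (i := 6) (by norm_num) ha h7 rfl
  have h5 := dig_prod_step (i := 5) (by norm_num) ha h6 rfl
  have h4 := dig_prod_step (i := 4) (by norm_num) ha h5 rfl
  have h3 := dig_prod_step (i := 3) (by norm_num) ha h4 rfl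
  have h2 := dig_prod_step (i := 2) (by norm_num) ha h3 rfl
  have h1 := dig_prod_step (i := 1) (by norm_num) ha h2 rfl
  have h0 := dig_prod_step (i := 0) (by norm_num) ha h1 rfl
  have h := h0 j
  rw [if_pos hj, pow_zero, Nat.div_one, Nat.mod_eq_of_lt (by have := (hx j).1; omega)] at h
  change ((dig (List.foldr _ 0 (bits (ones 14 R) x)) j : ℕ) : ZMod 127) = _
  refine (congrArg Nat.cast h).trans ?_
  push_cast
  ring

theorem good_prod (R : ℕ) (bs : List ℕ) (a : ℕ) : Good R (prod (127 * ones 14 R) bs a) :=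
  good_norm2 _ _

/-- Enumeration of the monomials of degree `m` and weight `w`. -/
def gen (M : ℕ) : ℕ → List (ℕ × List ℕ) → ℕ → ℕ → ℕ → List ℕ → List ℕ
  | 0, _, _, _, _, acc => acc
  | f + 1, l, m, w, a, acc =>
    match l with
    | [] => acc
    | (i, b) :: t =>
      match m with
      | 0 => match w with
        | 0 => a :: acc
        | _ + 1 => acc
      | m' + 1 =>
        match Nat.ble w (Nat.mul (m' + 1) i) with
        | false => acc
        | true =>
          match Nat.ble i w with
          | false => gen M f t (m' + 1) w a acc
          | true => force (prod M b a) fun a' =>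
            gen M f ((i, b) :: t) m' (Nat.sub w i) a' (gen M f t (m' + 1) w a acc)

theorem of_gen {M : ℕ} {P : ℕ → ℕ → ℕ → Prop} (f : ℕ) (l : List (ℕ × List ℕ)) (m w a : ℕ)
    (acc : List ℕ) (hP : ∀ p ∈ l, ∀ m w a, P (m + 1) w a → p.1 ≤ w → P m (w - p.1) (prod M p.2 a))
    (ha : P m w a) (hacc : ∀ y ∈ acc, P 0 0 y) : ∀ y ∈ gen M f l m w a acc, P 0 0 y := by
  induction f generalizing l m w a acc with
  | zero => exact hacc
  | succ f ih =>
    rcases l with _ | ⟨⟨i, b⟩, t⟩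
    · exact hacc
    · have hPt := fun p hp => hP p (List.mem_cons_of_mem (i, b) hp)
      rcases m with _ | m
      · rcases w with _ | w
        · intro y hy
          rcases List.mem_cons.mp hy with rfl | hy
          · exact ha
          · exact hacc y hy
        · exact hacc
      · simp only [gen]
        split
        · exact hacc
        · split
          · exact ih _ _ _ _ _ hPt ha hacc
          · rename_i hle
            rw [force_eq]
            refine ih _ _ _ _ _ hP ?_ (ih _ _ _ _ _ hPt ha hacc)
            exact hP (i, b) List.mem_cons_self _ _ _ ha (Nat.le_of_ble_eq_true hle)

/-- Packing of a list of vectors into a matrix. -/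
def pack (w : ℕ) : List ℕ → ℕ → ℕ → (ℕ → ℕ → Bool) → Bool
  | [], A, n, k => k A n
  | x :: xs, A, n, k => force (Nat.add x (Nat.shiftLeft A w)) fun A => pack w xs A (Nat.add n 1) k

theorem dig_shiftLeft (A R i : ℕ) : dig (A <<< (14 * R)) i = if i < R then 0 else dig A (i - R) := by
  rw [Nat.shiftLeft_eq]
  unfold dig dg
  rw [← pow_mul, ← pow_mul]
  split_ifs with h
  · obtain ⟨d, rfl⟩ := Nat.exists_eq_add_of_lt h
    rw [show A * 2 ^ (14 * (i + d + 1)) = 2 ^ (14 * i) * (2 ^ 14 * (A * 2 ^ (14 * d))) by ring,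
      Nat.mul_div_cancel_left _ (by positivity), Nat.mul_mod_right]
  · obtain ⟨d, rfl⟩ := Nat.exists_eq_add_of_le (not_lt.mp h)
    rw [show 14 * (R + d) = 14 * R + 14 * d by ring, pow_add, ← Nat.div_div_eq_div_mul,
      Nat.mul_div_cancel _ (by positivity)]
    simp

theorem of_pack {R : ℕ} (xs : List ℕ) (A n : ℕ) (k : ℕ → ℕ → Bool) (h : pack (14 * R) xs A n k = true) :
    ∃ A' n', k A' n' = true ∧ ∀ Q : (Fin R → ZMod 127) → Prop, (∀ x ∈ xs, Good R x ∧ Q (row R x 0)) →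
      (∀ i, dig A i ≤ 127) → (∀ t < n, Q (row R A t)) →
      (∀ i, dig A' i ≤ 127) ∧ ∀ t < n', Q (row R A' t) := by
  induction xs generalizing A n with
  | nil => exact ⟨A, n, h, fun Q _ h1 h2 => ⟨h1, h2⟩⟩
  | cons x xs ih =>
    obtain ⟨A', n', hk, hA'⟩ := ih _ _ h
    refine ⟨A', n', hk, fun Q hQ h1 h2 => ?_⟩
    have hx := hQ x List.mem_cons_self
    have hd : ∀ i, dig (x + A <<< (14 * R)) i = if i < R then dig x i else dig A (i - R) := by
      intro i
      rw [dig_add, dig_shiftLeft]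
      · split_ifs
        · simp
        · rw [(hx.1 i).2 (by omega), zero_add]
      · intro i
        rw [dig_shiftLeft]
        have := (hx.1 i).1
        have := h1 (i - R)
        split_ifs <;> omega
    refine hA' Q (fun y hy => hQ y (List.mem_cons_of_mem _ hy)) (fun i => ?_) (fun t ht => ?_)
    · refine (hd i).le.trans ?_
      split_ifs
      · exact (hx.1 i).1
      · exact h1 _
    · have : row R (x + A <<< (14 * R)) t = if t = 0 then row R x 0 else row R A (t - 1) := by
        ext j
        rw [row, hd]
        rcases t with _ | t
        · simp [row]
        · have : R * (t + 1) = R * t + R := by ring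
          rw [if_neg (by omega), if_neg (by omega)]
          simp only [row, Nat.add_sub_cancel]
          congr 2
          omega
      change Q (row R (x + A <<< (14 * R)) t)
      rw [this]
      split_ifs with h0
      · exact hx.2
      · refine h2 _ ?_
        change t < n + 1 at ht
        omega

/-- The columns of the rank certificates: evaluations in `n` points, for each of eight blocks, and
joint evaluations in `q` further points. -/
abbrev Col (n q : ℕ) := (Fin 8 × Fin n) ⊕ Fin q

/-- The embedding of the rows of the block `k`. -/
def blockEmb (n q : ℕ) (k : Fin 8) : (Fin (n + q) → ZMod 127) →ₗ[ZMod 127] (Col n q → ZMod 127) where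
  toFun u := Sum.elim (fun p => if p.1 = k then u (Fin.castAdd q p.2) else 0)
    (fun j => u (Fin.natAdd n j))
  map_add' u v := by
    ext (p | j)
    · by_cases h : p.1 = k <;> simp [h]
    · simp
  map_smul' c u := by
    ext (p | j) <;> simp

/-- The embedding of the joint part. -/
def jointEmb (n q : ℕ) : (Fin q → ZMod 127) →ₗ[ZMod 127] (Col n q → ZMod 127) where
  toFun u := Sum.elim (fun _ => 0) u
  map_add' u v := by ext (p | j) <;> simp
  map_smul' c u := by ext (p | j) <;> simp

theorem blockEmb_addCases (n q : ℕ) (k : Fin 8) (u : Fin q → ZMod 127) :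
    blockEmb n q k (fun j => Fin.addCases (fun _ => 0) u j) = jointEmb n q u := by
  ext (p | j)
  · simp [blockEmb, jointEmb]
  · simp [blockEmb, jointEmb]

/-- Elimination in all blocks. -/
def runAll (cut w O M R m : ℕ) (vars : List (ℕ × List ℕ)) (p : ℕ) (fin : ℕ → List ℕ → Bool) :
    List (Fin 8 × ℕ × ℕ) → ℕ → List ℕ → Bool
  | [], c, l => fin c l
  | (_, wt, a) :: t, c, l =>
    force a fun a =>
    pack w (gen M 30 vars m wt a []) 0 0 fun A r =>
    force (Nat.mul 127 (ones w r)) fun S =>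
    force (Nat.mul 127 (ones 14 (Nat.mul R r))) fun MA =>
    elim cut w O M S MA r p A c l fun c l => runAll cut w O M R m vars p fin t c l

/-- Elimination in the joint columns. -/
def runFin (q target c : ℕ) (l : List ℕ) : Bool :=
  match Nat.ble target c with
  | true => true
  | false => pack (Nat.mul 14 q) l 0 0 fun A r =>
    force (ones 14 q) fun O => force (Nat.mul 127 O) fun M =>
    force (Nat.mul 127 (ones (Nat.mul 14 q) r)) fun S =>
    force (Nat.mul 127 (ones 14 (Nat.mul q r))) fun MA =>
    elim (Nat.mul 14 q) (Nat.mul 14 q) O M S MA r (Nat.sub q 1) A c [] fun c _ => Nat.ble target c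

theorem of_runFin {n q target c : ℕ} {l : List ℕ} (h : runFin q target c l = true)
    (W : Submodule (ZMod 127) (Col n q → ZMod 127))
    (hW : ∀ y ∈ l, Good q y ∧ jointEmb n q (row q y 0) ∈ W) :
    target ≤ c + finrank (ZMod 127) W := by
  rw [runFin] at h
  split at h
  · rename_i h1
    have := Nat.le_of_ble_eq_true h1
    omega
  · simp only [force_eq] at h
    obtain ⟨A, r, h, hA⟩ := of_pack _ _ _ _ h
    obtain ⟨N, L, hN, hL⟩ := of_elim (n := q) (q := 0) r _ A c [] _ le_rfl
      (hA (fun _ => True) (fun x hx => ⟨(hW x hx).1, trivial⟩) (by simp [dig, dg]) (by simp)).1 h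
    have h2 := hA (fun u => jointEmb n q u ∈ W) hW (by simp [dig, dg]) (by simp)
    have h3 := hL (Col n q → ZMod 127) (jointEmb n q) (fun i => LinearMap.proj (Sum.inr i))
      (fun i u => rfl) W h2.2
    have := Nat.le_of_ble_eq_true hN
    omega

theorem of_runAll {n q m target p : ℕ} {vars : List (ℕ × List ℕ)} (bl : List (Fin 8 × ℕ × ℕ)) (c : ℕ)
    (l : List ℕ) (hnd : (bl.map Prod.fst).Nodup)
    (h : runAll (14 * n) (14 * (n + q)) (ones 14 (n + q)) (127 * ones 14 (n + q)) (n + q) m vars p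
      (runFin q target) bl c l = true)
    (W : Submodule (ZMod 127) (Col n q → ZMod 127))
    (hW : ∀ y ∈ l, Good q y ∧ jointEmb n q (row q y 0) ∈ W)
    (hbl : ∀ b ∈ bl, ∀ y ∈ gen (127 * ones 14 (n + q)) 30 vars m b.2.1 b.2.2 [],
      Good (n + q) y ∧ blockEmb n q b.1 (row (n + q) y 0) ∈ W) :
    target ≤ c + finrank (ZMod 127) W := by
  induction bl generalizing c l W with
  | nil => exact of_runFin h W hW
  | cons b t ih =>
    obtain ⟨k, wt, a⟩ := b
    rw [List.map_cons, List.nodup_cons] at hnd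
    simp only [runAll, force_eq] at h
    obtain ⟨A, r, h, hA⟩ := of_pack _ _ _ _ h
    have hb := hbl _ List.mem_cons_self
    have h2 := hA (fun u => blockEmb n q k u ∈ W) hb (by simp [dig, dg]) (by simp)
    obtain ⟨N, L, hN, hL⟩ := of_elim (n := n) (q := q) r _ A c l _ le_rfl h2.1 h
    have h3 := hL (Col n q → ZMod 127) (blockEmb n q k) (fun i => LinearMap.proj (Sum.inl (k, i)))
      (fun i u => by simp [blockEmb]) W h2.2
    set W' := W ⊓ ⨅ i, LinearMap.ker
      (LinearMap.proj (R := ZMod 127) (φ := fun _ : Col n q => ZMod 127) (Sum.inl (k, i))) with hW'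
    have hmem : ∀ x, x ∈ W' ↔ x ∈ W ∧ ∀ i, x (Sum.inl (k, i)) = 0 := by
      intro x
      rw [hW', Submodule.mem_inf, Submodule.mem_iInf]
      rfl
    refine (ih (c + N) (L ++ l) hnd.2 hN W' (fun y hy => ?_) (fun b hbt y hy => ?_)).trans ?_
    · rcases List.mem_append.mp hy with hy | hy
      · obtain ⟨h4, h5⟩ := h3.2 y hy
        rw [blockEmb_addCases] at h5
        refine ⟨h4, ?_⟩
        convert h5 using 2
        ext j
        simp [row]
      · refine ⟨(hW y hy).1, (hmem _).mpr ⟨(hW y hy).2, fun i => rfl⟩⟩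
    · have h4 := hbl b (List.mem_cons_of_mem _ hbt) y hy
      refine ⟨h4.1, (hmem _).mpr ⟨h4.2, fun i => ?_⟩⟩
      have hne : k ≠ b.1 := by
        intro he
        refine hnd.1 ?_
        change k ∈ _
        rw [he]
        exact (List.mem_map_of_mem (f := Prod.fst) hbt)
      exact if_neg hne
    · omega

/-- Packing of the values of a function, followed by the digits of `acc`. -/
def packF (f : ℕ → ℕ) : ℕ → ℕ → (ℕ → Bool) → Bool
  | 0, acc, k => k acc
  | n + 1, acc, k => force (Nat.add (f n) (Nat.mul acc 16384)) fun x => packF f n x k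

theorem dig_cons {a A : ℕ} (ha : a < 16384) (i : ℕ) :
    dig (a + A * 16384) i = if i = 0 then a else dig A (i - 1) := by
  rcases i with _ | i
  · simp only [dig, dg, pow_zero, Nat.div_one, if_true]
    omega
  · have := dig_shift (a + A * 16384) 1 i
    rw [add_comm 1 i] at this
    rw [← this, if_neg (by omega), Nat.add_sub_cancel]
    congr 1
    omega

theorem of_packF (f : ℕ → ℕ) (hf : ∀ j, f j ≤ 127) (n acc : ℕ) (k : ℕ → Bool)
    (h : packF f n acc k = true) :
    ∃ x, k x = true ∧ ∀ j, dig x j = if j < n then f j else dig acc (j - n) := by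
  induction n generalizing acc with
  | zero => exact ⟨acc, h, fun j => by simp⟩
  | succ n ih =>
    rw [packF, force_eq] at h
    obtain ⟨x, hk, hx⟩ := ih _ h
    refine ⟨x, hk, fun j => ?_⟩
    rw [hx]
    change (if j < n then f j else dig (f n + acc * 16384) (j - n)) = _
    rw [dig_cons (by have := hf n; omega)]
    rcases lt_trichotomy j n with hj | rfl | hj
    · rw [if_pos hj, if_pos (by omega)]
    · simp
    · rw [if_neg (by omega), if_neg (by omega), if_neg (by omega), Nat.sub_sub]

/-- The polynomial with coefficients the `j`-th digits. -/
noncomputable def toP (j : ℕ) : List ℕ → Polynomial (ZMod 127)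
  | [] => 0
  | a :: t => Polynomial.C (dig a j : ZMod 127) + Polynomial.X * toP j t

theorem coeff_toP (j : ℕ) (l : List ℕ) (i : ℕ) : (toP j l).coeff i = dig (l.getD i 0) j := by
  induction l generalizing i with
  | nil => simp [toP, dig, dg]
  | cons a t ih =>
    rw [toP]
    cases i with
    | zero => simp
    | succ i => simp [ih]

/-- Multiplication by a linear polynomial. -/
def mulLin (M : ℕ) (bu bv : List ℕ) : List ℕ → ℕ → (List ℕ → Bool) → Bool
  | [], c, k => force (prod M bv c) fun x => k [x]
  | a :: t, c, k => force (norm2 M (Nat.add (prod M bu a) (prod M bv c))) fun x =>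
    mulLin M bu bv t a fun l => k (x :: l)

theorem of_mulLin {R u v : ℕ} (hu : Good R u) (hv : Good R v) (l : List ℕ) (c : ℕ)
    (hl : ∀ a ∈ l, Good R a) (hc : Good R c) (k : List ℕ → Bool)
    (h : mulLin (127 * ones 14 R) (bits (ones 14 R) u) (bits (ones 14 R) v) l c k = true) :
    ∃ l', k l' = true ∧ (∀ a ∈ l', Good R a) ∧ ∀ j < R, toP j l' =
      (Polynomial.C (dig u j : ZMod 127) + Polynomial.C (dig v j : ZMod 127) * Polynomial.X) *
        toP j l + Polynomial.C (dig v j * dig c j : ZMod 127) := by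
  induction l generalizing c k with
  | nil =>
    refine ⟨_, h, ?_, fun j hj => ?_⟩
    · intro a ha
      rw [List.mem_singleton.mp ha]
      exact good_prod _ _ _
    · simp [toP, cast_dig_prod hv hc j hj]
  | cons a t ih =>
    rw [mulLin, force_eq] at h
    have ha := hl a List.mem_cons_self
    obtain ⟨l', hk, hg, hl'⟩ := ih a (fun b hb => hl b (List.mem_cons_of_mem _ hb)) ha _ h
    refine ⟨_, hk, ?_, fun j hj => ?_⟩
    · intro b hb
      rcases List.mem_cons.mp hb with rfl | hb
      · exact good_norm2 _ _
      · exact hg b hb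
    · rw [toP, toP, hl' j hj, cast_dig_norm2, if_pos hj]
      change Polynomial.C ((dig (prod _ _ a + prod _ _ c) j : ℕ) : ZMod 127) + _ = _
      rw [dig_add, Nat.cast_add, cast_dig_prod hu ha j hj, cast_dig_prod hv hc j hj]
      · simp only [map_add, map_mul]
        ring
      · intro i
        have h1 := (good_prod R (bits (ones 14 R) u) a i).1
        have h2 := (good_prod R (bits (ones 14 R) v) c i).1
        omega

/-- Evaluation of the bit masks. -/
def forceBits (O x : ℕ) (k : List ℕ → Bool) : Bool :=
  force (bit O x 0) fun b0 => force (bit O x 1) fun b1 => force (bit O x 2) fun b2 =>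
  force (bit O x 3) fun b3 => force (bit O x 4) fun b4 => force (bit O x 5) fun b5 =>
  force (bit O x 6) fun b6 => k [b0, b1, b2, b3, b4, b5, b6]

theorem forceBits_eq (O x : ℕ) (k : List ℕ → Bool) : forceBits O x k = k (bits O x) := rfl

/-- Multiplication by linear polynomials `(p - r) + (q - r) X`. -/
def mulAll (M O p q : ℕ) : List ℕ → List ℕ → (List ℕ → Bool) → Bool
  | [], l, k => k l
  | r :: t, l, k =>
    force (norm2 M (Nat.add p (Nat.mul (Nat.sub 127 r) O))) fun u =>
    force (norm2 M (Nat.add q (Nat.mul (Nat.sub 127 r) O))) fun v =>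
    forceBits O u fun bu => forceBits O v fun bv =>
    mulLin M bu bv l 0 fun l => mulAll M O p q t l k

theorem cast_dig_norm2_sub {R p r j : ℕ} (hp : Good R p) (hr : r ≤ 127) (hj : j < R) :
    (dig (norm2 (127 * ones 14 R) (Nat.add p (Nat.mul (Nat.sub 127 r) (ones 14 R)))) j : ZMod 127) =
      dig p j - r := by
  have h1 := dig_ones (c := 127 - r) (by omega) R
  rw [cast_dig_norm2, if_pos hj]
  change ((dig (p + (127 - r) * ones 14 R) j : ℕ) : ZMod 127) = _
  rw [dig_add, h1, if_pos hj, Nat.cast_add, Nat.cast_sub hr]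
  · have : ((127 : ℕ) : ZMod 127) = 0 := by decide
    rw [this]; ring
  · intro i
    rw [h1]
    have := (hp i).1
    split_ifs <;> omega

theorem of_mulAll {R p q : ℕ} (hp : Good R p) (hq : Good R q) (rs : List ℕ) (hr : ∀ r ∈ rs, r ≤ 127)
    (l : List ℕ) (hl : ∀ a ∈ l, Good R a) (k : List ℕ → Bool)
    (h : mulAll (127 * ones 14 R) (ones 14 R) p q rs l k = true) :
    ∃ l', k l' = true ∧ (∀ a ∈ l', Good R a) ∧ ∀ j < R, toP j l' =
      (rs.map fun r : ℕ => Polynomial.C (dig p j - r : ZMod 127) +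
        Polynomial.C (dig q j - r : ZMod 127) * Polynomial.X).prod * toP j l := by
  induction rs generalizing l with
  | nil => exact ⟨l, h, hl, fun j hj => by simp⟩
  | cons r t ih =>
    simp only [mulAll, force_eq, forceBits_eq] at h
    have hg0 : Good R 0 := fun i => by simp [dig, dg]
    obtain ⟨l1, h1, hg1, hl1⟩ := of_mulLin (good_norm2 _ _) (good_norm2 _ _) l 0 hl hg0 _ h
    obtain ⟨l2, h2, hg2, hl2⟩ := ih (fun r hr' => hr r (List.mem_cons_of_mem _ hr')) l1 hg1 h1
    refine ⟨l2, h2, hg2, fun j hj => ?_⟩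
    have hr' := hr r List.mem_cons_self
    rw [hl2 j hj, hl1 j hj, cast_dig_norm2_sub hp hr' hj, cast_dig_norm2_sub hq hr' hj,
      List.map_cons, List.prod_cons]
    simp only [dig, dg, Nat.zero_div, Nat.zero_mod, Nat.cast_zero, mul_zero, map_zero, add_zero]
    ring

/-- The variables with the packed vectors of their values. -/
def withVars (O M : ℕ) (n q w : ℕ) (Q : ℕ → ℕ → ℕ) (cs : List ℕ) : List (Fin 8) →
    List (ℕ × List ℕ) → (List (ℕ × List ℕ) → Bool) → Bool
  | [], acc, k => k acc
  | i :: t, acc, k =>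
    packF (fun j => Q j i) q 0 fun y =>
    force (Nat.add (norm2 M (Nat.mul (cs.getD i 0) (nrm i))) (Nat.shiftLeft y w)) fun x =>
    forceBits O x fun b => withVars O M n q w Q cs t ((i, b) :: acc) k

theorem of_withVars {n q : ℕ} {Q : ℕ → ℕ → ℕ} (hQ : ∀ j i, Q j i ≤ 127) {cs : List ℕ}
    (hcs : ∀ a ∈ cs, Good n a) (is : List (Fin 8)) (acc : List (ℕ × List ℕ))
    (k : List (ℕ × List ℕ) → Bool)
    (h : withVars (ones 14 (n + q)) (127 * ones 14 n) n q (14 * n) Q cs is acc k = true)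
    {P : ℕ × List ℕ → Prop} (hacc : ∀ p ∈ acc, P p)
    (hP : ∀ (i : Fin 8) (x : ℕ), Good (n + q) x →
      (∀ j < n, (dig x j : ZMod 127) = dig (cs.getD i 0) j * nrm i) →
      (∀ j < q, dig x (n + j) = Q j i) → P (i, bits (ones 14 (n + q)) x)) :
    ∃ vars, k vars = true ∧ ∀ p ∈ vars, P p := by
  induction is generalizing acc with
  | nil => exact ⟨acc, h, hacc⟩
  | cons i t ih =>
    rw [withVars] at h
    obtain ⟨y, h, hy⟩ := of_packF _ (fun j => hQ j i) _ _ _ h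
    rw [force_eq, forceBits_eq] at h
    refine ih _ h ?_
    intro p hp
    rcases List.mem_cons.mp hp with rfl | hp
    · have hgc : Good n (cs.getD i 0) := by
        rw [List.getD_eq_getElem?_getD]
        rcases hc : cs[(i : ℕ)]? with _ | c
        · intro i; simp [dig, dg]
        · exact hcs c (List.mem_of_getElem? hc)
      set z := norm2 (127 * ones 14 n) (cs.getD i 0 * nrm i) with hz
      have hzg : Good n z := good_norm2 _ _
      have hd : ∀ j, dig (z + y <<< (14 * n)) j = if j < n then dig z j else dig y (j - n) := by
        intro j
        rw [dig_add, dig_shiftLeft]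
        · split_ifs
          · simp
          · rw [(hzg j).2 (by omega), zero_add]
        · intro j
          rw [dig_shiftLeft, hy]
          have := (hzg j).1
          have := hQ (j - n) i
          split_ifs
          · omega
          · omega
          · simp [dig, dg]; omega
      refine hP i (z + y <<< (14 * n)) ?_ ?_ ?_
      · intro j
        rw [hd, hy]
        refine ⟨?_, fun hj => ?_⟩
        · split_ifs
          · exact (hzg j).1
          · exact hQ _ _
          · simp [dig, dg]
        · rw [if_neg (by omega), if_neg (by omega)]
          simp [dig, dg]
      · intro j hj
        rw [hd, if_pos hj, hz, cast_dig_norm2, if_pos hj, dig_mul, Nat.cast_mul]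
        intro i'
        have h1 := (hgc i').1
        have h2 := (by decide : ∀ i, nrm i ≤ 105) i
        calc _ ≤ 127 * 105 := Nat.mul_le_mul h1 h2
          _ < _ := by norm_num
      · intro j hj
        rw [hd, if_neg (by omega), Nat.add_sub_cancel_left, hy, if_pos hj]
    · exact hacc p hp

/-- A pseudorandom number below `127`. -/
def hash (x : ℕ) : ℕ := Nat.mod (Nat.mod (Nat.pow (Nat.add x 1000) 3) 1000003) 127

theorem hash_lt (x : ℕ) : hash x < 127 := Nat.mod_lt _ (by norm_num)

/-- Symbolic parameters of the points used for evaluation. -/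
def crd : ℕ → ℕ → (ℕ ⊕ Fin 7) × (ℕ ⊕ Fin 7)
  | 0, j => (Sum.inl (hash (Nat.mul 2 j)), Sum.inl (hash (Nat.add (Nat.mul 2 j) 1)))
  | 1, j => (Sum.inr (Fin.ofNat 7 j), Sum.inl (Nat.div j 7))
  | _, j => (Sum.inr (Fin.ofNat 7 (Nat.div j 6)),
      Sum.inr (Fin.ofNat 7 (Nat.add (Nat.add (Nat.div j 6) 1) (Nat.mod j 6))))

/-- The additional points. -/
def extra (j i : ℕ) : ℕ := match i with
  | 0 => 0
  | i + 1 => hash (Nat.add (Nat.mul 7 j) (Nat.add i 5000))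

/-- The roots modulo `127`. -/
def roots : Fin 7 → ℕ := ![113, 21, 86, 101, 27, 75, 39]

/-- The value of a symbolic parameter modulo `127`. -/
def valN : ℕ ⊕ Fin 7 → ℕ
  | Sum.inl c => Nat.mod c 127
  | Sum.inr i => roots i

section Rows
variable {A : Type*} [CommRing A]

/-- The value of a symbolic parameter. -/
def val (ρ : Fin 7 → A) : ℕ ⊕ Fin 7 → A
  | Sum.inl c => c
  | Sum.inr i => ρ i

/-- The points used for evaluation. -/
noncomputable def zpt (kind : ℕ) (ρ : Fin 7 → A) (j : ℕ) : Fin 8 → A :=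
  pt ρ (val ρ (crd kind j).1) (val ρ (crd kind j).2) 1 1

/-- Evaluation of a monomial. -/
def mev (d : Fin 8 →₀ ℕ) (z : Fin 8 → A) : A := ∏ i, z i ^ d i

theorem mev_add (d e : Fin 8 →₀ ℕ) (z : Fin 8 → A) : mev (d + e) z = mev d z * mev e z := by
  simp [mev, pow_add, Finset.prod_mul_distrib]

theorem mev_single (i : Fin 8) (z : Fin 8 → A) : mev (Finsupp.single i 1) z = z i := by
  rw [mev, Finset.prod_eq_single i]
  · simp
  · intro b _ hb
    rw [Finsupp.single_eq_of_ne hb, pow_zero]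
  · simp

/-- The rows of the rank certificates. -/
noncomputable def rowA (kind n q : ℕ) (ρ : Fin 7 → A) (k : Fin 8) (d : Fin 8 →₀ ℕ) : Col n q → A :=
  Sum.elim (fun p => if p.1 = k then mev d (zpt kind ρ p.2) else 0)
    (fun j => (extra j k : A) * mev d (fun i => (extra j i : A)))

end Rows

/-- Preparation of the blocks. -/
def blocks (n q w : ℕ) : List (Fin 8) → List (Fin 8 × ℕ × ℕ) → (List (Fin 8 × ℕ × ℕ) → Bool) → Bool
  | [], acc, k => k acc
  | i :: t, acc, k => match Nat.ble i w with
    | false => false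
    | true => packF (fun j => extra j i) q 0 fun y => packF (fun _ => 1) n y fun a =>
      blocks n q w t ((i, Nat.sub w i, a) :: acc) k

/-- The variables not vanishing in all points. -/
def varList : ℕ → List (Fin 8)
  | 0 => [0, 1, 2, 3, 4, 5, 6, 7]
  | 1 => [1, 2, 3, 4, 5, 6, 7]
  | _ => [1, 2, 3, 4, 5, 6]

/-- The rank computation. -/
def check (kind n q m w target : ℕ) (ks : List (Fin 8)) : Bool :=
  force (ones 14 n) fun O => force (Nat.mul 127 O) fun M =>
  packF (fun j => valN (crd kind j).1) n 0 fun x =>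
  packF (fun j => valN (crd kind j).2) n 0 fun y =>
  mulAll M O x y [113, 21, 86, 101, 27, 75, 39] [O] fun cs =>
  force (ones 14 (Nat.add n q)) fun O' => force (Nat.mul 127 O') fun M' =>
  withVars O' M n q (Nat.mul 14 n) extra cs (varList kind) [] fun vars =>
  blocks n q w ks [] fun bl =>
  runAll (Nat.mul 14 n) (Nat.mul 14 (Nat.add n q)) O' M' (Nat.add n q) m vars (Nat.sub n 1) (runFin q target) bl 0 []

theorem valN_le (c : ℕ ⊕ Fin 7) : valN c ≤ 127 := by
  rcases c with c | i
  · exact (Nat.mod_lt _ (by norm_num)).le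
  · exact (by decide : ∀ i, roots i ≤ 127) i

theorem cast_valN (c : ℕ ⊕ Fin 7) :
    (valN c : ZMod 127) = val (fun i => (roots i : ZMod 127)) c := by
  rcases c with c | i
  · exact ZMod.natCast_mod c 127
  · rfl

theorem extra_le (j i : ℕ) : extra j i ≤ 127 := by
  rcases i with _ | i
  · exact Nat.zero_le _
  · exact (hash_lt _).le

theorem of_blocks {n q w : ℕ} (ks : List (Fin 8)) (acc : List (Fin 8 × ℕ × ℕ))
    (k : List (Fin 8 × ℕ × ℕ) → Bool) (h : blocks n q w ks acc k = true)
    {P : Fin 8 × ℕ × ℕ → Prop} (hacc : ∀ b ∈ acc, P b)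
    (hP : ∀ i ∈ ks, ∀ a, (i : ℕ) ≤ w → Good (n + q) a → (∀ j < n, dig a j = 1) →
      (∀ j < q, dig a (n + j) = extra j i) → P (i, w - i, a)) :
    ∃ bl, k bl = true ∧ bl.map Prod.fst = ks.reverse ++ acc.map Prod.fst ∧ ∀ b ∈ bl, P b := by
  induction ks generalizing acc with
  | nil => exact ⟨acc, h, by simp, hacc⟩
  | cons i t ih =>
    rw [blocks] at h
    split at h
    · exact absurd h (by simp)
    · rename_i hle
      obtain ⟨y, h, hy⟩ := of_packF _ (fun j => extra_le j i) _ _ _ h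
      obtain ⟨a, h, ha⟩ := of_packF (fun _ => 1) (fun j => by norm_num) _ _ _ h
      have h0 : ∀ j, dig 0 j = 0 := fun j => by simp [dig, dg]
      obtain ⟨bl, hk, hm, hbl⟩ := ih _ h (fun b hb => by
        rcases List.mem_cons.mp hb with rfl | hb
        · refine hP i List.mem_cons_self a (Nat.le_of_ble_eq_true hle) ?_ ?_ ?_
          · intro j
            rw [ha, hy]
            refine ⟨?_, fun hj => ?_⟩
            · split_ifs
              · norm_num
              · exact extra_le _ _
              · rw [h0]; norm_num
            · rw [if_neg (by omega), if_neg (by omega), h0]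
          · intro j hj
            rw [ha, if_pos hj]
          · intro j hj
            rw [ha, if_neg (by omega), hy, Nat.add_sub_cancel_left, if_pos hj]
        · exact hacc b hb) (fun i hi => hP i (List.mem_cons_of_mem _ hi))
      exact ⟨bl, hk, by simp [hm], hbl⟩

theorem prod_roots (f : ZMod 127 → Polynomial (ZMod 127)) :
    (([113, 21, 86, 101, 27, 75, 39] : List ℕ).map fun r : ℕ => f r).prod =
      ∏ i, f (roots i : ℕ) := by
  rw [← List.prod_ofFn]
  rfl

/-- The span of the rows of the rank certificates. -/
noncomputable def rowSpan (kind n q m w : ℕ) (ks : List (Fin 8)) :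
    Submodule (ZMod 127) (Col n q → ZMod 127) :=
  Submodule.span (ZMod 127) {u | ∃ k ∈ ks, ((k : Fin 8) : ℕ) ≤ w ∧
    ∃ d ∈ monSet m ((w : ℤ) - ((k : ℕ) : ℤ)),
      u = rowA kind n q (fun i => (roots i : ZMod 127)) k d}

theorem le_finrank_of_check {kind n q m w target : ℕ} {ks : List (Fin 8)} (hks : ks.Nodup)
    (h : check kind n q m w target ks = true) :
    target ≤ finrank (ZMod 127) (rowSpan kind n q m w ks) := by
  simp only [check, force_eq] at h
  obtain ⟨x, h, hx⟩ := of_packF _ (fun j => valN_le _) _ _ _ h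
  obtain ⟨y, h, hy⟩ := of_packF _ (fun j => valN_le _) _ _ _ h
  have h0 : ∀ j, dig 0 j = 0 := fun j => by simp [dig, dg]
  have hg : ∀ (f : ℕ → ℕ), (∀ j, f j ≤ 127) → ∀ x,
      (∀ j, dig x j = if j < n then f j else dig 0 (j - n)) → Good n x := by
    intro f hf x hx j
    rw [hx]
    refine ⟨?_, fun hj => ?_⟩
    · split_ifs
      · exact hf j
      · rw [h0]; norm_num
    · rw [if_neg (by omega), h0]
  have h1 := fun j => dig_ones (c := 1) (by norm_num) n j
  simp only [one_mul] at h1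
  obtain ⟨cs, h, hcs, hcs'⟩ := of_mulAll (hg _ (fun j => valN_le _) _ hx)
    (hg _ (fun j => valN_le _) _ hy) _ (by decide) _ (by
      intro a ha
      rw [List.mem_singleton.mp ha]
      intro j
      rw [h1]
      split_ifs
      · simp; omega
      · simp) _ h
  set ρ : Fin 7 → ZMod 127 := fun i => (roots i : ZMod 127) with hρ
  have hcoef : ∀ j < n, ∀ i : Fin 8, (dig (cs.getD i 0) j : ZMod 127) * nrm i =
      zpt kind ρ j i := by
    intro j hj i
    have h2 := hcs' j hj
    rw [hx, hy, if_pos hj, if_pos hj, cast_valN, cast_valN,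
      prod_roots (fun r => Polynomial.C (val ρ (crd kind j).1 - r) +
        Polynomial.C (val ρ (crd kind j).2 - r) * Polynomial.X)] at h2
    have h3 : toP j [ones 14 n] = 1 := by
      simp only [toP, mul_zero, add_zero]
      rw [h1, if_pos hj]
      simp
    rw [h3, mul_one] at h2
    rw [← coeff_toP, h2, zpt, pt, septic, linProd, mul_comm]
    simp only [mul_one]
    rfl
  obtain ⟨vars, h, hvars⟩ := of_withVars (Q := fun j i => extra j i) (fun j i => extra_le _ _) hcs
    _ _ _ h (P := fun p => ∃ (i : Fin 8) (x : ℕ), p = ((i : ℕ), bits (ones 14 (n + q)) x) ∧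
      Good (n + q) x ∧ (∀ j < n, (dig x j : ZMod 127) = zpt kind ρ j i) ∧
      ∀ j < q, (dig x (n + j) : ZMod 127) = extra j i) (by simp)
    (fun i x hx h1 h2 => ⟨i, x, rfl, hx, fun j hj => by rw [h1 j hj, hcoef j hj],
      fun j hj => by rw [h2 j hj]⟩)
  set W := rowSpan kind n q m w ks with hW
  obtain ⟨bl, h, hm, hbl⟩ := of_blocks _ _ _ h
    (P := fun b => ∀ y ∈ gen (127 * ones 14 (n + q)) 30 vars m b.2.1 b.2.2 [],
      Good (n + q) y ∧ blockEmb n q b.1 (row (n + q) y 0) ∈ W) (by simp) (by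
    intro k hk a hkw ha han haq
    set P : ℕ → ℕ → ℕ → Prop := fun m' w' a => m' ≤ m ∧ w' ≤ w - k ∧ Good (n + q) a ∧
      ∃ d ∈ monSet (m - m') ((w - k : ℕ) - w' : ℤ),
        (∀ j < n, (dig a j : ZMod 127) = mev d (zpt kind ρ j)) ∧
        ∀ j < q, (dig a (n + j) : ZMod 127) = extra j k * mev d (fun i => (extra j i : ZMod 127))
      with hPdef
    have key := of_gen (M := 127 * ones 14 (n + q)) (P := P) 30 vars m (w - k) a [] (by
      rintro p hp m' w' b ⟨hm', hw', hb, d, hd, hd1, hd2⟩ hpw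
      obtain ⟨i, x, rfl, hxg, hx1, hx2⟩ := hvars p hp
      refine ⟨by omega, by omega, good_prod _ _ _, d + Finsupp.single i 1, ?_, ?_, ?_⟩
      · have := monSet_add hd (single_mem_monSet i)
        simp only at hpw ⊢
        convert this using 2 <;> omega
      · intro j hj
        rw [cast_dig_prod hxg hb j (by omega), mev_add, mev_single, hx1 j hj, hd1 j hj, mul_comm]
      · intro j hj
        rw [cast_dig_prod hxg hb (n + j) (by omega), mev_add, mev_single, hx2 j hj, hd2 j hj]
        ring) ⟨le_rfl, le_rfl, ha, 0, by simp [mem_monSet], fun j hj => by simp [mev, han j hj],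
        fun j hj => by simp [mev, haq j hj]⟩ (by simp)
    intro y hy
    obtain ⟨-, -, hyg, d, hd, hd1, hd2⟩ := key y hy
    refine ⟨hyg, Submodule.subset_span ⟨k, hk, hkw, d, ?_, ?_⟩⟩
    · convert hd using 2 <;> omega
    · ext (p | j)
      · simp only [blockEmb, rowA, row, LinearMap.coe_mk, AddHom.coe_mk, Sum.elim_inl, mul_zero,
          zero_add, Fin.val_castAdd]
        rw [hd1 _ p.2.2]
      · simp only [blockEmb, rowA, row, LinearMap.coe_mk, AddHom.coe_mk, Sum.elim_inr, mul_zero,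
          zero_add, Fin.val_natAdd]
        rw [hd2 _ j.2])
  have := of_runAll bl 0 [] (by simpa [hm] using hks) h W (by simp) hbl
  omega

theorem exists_ne_zero_of_le_finrank {ι κ A K : Type*} [Fintype κ] [CommRing A] [Field K]
    (φ : A →+* K) (hφ : Function.Surjective φ) (r : ι → κ → A) (N : ℕ)
    (h : N ≤ finrank K (Submodule.span K (Set.range fun i => φ ∘ r i))) :
    ∃ f : A, f ≠ 0 ∧ ∀ ψ : A →+* ℂ, ψ f ≠ 0 →
      N ≤ finrank ℂ (Submodule.span ℂ (Set.range fun i => ψ ∘ r i)) := by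
  classical
  obtain ⟨b, hb, hspan, hli⟩ := exists_linearIndependent K (Set.range fun i => φ ∘ r i)
  have : Fintype b := hli.setFinite.fintype
  rw [← hspan, ← Subtype.range_coe (s := b), finrank_span_eq_card hli] at h
  obtain ⟨e⟩ : Nonempty (Fin N ↪ b) := Function.Embedding.nonempty_of_card_le (by simpa using h)
  have hs : ∀ i, ∃ j, φ ∘ r j = (e i : κ → K) := fun i => hb (e i).2
  choose s hs using hs
  have hli' : LinearIndependent K fun i => φ ∘ r (s i) := by
    simp_rw [hs]
    exact hli.comp e e.injective
  obtain ⟨C, hC⟩ : ∃ C : Matrix κ (Fin N) K, (Matrix.of fun i => φ ∘ r (s i)) * C = 1 := by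
    obtain ⟨g, hg⟩ := LinearMap.exists_leftInverse_of_injective
      (Matrix.vecMulLinear (Matrix.of fun i => φ ∘ r (s i)))
      (LinearMap.ker_eq_bot.mpr (Matrix.vecMul_injective_iff.mpr hli'))
    refine ⟨(LinearMap.toMatrix' g).transpose, Matrix.ext_of_single_vecMul fun i => ?_⟩
    rw [← Matrix.vecMul_vecMul, Matrix.vecMul_one, Matrix.vecMul_transpose,
      LinearMap.toMatrix'_mulVec]
    exact LinearMap.congr_fun hg _
  choose C' hC' using fun i j => hφ (C i j)
  set M : Matrix (Fin N) κ A := Matrix.of fun i => r (s i) with hM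
  have hdet : φ (M * Matrix.of C').det = 1 := by
    rw [RingHom.map_det, RingHom.mapMatrix_apply, Matrix.map_mul]
    have h1 : (Matrix.of C').map φ = C := by
      ext i j
      exact hC' i j
    have h2 : M.map φ = Matrix.of fun i => φ ∘ r (s i) := rfl
    rw [h1, h2, hC, Matrix.det_one]
  refine ⟨(M * Matrix.of C').det, fun h0 => by simp [h0] at hdet, fun ψ hψ => ?_⟩
  have hli2 : LinearIndependent ℂ fun i => ψ ∘ r (s i) := by
    have : Function.Injective (Matrix.vecMul · (M.map ψ)) := by
      refine (injective_iff_map_eq_zero (Matrix.vecMulLinear (M.map ψ))).mpr fun v hv => ?_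
      rw [Matrix.vecMulLinear_apply] at hv
      rw [RingHom.map_det, RingHom.mapMatrix_apply, Matrix.map_mul] at hψ
      refine Matrix.eq_zero_of_vecMul_eq_zero hψ ?_
      rw [← Matrix.vecMul_vecMul, hv, Matrix.zero_vecMul]
    exact Matrix.vecMul_injective_iff.mp this
  have h2 := finrank_span_eq_card hli2
  rw [Fintype.card_fin] at h2
  rw [← h2]
  refine Submodule.finrank_mono (Submodule.span_mono ?_)
  rintro _ ⟨i, rfl⟩
  exact ⟨s i, rfl⟩

/-- A property holds for all tuples outside of some hypersurface. -/
def Gen (P : (Fin 7 → ℂ) → Prop) : Prop :=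
  ∃ f : MvPolynomial (Fin 7) ℤ, f ≠ 0 ∧ ∀ ρ, aeval ρ f ≠ 0 → P ρ

theorem Gen.mono {P Q : (Fin 7 → ℂ) → Prop} (hP : Gen P) (h : ∀ ρ, P ρ → Q ρ) : Gen Q := by
  obtain ⟨f, hf, hP⟩ := hP
  exact ⟨f, hf, fun ρ hρ => h ρ (hP ρ hρ)⟩

theorem Gen.and {P Q : (Fin 7 → ℂ) → Prop} (hP : Gen P) (hQ : Gen Q) : Gen fun ρ => P ρ ∧ Q ρ := by
  obtain ⟨f, hf, hP⟩ := hP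
  obtain ⟨g, hg, hQ⟩ := hQ
  refine ⟨f * g, mul_ne_zero hf hg, fun ρ hρ => ?_⟩
  rw [map_mul] at hρ
  exact ⟨hP ρ (left_ne_zero_of_mul hρ), hQ ρ (right_ne_zero_of_mul hρ)⟩

theorem gen_injective : Gen Function.Injective := by
  refine ⟨∏ p : Fin 7 × Fin 7 with p.1 ≠ p.2, (X p.1 - X p.2), ?_, ?_⟩
  · refine Finset.prod_ne_zero_iff.mpr fun p hp => ?_
    rw [sub_ne_zero]
    exact fun h => (Finset.mem_filter.mp hp).2 (X_injective h)
  · intro ρ hρ i j hij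
    by_contra hne
    refine hρ ?_
    rw [map_prod]
    exact Finset.prod_eq_zero (i := (i, j)) (by simp [hne]) (by simp [hij])

theorem map_zpt {A B : Type*} [CommRing A] [CommRing B] (φ : A →+* B) (kind : ℕ) (ρ : Fin 7 → A)
    (j : ℕ) (k : Fin 8) : φ (zpt kind ρ j k) = zpt kind (φ ∘ ρ) j k := by
  have hv : ∀ c, φ (val ρ c) = val (φ ∘ ρ) c := by
    rintro (c | i) <;> simp [val]
  rw [zpt, zpt, map_pt, map_one, hv, hv]
  rfl

theorem map_rowA {A B : Type*} [CommRing A] [CommRing B] (φ : A →+* B) (kind n q : ℕ)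
    (ρ : Fin 7 → A) (k : Fin 8) (d : Fin 8 →₀ ℕ) :
    φ ∘ rowA kind n q ρ k d = rowA kind n q (φ ∘ ρ) k d := by
  ext (p | j)
  · simp only [Function.comp_apply, rowA, Sum.elim_inl]
    split_ifs
    · simp [mev, map_zpt, Function.comp_def]
    · simp
  · simp [rowA, mev]

/-- The span of the rows of the rank certificates over the complex numbers. -/
noncomputable def rowSpanC (kind n q m w : ℕ) (ks : List (Fin 8)) (ρ : Fin 7 → ℂ) :
    Submodule ℂ (Col n q → ℂ) :=
  Submodule.span ℂ {u | ∃ k ∈ ks, ((k : Fin 8) : ℕ) ≤ w ∧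
    ∃ d ∈ monSet m ((w : ℤ) - ((k : ℕ) : ℤ)), u = rowA kind n q ρ k d}

theorem gen_of_check {kind n q m w target : ℕ} {ks : List (Fin 8)} (hks : ks.Nodup)
    (h : check kind n q m w target ks = true) :
    Gen fun ρ => target ≤ finrank ℂ (rowSpanC kind n q m w ks ρ) := by
  have h1 := le_finrank_of_check hks h
  set ι := {p : Fin 8 × (Fin 8 →₀ ℕ) // p.1 ∈ ks ∧ (p.1 : ℕ) ≤ w ∧
    p.2 ∈ monSet m ((w : ℤ) - ((p.1 : ℕ) : ℤ))}
  let φ : MvPolynomial (Fin 7) ℤ →+* ZMod 127 :=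
    (aeval fun i => (roots i : ZMod 127) : MvPolynomial (Fin 7) ℤ →ₐ[ℤ] ZMod 127).toRingHom
  have hset : ∀ {K : Type} [CommRing K] (ρ : Fin 7 → K) (φ : MvPolynomial (Fin 7) ℤ →+* K),
      (∀ i, φ (X i) = ρ i) →
      {u | ∃ k ∈ ks, ((k : Fin 8) : ℕ) ≤ w ∧
        ∃ d ∈ monSet m ((w : ℤ) - ((k : ℕ) : ℤ)), u = rowA kind n q ρ k d} =
      Set.range fun i : ι => φ ∘ rowA kind n q X i.1.1 i.1.2 := by
    intro K _ ρ φ hφ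
    have : φ ∘ X = ρ := funext hφ
    ext u
    constructor
    · rintro ⟨k, hk, hkw, d, hd, rfl⟩
      exact ⟨⟨(k, d), hk, hkw, hd⟩, by simp only [map_rowA, this]⟩
    · rintro ⟨⟨⟨k, d⟩, hk, hkw, hd⟩, rfl⟩
      exact ⟨k, hk, hkw, d, hd, by simp only [map_rowA, this]⟩
  rw [rowSpan, hset _ φ (fun i => by simp [φ])] at h1
  obtain ⟨f, hf, hf'⟩ := exists_ne_zero_of_le_finrank φ (fun x => by
    obtain ⟨y, rfl⟩ := ZMod.intCast_surjective x
    exact ⟨(y : MvPolynomial (Fin 7) ℤ), map_intCast φ y⟩) _ _ h1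
  refine ⟨f, hf, fun ρ hρ => ?_⟩
  beta_reduce
  rw [rowSpanC, hset ρ (aeval ρ : MvPolynomial (Fin 7) ℤ →ₐ[ℤ] ℂ).toRingHom (fun i => by simp)]
  exact hf' _ hρ

/-- The supremum of a family of subspaces indexed by a list. -/
noncomputable def supL {ι V : Type*} [AddCommGroup V] [Module ℂ V] (F : ι → Submodule ℂ V) :
    List ι → Submodule ℂ V
  | [] => ⊥
  | k :: t => F k ⊔ supL F t

section SupL
variable {ι V W : Type*} [AddCommGroup V] [Module ℂ V] [AddCommGroup W] [Module ℂ W]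

theorem supL_le {F : ι → Submodule ℂ V} {l : List ι} {U : Submodule ℂ V} :
    supL F l ≤ U ↔ ∀ k ∈ l, F k ≤ U := by
  induction l with
  | nil => simp [supL]
  | cons k t ih => simp [supL, ih]

theorem le_supL {F : ι → Submodule ℂ V} {l : List ι} {k : ι} (hk : k ∈ l) : F k ≤ supL F l :=
  supL_le.mp le_rfl k hk

theorem map_supL (T : V →ₗ[ℂ] W) (F : ι → Submodule ℂ V) (l : List ι) :
    (supL F l).map T = supL (fun k => (F k).map T) l := by
  induction l with
  | nil => simp [supL]
  | cons k t ih => simp [supL, Submodule.map_sup, ih]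

theorem supL_congr {F G : ι → Submodule ℂ V} {l : List ι} (h : ∀ k ∈ l, F k = G k) :
    supL F l = supL G l := by
  induction l with
  | nil => rfl
  | cons k t ih =>
    rw [supL, supL, h k List.mem_cons_self, ih fun k hk => h k (List.mem_cons_of_mem _ hk)]

theorem finrank_sup_le (S T : Submodule ℂ V) [FiniteDimensional ℂ S] [FiniteDimensional ℂ T] :
    finrank ℂ ↥(S ⊔ T) ≤ finrank ℂ S + finrank ℂ T := by
  have := Submodule.finrank_sup_add_finrank_inf_eq S T
  omega

theorem finrank_map_sup_le (T : V →ₗ[ℂ] W) {A B : Submodule ℂ V} (h : B ≤ A)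
    [FiniteDimensional ℂ A] (U : Submodule ℂ W) [FiniteDimensional ℂ U] :
    finrank ℂ ↥(A.map T ⊔ U) ≤ (finrank ℂ A - finrank ℂ B) + finrank ℂ ↥(B.map T ⊔ U) := by
  have := Submodule.finiteDimensional_of_le h
  obtain ⟨C, hC, hdis⟩ : ∃ C : Submodule ℂ V, B ⊔ C = A ∧ Disjoint B C := by
    obtain ⟨C, hd, hc⟩ := exists_isCompl (⟨B, h⟩ : Set.Iic A)
    refine ⟨C.1, ?_, ?_⟩
    · have := hc.eq_top
      exact congrArg Subtype.val this
    · rw [disjoint_iff]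
      exact congrArg Subtype.val hd.eq_bot
  have : FiniteDimensional ℂ C := Submodule.finiteDimensional_of_le (hC ▸ le_sup_right)
  have h1 := Submodule.finrank_sup_add_finrank_inf_eq B C
  rw [hC, hdis.eq_bot, finrank_bot] at h1
  have h2 : A.map T ⊔ U = C.map T ⊔ (B.map T ⊔ U) := by
    rw [← hC, Submodule.map_sup, sup_comm (B.map T), sup_assoc]
  have h3 := finrank_sup_le (C.map T) (B.map T ⊔ U)
  have h4 := Submodule.finrank_map_le T C
  rw [h2]
  omega

theorem finrank_supL_map_le (T : ι → V →ₗ[ℂ] W) {A B : ι → Submodule ℂ V} (h : ∀ k, B k ≤ A k)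
    [∀ k, FiniteDimensional ℂ (A k)] (l : List ι) (U : Submodule ℂ W) [FiniteDimensional ℂ U] :
    finrank ℂ ↥(supL (fun k => (A k).map (T k)) l ⊔ U) ≤
      (l.map fun k => finrank ℂ (A k) - finrank ℂ (B k)).sum +
        finrank ℂ ↥(supL (fun k => (B k).map (T k)) l ⊔ U) := by
  induction l generalizing U with
  | nil => exact (Nat.zero_add _).ge
  | cons k t ih =>
    have := Submodule.finiteDimensional_of_le (h k)
    have h1 := ih ((A k).map (T k) ⊔ U)
    have : FiniteDimensional ℂ (supL (fun k => (B k).map (T k)) t) := by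
      clear h1 ih
      induction t with
      | nil => exact inferInstanceAs (FiniteDimensional ℂ (⊥ : Submodule ℂ W))
      | cons k t ih =>
        have := Submodule.finiteDimensional_of_le (h k)
        rw [supL]
        infer_instance
    have h2 := finrank_map_sup_le (T k) (h k) (supL (fun k => (B k).map (T k)) t ⊔ U)
    have e1 : supL (fun k => (A k).map (T k)) (k :: t) ⊔ U =
        supL (fun k => (A k).map (T k)) t ⊔ ((A k).map (T k) ⊔ U) := by
      rw [supL, sup_comm ((A k).map (T k)), sup_assoc]
    have e2 : supL (fun k => (B k).map (T k)) (k :: t) ⊔ U =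
        (B k).map (T k) ⊔ (supL (fun k => (B k).map (T k)) t ⊔ U) := by
      rw [supL, sup_assoc]
    have e3 : (A k).map (T k) ⊔ (supL (fun k => (B k).map (T k)) t ⊔ U) =
        supL (fun k => (B k).map (T k)) t ⊔ ((A k).map (T k) ⊔ U) := sup_left_comm _ _ _
    rw [e3] at h2
    rw [e1, e2, List.map_cons, List.sum_cons]
    omega

end SupL

/-- The sets on which the evaluation points lie. -/
def Zk (kind : ℕ) (ρ : Fin 7 → ℂ) : Set (Fin 8 → ℂ) := match kind with
  | 0 => Z0 ρ
  | 1 => Z1 ρ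
  | _ => Z2 ρ

theorem zpt_mem (kind : ℕ) (ρ : Fin 7 → ℂ) (j : ℕ) : zpt kind ρ j ∈ Zk kind ρ := by
  match kind with
  | 0 => exact ⟨_, _, _, _, rfl⟩
  | 1 => exact mem_Z1.mpr ⟨Fin.ofNat 7 j, _, 1, 1, by rw [mul_one]; rfl⟩
  | k + 2 =>
    exact mem_Z2.mpr ⟨Fin.ofNat 7 (Nat.div j 6),
      Fin.ofNat 7 (Nat.add (Nat.add (Nat.div j 6) 1) (Nat.mod j 6)), 1, 1, by
        rw [mul_one, mul_one]; rfl⟩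

/-- The evaluation maps of the rank certificates. -/
noncomputable def evB (kind n q : ℕ) (ρ : Fin 7 → ℂ) (k : Fin 8) :
    MvPolynomial (Fin 8) ℂ →ₗ[ℂ] Col n q → ℂ :=
  LinearMap.pi (Sum.elim
    (fun p => if p.1 = k then (aeval (zpt kind ρ p.2) : MvPolynomial (Fin 8) ℂ →ₐ[ℂ] ℂ).toLinearMap
      else 0)
    (fun j => (extra j k : ℂ) •
      (aeval (fun i => (extra j i : ℂ)) : MvPolynomial (Fin 8) ℂ →ₐ[ℂ] ℂ).toLinearMap))

/-- Evaluation at the additional points. -/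
noncomputable def evQ (n q : ℕ) : MvPolynomial (Fin 8) ℂ →ₗ[ℂ] Col n q → ℂ :=
  LinearMap.pi (Sum.elim (fun _ => 0)
    (fun j => (aeval (fun i : Fin 8 => (extra j i : ℂ)) : MvPolynomial (Fin 8) ℂ →ₐ[ℂ] ℂ).toLinearMap))

theorem evB_monomial (kind n q : ℕ) (ρ : Fin 7 → ℂ) (k : Fin 8) (d : Fin 8 →₀ ℕ) :
    evB kind n q ρ k (monomial d 1) = rowA kind n q ρ k d := by
  ext (p | j)
  · simp only [evB, LinearMap.pi_apply, Sum.elim_inl, rowA]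
    split_ifs
    · simp [aeval_monomial, mev, Finsupp.prod_fintype]
    · rfl
  · simp [evB, rowA, aeval_monomial, mev, Finsupp.prod_fintype]

theorem rowSpanC_le (kind n q m w : ℕ) (ks : List (Fin 8)) (ρ : Fin 7 → ℂ) :
    rowSpanC kind n q m w ks ρ ≤
      supL (fun k : Fin 8 => (Pol m ((w : ℤ) - ((k : ℕ) : ℤ))).map (evB kind n q ρ k)) ks := by
  refine Submodule.span_le.mpr ?_
  rintro _ ⟨k, hk, -, d, hd, rfl⟩
  refine le_supL hk ?_
  rw [← evB_monomial]
  exact Submodule.mem_map_of_mem (monomial_mem_Pol hd 1)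

theorem evB_eq {kind n q m : ℕ} {w : ℤ} {ρ : Fin 7 → ℂ} (k : Fin 8) {f : MvPolynomial (Fin 8) ℂ}
    (hf : f ∈ Van (Zk kind ρ) m w) : evB kind n q ρ k f = evQ n q (mulX k f) := by
  ext (p | j)
  · simp only [evB, evQ, LinearMap.pi_apply, Sum.elim_inl]
    split_ifs
    · exact (mem_Van.mp hf).1 _ (zpt_mem _ _ _)
    · rfl
  · simp [evB, evQ, mulX_apply]

theorem le_of_rowSpanC {kind n q m w target : ℕ} {ks : List (Fin 8)} {ρ : Fin 7 → ℂ}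
    (h : target ≤ finrank ℂ (rowSpanC kind n q m w ks ρ)) :
    target ≤ (ks.map fun k : Fin 8 => cod (Zk kind ρ) m (w - ((k : ℕ) : ℤ))).sum +
      finrank ℂ ((supL (fun k : Fin 8 => (Van (Zk kind ρ) m (w - ((k : ℕ) : ℤ))).map (mulX k)) ks).map
        (evQ n q)) := by
  have h1 := Submodule.finrank_mono (rowSpanC_le kind n q m w ks ρ)
  have h2 := finrank_supL_map_le (fun k => evB kind n q ρ k)
    (A := fun k : Fin 8 => Pol m ((w : ℤ) - ((k : ℕ) : ℤ)))
    (B := fun k : Fin 8 => Van (Zk kind ρ) m ((w : ℤ) - ((k : ℕ) : ℤ))) (fun k : Fin 8 => Van_le_Pol _ _ _) ks ⊥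
  rw [sup_bot_eq, sup_bot_eq] at h2
  have h3 : supL (fun k : Fin 8 => (Van (Zk kind ρ) m ((w : ℤ) - ((k : ℕ) : ℤ))).map (evB kind n q ρ k)) ks =
      (supL (fun k : Fin 8 => (Van (Zk kind ρ) m (w - ((k : ℕ) : ℤ))).map (mulX k)) ks).map (evQ n q) := by
    rw [map_supL]
    refine supL_congr fun k _ => ?_
    rw [← Submodule.map_comp]
    ext x
    simp only [Submodule.mem_map]
    refine exists_congr fun f => and_congr_right fun hf => ?_
    rw [evB_eq k hf]
    rfl
  rw [h3] at h2
  exact (h.trans h1).trans h2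

theorem gen_cod {kind n m w target : ℕ} (h : check kind n 0 m w target [0] = true) :
    Gen fun ρ => target ≤ cod (Zk kind ρ) m w := by
  refine (gen_of_check (List.nodup_singleton _) h).mono fun ρ hρ => ?_
  have h1 := le_of_rowSpanC hρ
  have h2 : evQ n 0 = 0 := by
    refine LinearMap.ext fun f => ?_
    ext (p | j)
    · rfl
    · exact j.elim0
  rw [h2, Submodule.map_zero, finrank_bot] at h1
  simpa using h1

theorem evQ_mulX_zero (n q : ℕ) (f : MvPolynomial (Fin 8) ℂ) : evQ n q (mulX 0 f) = 0 := by
  ext (p | j)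
  · rfl
  · simp [evQ, mulX_apply, extra]

theorem gen_block {kind n q m w target : ℕ} {ks : List (Fin 8)} (hks : ks.Nodup)
    (h : check kind n q m w target ks = true) :
    Gen fun ρ => ∀ S : Submodule ℂ (MvPolynomial (Fin 8) ℂ), S ≤ Pol m w →
      target + finrank ℂ S ≤ (ks.map fun k : Fin 8 => cod (Zk kind ρ) m (w - ((k : ℕ) : ℤ))).sum +
        finrank ℂ ↥(supL (fun k : Fin 8 => (Van (Zk kind ρ) m (w - ((k : ℕ) : ℤ))).map (mulX k)) ks ⊔
          S.map (mulX 0)) := by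
  refine (gen_of_check hks h).mono fun ρ hρ S hS => ?_
  have h1 := le_of_rowSpanC hρ
  set G := supL (fun k : Fin 8 => (Van (Zk kind ρ) m (w - ((k : ℕ) : ℤ))).map (mulX k)) ks
  have hG : G ≤ Pol (m + 1) w := supL_le.mpr fun k _ => by
    rw [Submodule.map_le_iff_le_comap]
    exact fun f hf => Van_le_Pol _ _ _ (X_mul_mem_Van k hf)
  have hS' : S.map (mulX 0) ≤ Pol (m + 1) w := by
    rw [Submodule.map_le_iff_le_comap]
    intro f hf
    refine X_mul_mem_Pol 0 ?_
    simpa using hS hf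
  have : FiniteDimensional ℂ ↥(G ⊔ S.map (mulX 0)) :=
    Submodule.finiteDimensional_of_le (sup_le hG hS')
  have h2 := finrank_eq_map_add_ker (evQ n q) (G ⊔ S.map (mulX 0))
  have h3 : finrank ℂ (G.map (evQ n q)) ≤ finrank ℂ ((G ⊔ S.map (mulX 0)).map (evQ n q)) :=
    Submodule.finrank_mono (Submodule.map_mono le_sup_left)
  have h4 : finrank ℂ (S.map (mulX 0)) ≤ finrank ℂ ↥((G ⊔ S.map (mulX 0)) ⊓ (evQ n q).ker) := by
    refine Submodule.finrank_mono (le_inf le_sup_right ?_)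
    rw [Submodule.map_le_iff_le_comap]
    exact fun f _ => evQ_mulX_zero n q f
  rw [finrank_map_mulX] at h4
  omega

theorem gen_Dec {n q m w target : ℕ} {ks : List (Fin 8)} (hks : ks.Nodup)
    (h : check 0 n q m w target ks = true) :
    Gen fun ρ => target + finrank ℂ (Van (Z0 ρ) m w) ≤
      (ks.map fun k : Fin 8 => cod (Z0 ρ) m (w - ((k : ℕ) : ℤ))).sum +
        finrank ℂ (Dec (Z0 ρ) (m + 1) w) := by
  refine (gen_block hks h).mono fun ρ hρ => ?_
  refine (hρ _ (Van_le_Pol (Z0 ρ) m w)).trans (Nat.add_le_add_left ?_ _)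
  have : FiniteDimensional ℂ (Dec (Z0 ρ) (m + 1) w) :=
    Submodule.finiteDimensional_of_le ((Dec_le_Van _ _ _).trans (Van_le_Pol _ _ _))
  refine Submodule.finrank_mono (sup_le (supL_le.mpr fun k _ => ?_) ?_)
  · rw [Submodule.map_le_iff_le_comap]
    exact fun f hf => X_mul_mem_Dec k hf
  · rw [Submodule.map_le_iff_le_comap]
    intro f hf
    refine X_mul_mem_Dec 0 ?_
    simpa using hf

instance (Z : Set (Fin 8 → ℂ)) (m : ℕ) (w : ℤ) : FiniteDimensional ℂ (Van Z m w) :=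
  Submodule.finiteDimensional_of_le (Van_le_Pol Z m w)

instance (Z : Set (Fin 8 → ℂ)) (m : ℕ) (w : ℤ) : FiniteDimensional ℂ (Dec Z m w) :=
  Submodule.finiteDimensional_of_le (Dec_le_Van Z m w)

theorem finrank_mul_le {A : Type*} [CommRing A] [Algebra ℂ A] (S T : Submodule ℂ A)
    [FiniteDimensional ℂ S] [FiniteDimensional ℂ T] :
    finrank ℂ ↥(S * T) ≤ finrank ℂ S * finrank ℂ T := by
  rw [← Submodule.mulMap_range]
  exact (LinearMap.finrank_range_le _).trans (finrank_tensorProduct ..).le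

theorem finrank_finsetSup_le {ι V : Type*} [AddCommGroup V] [Module ℂ V] (s : Finset ι)
    (F : ι → Submodule ℂ V) [∀ i, FiniteDimensional ℂ (F i)] :
    finrank ℂ ↥(s.sup F) ≤ ∑ i ∈ s, finrank ℂ (F i) := by
  classical
  induction s using Finset.induction_on with
  | empty => simp
  | insert a s ha ih =>
    rw [Finset.sup_insert, Finset.sum_insert ha]
    exact (finrank_sup_le _ _).trans (Nat.add_le_add_left ih _)

/-- The number of generators in a given degree and weight. -/
noncomputable def gap (Z : Set (Fin 8 → ℂ)) (m : ℕ) (w : ℤ) : ℕ :=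
  finrank ℂ (Van Z m w) - finrank ℂ (Dec Z m w)

theorem gap_add (Z : Set (Fin 8 → ℂ)) (m : ℕ) (w : ℤ) :
    gap Z m w + finrank ℂ (Dec Z m w) = finrank ℂ (Van Z m w) :=
  Nat.sub_add_cancel (Submodule.finrank_mono (Dec_le_Van Z m w))

theorem exists_gap (Z : Set (Fin 8 → ℂ)) (m : ℕ) (w : ℤ) :
    ∃ G : Submodule ℂ (MvPolynomial (Fin 8) ℂ), Dec Z m w ⊔ G = Van Z m w ∧
      finrank ℂ G = gap Z m w := by
  obtain ⟨C, hd, hc⟩ := exists_isCompl (⟨Dec Z m w, Dec_le_Van Z m w⟩ : Set.Iic (Van Z m w))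
  have h1 : Dec Z m w ⊔ C.1 = Van Z m w := congrArg Subtype.val hc.eq_top
  have h2 : Dec Z m w ⊓ C.1 = ⊥ := congrArg Subtype.val hd.eq_bot
  have : FiniteDimensional ℂ C.1 := Submodule.finiteDimensional_of_le C.2
  have h3 := Submodule.finrank_sup_add_finrank_inf_eq (Dec Z m w) C.1
  rw [h1, h2, finrank_bot] at h3
  refine ⟨C.1, h1, ?_⟩
  rw [gap]
  omega

theorem Van_eq_bot {Z : Set (Fin 8 → ℂ)} {m : ℕ} {w : ℤ} (h : w < 0 ∨ 7 * m < w) :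
    Van Z m w = ⊥ := by
  rw [eq_bot_iff, ← Pol_eq_bot h]
  exact Van_le_Pol Z m w

theorem Van_le_sup {Z : Set (Fin 8 → ℂ)} (G : ℕ → ℤ → Submodule ℂ (MvPolynomial (Fin 8) ℂ))
    (hG : ∀ m w, Dec Z m w ⊔ G m w = Van Z m w) (N m w : ℕ) (hw : w ≤ N) :
    (Van Z m w ≤ (Finset.range (m + 1) ×ˢ Finset.range (N + 1)).sup fun x =>
        Pol (m - x.1) ((w : ℤ) - (x.2 : ℤ)) * G x.1 x.2) ∧
    (Dec Z m w ≤ (Finset.range m ×ˢ Finset.range (N + 1)).sup fun x =>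
        Pol (m - x.1) ((w : ℤ) - (x.2 : ℤ)) * G x.1 x.2) := by
  induction m generalizing w with
  | zero =>
    have h0 : Dec Z 0 w = ⊥ := rfl
    refine ⟨?_, by rw [h0]; exact bot_le⟩
    rw [← hG, h0, bot_sup_eq]
    refine le_trans ?_ (Finset.le_sup (b := (0, w)) (Finset.mem_product.mpr
      ⟨Finset.mem_range.mpr (by omega), Finset.mem_range.mpr (by omega)⟩))
    intro f hf
    rw [← one_mul f]
    refine Submodule.mul_mem_mul ?_ hf
    simpa using monomial_mem_Pol (m := 0) (w := 0) (d := 0) (by simp [mem_monSet]) 1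
  | succ m ih =>
    have hD : Dec Z (m + 1) w ≤ (Finset.range (m + 1) ×ˢ Finset.range (N + 1)).sup fun x =>
        Pol (m + 1 - x.1) ((w : ℤ) - (x.2 : ℤ)) * G x.1 x.2 := by
      intro f hf
      obtain ⟨g, hg, rfl⟩ := mem_Dec_succ.mp hf
      refine sum_mem fun k _ => ?_
      have hgk := hg k
      by_cases hk : (k : ℕ) ≤ w
      · have e : ((w : ℤ) - ((k : ℕ) : ℤ)) = ((w - k : ℕ) : ℤ) := by omega
        rw [e] at hgk
        have h1 := (ih (w - k) (by omega)).1 hgk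
        have h2 : (Finset.range (m + 1) ×ˢ Finset.range (N + 1)).sup (fun x =>
            Pol (m - x.1) (((w - k : ℕ) : ℤ) - (x.2 : ℤ)) * G x.1 x.2) ≤
            ((Finset.range (m + 1) ×ˢ Finset.range (N + 1)).sup fun x =>
              Pol (m + 1 - x.1) ((w : ℤ) - (x.2 : ℤ)) * G x.1 x.2).comap (mulX k) := by
          refine Finset.sup_le fun x hx => ?_
          rw [← Submodule.map_le_iff_le_comap]
          refine le_trans ?_ (Finset.le_sup hx)
          rw [Submodule.map_le_iff_le_comap]
          refine Submodule.mul_le.mpr fun a ha b hb => ?_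
          rw [Submodule.mem_comap, mulX_apply, ← mul_assoc]
          refine Submodule.mul_mem_mul ?_ hb
          have hx1 : x.1 < m + 1 := by simp at hx; omega
          have := X_mul_mem_Pol (m := m - x.1) (w := (w : ℤ) - (x.2 : ℤ)) k (f := a) (by
            convert ha using 2
            omega)
          convert this using 2
          omega
        exact h2 h1
      · have : g k = 0 := by
          rw [Van_eq_bot (Or.inl (by omega))] at hgk
          exact hgk
        rw [this, mul_zero]
        exact zero_mem _
    refine ⟨?_, hD⟩
    rw [← hG]
    refine sup_le (hD.trans (Finset.sup_mono ?_)) ?_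
    · exact Finset.product_subset_product_left (Finset.range_subset_range.mpr (by omega))
    · refine le_trans ?_ (Finset.le_sup (b := (m + 1, w)) (Finset.mem_product.mpr
        ⟨Finset.mem_range.mpr (by omega), Finset.mem_range.mpr (by omega)⟩))
      intro f hf
      rw [← one_mul f]
      refine Submodule.mul_mem_mul ?_ hf
      simpa using monomial_mem_Pol (m := 0) (w := 0) (d := 0) (by simp [mem_monSet]) 1

theorem finrank_Dec_le (Z : Set (Fin 8 → ℂ)) (m w : ℕ) :
    finrank ℂ (Dec Z m w) ≤ ∑ x ∈ Finset.range m ×ˢ Finset.range (w + 1),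
      finrank ℂ (Pol (m - x.1) ((w : ℤ) - (x.2 : ℤ))) * gap Z x.1 x.2 := by
  choose G hG hG' using exists_gap Z
  have hfin : ∀ m w, FiniteDimensional ℂ (G m w) := fun m w =>
    Submodule.finiteDimensional_of_le (le_sup_right.trans (hG m w).le)
  have : ∀ x : ℕ × ℕ, FiniteDimensional ℂ
      ↥(Pol (m - x.1) ((w : ℤ) - (x.2 : ℤ)) * G x.1 x.2) := fun x => by
    rw [← Submodule.mulMap_range]
    infer_instance
  have hfin' : FiniteDimensional ℂ ↥((Finset.range m ×ˢ Finset.range (w + 1)).sup fun x =>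
      Pol (m - x.1) ((w : ℤ) - (x.2 : ℤ)) * G x.1 x.2) := by
    infer_instance
  refine ((Submodule.finrank_mono (Van_le_sup G hG w m w le_rfl).2).trans
    (finrank_finsetSup_le _ _)).trans (Finset.sum_le_sum fun x _ => ?_)
  rw [← hG']
  exact finrank_mul_le _ _

/-- The lowering operator on the tensor product with the space of linear forms. -/
noncomputable def lowerT : (Fin 8 → MvPolynomial (Fin 8) ℂ) →ₗ[ℂ] Fin 8 → MvPolynomial (Fin 8) ℂ :=
  LinearMap.pi fun k => (lowerD : MvPolynomial (Fin 8) ℂ →ₗ[ℂ] _) ∘ₗ LinearMap.proj k +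
    (((k + 1 : Fin 8) : ℕ) : ℂ) • LinearMap.proj (k + 1)

/-- The raising operator on the tensor product with the space of linear forms. -/
noncomputable def raiseT : (Fin 8 → MvPolynomial (Fin 8) ℂ) →ₗ[ℂ] Fin 8 → MvPolynomial (Fin 8) ℂ :=
  LinearMap.pi fun k => (raiseD : MvPolynomial (Fin 8) ℂ →ₗ[ℂ] _) ∘ₗ LinearMap.proj k +
    ((7 - ((k - 1 : Fin 8) : ℕ) : ℕ) : ℂ) • LinearMap.proj (k - 1)

theorem lowerT_apply (g : Fin 8 → MvPolynomial (Fin 8) ℂ) (k : Fin 8) :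
    lowerT g k = lowerD (g k) + (((k + 1 : Fin 8) : ℕ) : ℂ) • g (k + 1) := rfl

theorem raiseT_apply (g : Fin 8 → MvPolynomial (Fin 8) ℂ) (k : Fin 8) :
    raiseT g k = raiseD (g k) + ((7 - ((k - 1 : Fin 8) : ℕ) : ℕ) : ℂ) • g (k - 1) := rfl

theorem mulSum_lowerT (g : Fin 8 → MvPolynomial (Fin 8) ℂ) : mulSum (lowerT g) = lowerD (mulSum g) := by
  rw [mulSum_apply, mulSum_apply, map_sum]
  simp only [lowerT_apply, mul_add, Finset.sum_add_distrib, Derivation.leibniz, lowerD_X,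
    smul_eq_mul]
  congr 1
  rw [← Equiv.sum_comp (Equiv.subRight (1 : Fin 8))]
  refine Finset.sum_congr rfl fun k _ => ?_
  rw [Equiv.subRight_apply, sub_add_cancel, smul_eq_C_mul]
  ring

theorem mulSum_raiseT (g : Fin 8 → MvPolynomial (Fin 8) ℂ) : mulSum (raiseT g) = raiseD (mulSum g) := by
  rw [mulSum_apply, mulSum_apply, map_sum]
  simp only [raiseT_apply, mul_add, Finset.sum_add_distrib, Derivation.leibniz, raiseD_X,
    smul_eq_mul]
  congr 1
  rw [← Equiv.sum_comp (Equiv.addRight (1 : Fin 8))]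
  refine Finset.sum_congr rfl fun k _ => ?_
  rw [Equiv.coe_addRight, add_sub_cancel_right, smul_eq_C_mul]
  ring

/-- The kernel of multiplication by linear forms. -/
noncomputable def tens (ρ : Fin 7 → ℂ) (m : ℕ) (w : ℤ) :
    Submodule ℂ (Fin 8 → MvPolynomial (Fin 8) ℂ) :=
  Submodule.pi Set.univ fun k => Van (Z0 ρ) m (w - ((k : ℕ) : ℤ))

theorem mem_tens {ρ : Fin 7 → ℂ} {m : ℕ} {w : ℤ} {g : Fin 8 → MvPolynomial (Fin 8) ℂ} :
    g ∈ tens ρ m w ↔ ∀ k : Fin 8, g k ∈ Van (Z0 ρ) m (w - ((k : ℕ) : ℤ)) := by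
  simp [tens, Submodule.mem_pi]

/-- The components of an element of `tens`. -/
noncomputable def tensEquiv (ρ : Fin 7 → ℂ) (m : ℕ) (w : ℤ) :
    tens ρ m w ≃ₗ[ℂ] ∀ k : Fin 8, Van (Z0 ρ) m (w - ((k : ℕ) : ℤ)) where
  toFun g k := ⟨g.1 k, mem_tens.mp g.2 k⟩
  invFun g := ⟨fun k => (g k).1, mem_tens.mpr fun k => (g k).2⟩
  map_add' _ _ := rfl
  map_smul' _ _ := rfl
  left_inv _ := rfl
  right_inv _ := rfl

instance (ρ : Fin 7 → ℂ) (m : ℕ) (w : ℤ) : FiniteDimensional ℂ (tens ρ m w) :=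
  FiniteDimensional.of_injective (tensEquiv ρ m w).toLinearMap (tensEquiv ρ m w).injective

theorem finrank_tens (ρ : Fin 7 → ℂ) (m : ℕ) (w : ℤ) :
    finrank ℂ (tens ρ m w) = ∑ k : Fin 8, finrank ℂ (Van (Z0 ρ) m (w - ((k : ℕ) : ℤ))) := by
  rw [(tensEquiv ρ m w).finrank_eq, finrank_pi_fintype]

theorem isSl2_ker (ρ : Fin 7 → ℂ) (m : ℕ) :
    IsSl2 lowerT raiseT (7 * ((m + 1 : ℕ) : ℤ)) fun w => tens ρ m w ⊓ mulSum.ker where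
  lower w g hg := by
    obtain ⟨hg, hg'⟩ := Submodule.mem_inf.mp hg
    refine Submodule.mem_inf.mpr ⟨mem_tens.mpr fun k => ?_, ?_⟩
    · rw [lowerT_apply]
      refine add_mem ?_ ?_
      · rw [sub_right_comm]
        exact (isSl2_Van ρ m).lower _ _ (mem_tens.mp hg k)
      · by_cases hk : k = 7
        · subst hk; simp
        · refine Submodule.smul_mem _ _ ?_
          have e : ∀ k : Fin 8, k ≠ 7 → (((k + 1 : Fin 8) : ℕ) : ℤ) = ((k : ℕ) : ℤ) + 1 := by decide
          have := mem_tens.mp hg (k + 1)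
          rw [e k hk] at this
          rwa [sub_sub, add_comm 1]
    · rw [LinearMap.mem_ker] at hg' ⊢
      rw [mulSum_lowerT, hg', map_zero]
  raise w g hg := by
    obtain ⟨hg, hg'⟩ := Submodule.mem_inf.mp hg
    refine Submodule.mem_inf.mpr ⟨mem_tens.mpr fun k => ?_, ?_⟩
    · rw [raiseT_apply]
      refine add_mem ?_ ?_
      · rw [← sub_add_eq_add_sub]
        exact (isSl2_Van ρ m).raise _ _ (mem_tens.mp hg k)
      · by_cases hk : k = 0
        · subst hk; simp
        · refine Submodule.smul_mem _ _ ?_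
          have e : ∀ k : Fin 8, k ≠ 0 → (((k - 1 : Fin 8) : ℕ) : ℤ) = ((k : ℕ) : ℤ) - 1 := by decide
          have := mem_tens.mp hg (k - 1)
          rw [e k hk] at this
          rwa [show w + 1 - ((k : ℕ) : ℤ) = w - (((k : ℕ) : ℤ) - 1) by ring]
    · rw [LinearMap.mem_ker] at hg' ⊢
      rw [mulSum_raiseT, hg', map_zero]
  comm w g hg := by
    obtain ⟨hg, -⟩ := Submodule.mem_inf.mp hg
    refine funext fun k => ?_
    have h := (isSl2_Van ρ m).comm _ _ (mem_tens.mp hg k)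
    have e : ∀ k : Fin 8, (((k + 1 : Fin 8) : ℕ) : ℤ) * ((7 - (k : ℕ) : ℕ) : ℤ) =
        ((7 - ((k - 1 : Fin 8) : ℕ) : ℕ) : ℤ) * ((k : ℕ) : ℤ) + 7 - 2 * ((k : ℕ) : ℤ) := by decide
    have e' := congrArg (Int.cast (R := ℂ)) (e k)
    simp only [Derivation.coeFn_coe, Pi.add_apply, Pi.smul_apply, lowerT_apply, raiseT_apply,
      map_add, Derivation.map_smul, add_sub_cancel_right, sub_add_cancel] at h ⊢
    rw [h]
    push_cast at e' ⊢
    simp only [smul_eq_C_mul, map_add, map_sub, map_mul, map_one] at e' ⊢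
    have e2 := congrArg (C (σ := Fin 8)) e'
    simp only [map_add, map_sub, map_mul] at e2
    linear_combination (g k) * e2
  bot_of_neg w hw := by
    rw [eq_bot_iff]
    intro g hg
    refine funext fun k => ?_
    have := mem_tens.mp (Submodule.mem_inf.mp hg).1 k
    rw [Van_eq_bot (Or.inl (by omega))] at this
    exact this
  bot_of_lt w hw := by
    rw [eq_bot_iff]
    intro g hg
    refine funext fun k => ?_
    have := mem_tens.mp (Submodule.mem_inf.mp hg).1 k
    rw [Van_eq_bot (Or.inr (by have := k.2; push_cast at hw; omega))] at this
    exact this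

theorem finrank_Dec_succ_le (ρ : Fin 7 → ℂ) (m : ℕ) {w : ℤ} (hw : 2 * w < 7 * ((m + 1 : ℕ) : ℤ)) :
    finrank ℂ (Dec (Z0 ρ) (m + 1) (w + 1)) + finrank ℂ (Van (Z0 ρ) m (w - 7)) ≤
      finrank ℂ (Dec (Z0 ρ) (m + 1) w) + finrank ℂ (Van (Z0 ρ) m (w + 1)) := by
  have : ∀ w, FiniteDimensional ℂ ↥(tens ρ m w ⊓ mulSum.ker) := fun w =>
    Submodule.finiteDimensional_of_le inf_le_left
  have h1 := (isSl2_ker ρ m).finrank_mono hw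
  have h2 : ∀ w, finrank ℂ (tens ρ m w) = finrank ℂ (Dec (Z0 ρ) (m + 1) w) +
    finrank ℂ ↥(tens ρ m w ⊓ mulSum.ker) := fun w => finrank_eq_map_add_ker mulSum (tens ρ m w)
  have h3 := h2 w
  have h4 := h2 (w + 1)
  rw [finrank_tens, Fin.sum_univ_castSucc] at h3
  rw [finrank_tens, Fin.sum_univ_succ] at h4
  have h5 : ∀ k : Fin 7, w + 1 - (((k.succ : Fin 8) : ℕ) : ℤ) =
      w - (((k.castSucc : Fin 8) : ℕ) : ℤ) := fun k => by
    rw [Fin.val_succ, Fin.val_castSucc]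
    push_cast
    ring
  rw [Finset.sum_congr rfl fun k _ => congrArg (fun u => finrank ℂ (Van (Z0 ρ) m u)) (h5 k)] at h4
  rw [show w + 1 - (((0 : Fin 8) : ℕ) : ℤ) = w + 1 by simp] at h4
  simp only [Fin.val_last, Nat.cast_ofNat] at h3
  omega

/-- The numbers of monomials of given degree and weight, up to the central weight. -/
def monTable : List (List ℕ) :=
  [[1],
  [1, 1, 1, 1],
  [1, 1, 2, 2, 3, 3, 4, 4],
  [1, 1, 2, 3, 4, 5, 7, 8, 9, 10, 10],
  [1, 1, 2, 3, 5, 6, 9, 11, 14, 16, 19, 20, 23, 23, 24],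
  [1, 1, 2, 3, 5, 7, 10, 13, 17, 21, 26, 30, 35, 39, 43, 46, 48, 49],
  [1, 1, 2, 3, 5, 7, 11, 14, 19, 24, 31, 37, 46, 52, 61, 68, 76, 81, 88, 90, 94, 94],
  [1, 1, 2, 3, 5, 7, 11, 15, 20, 26, 34, 42, 53, 63, 75, 87, 100, 112, 125, 136, 146, 155, 162,
    166, 169],
  [1, 1, 2, 3, 5, 7, 11, 15, 21, 27, 36, 45, 58, 70, 86, 101, 120, 137, 158, 176, 197, 214, 233,
    247, 263, 272, 282, 285, 289],
  [1, 1, 2, 3, 5, 7, 11, 15, 21, 28, 37, 47, 61, 75, 93, 112, 134, 157, 184, 210, 239, 268, 297,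
    325, 354, 379, 403, 424, 441, 454, 464, 468],
  [1, 1, 2, 3, 5, 7, 11, 15, 21, 28, 38, 48, 63, 78, 98, 119, 145, 171, 204, 236, 274, 311, 353,
    392, 437, 477, 520, 558, 598, 629, 663, 686, 709, 722, 734, 734],
  [1, 1, 2, 3, 5, 7, 11, 15, 21, 28, 38, 49, 64, 80, 101, 124, 152, 182, 218, 256, 300, 346, 397,
    449, 506, 563, 623, 682, 742, 799, 856, 908, 957, 1000, 1038, 1069, 1093, 1109, 1117],
  [1, 1, 2, 3, 5, 7, 11, 15, 21, 28, 38, 49, 65, 81, 103, 127, 157, 189, 229, 270, 320, 372, 432,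
    493, 564, 633, 711, 788, 871, 950, 1036, 1114, 1197, 1271, 1346, 1410, 1475, 1524, 1572, 1605,
    1634, 1646, 1656]]

/-- The number of monomials of degree `m ≤ 12` and weight `w`. -/
def pv (m w : ℕ) : ℕ := if 7 * m < w then 0 else (monTable.getD m []).getD (min w (7 * m - w)) 0

set_option maxRecDepth 100000 in
theorem countTable_eq :
    countTable 12 8 = (List.range 13).map fun m => (List.range (7 * m + 1)).map (pv m) := by
  decide +kernel

theorem finrank_Pol_eq_pv {m : ℕ} (hm : m ≤ 12) (w : ℕ) : finrank ℂ (Pol m (w : ℤ)) = pv m w := by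
  rw [finrank_Pol m w 12 hm, countTable_eq]
  have h1 : m < ((List.range 13).map fun m => (List.range (7 * m + 1)).map (pv m)).length := by
    simp; omega
  rw [List.getD_eq_getElem _ _ h1, List.getElem_map, List.getElem_range]
  rcases le_or_gt w (7 * m) with h | h
  · have h2 : w < ((List.range (7 * m + 1)).map (pv m)).length := by simp; omega
    rw [List.getD_eq_getElem _ _ h2, List.getElem_map, List.getElem_range]
  · rw [List.getD_eq_default _ _ (by simp; omega), pv, if_pos h]

/-- The dimensions of the pieces of the ideal, from weight `18` to the central weight, in the
degrees from `6` to `12`. -/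
def idealTable : List (List ℕ) :=
  [[1, 1, 2, 2],
  [1, 2, 4, 6, 8, 9, 10],
  [1, 2, 6, 9, 15, 19, 26, 29, 34, 35, 38],
  [1, 2, 7, 14, 23, 33, 46, 57, 69, 80, 90, 97, 103, 105],
  [1, 2, 9, 17, 32, 46, 68, 87, 111, 132, 157, 175, 198, 212, 228, 236, 245, 245],
  [1, 2, 9, 19, 36, 56, 83, 112, 146, 181, 219, 256, 295, 331, 366, 397, 425, 448, 466, 478, 484],
  [1, 2, 9, 19, 38, 60, 94, 128, 173, 219, 273, 325, 386, 441, 503, 558, 616, 665, 717, 755, 794,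
    820, 844, 853, 862]]

/-- The dimension of the piece of the ideal of degree `m ≤ 12` and weight `w`. -/
def iTab (m w : ℕ) : ℕ :=
  if m < 6 ∨ min w (7 * m - w) < 18 then 0 else
    (idealTable.getD (m - 6) []).getD (min w (7 * m - w) - 18) 0

/-- The numbers of generators of degree `m` and weight `w`. -/
def gTab (m w : ℕ) : ℕ :=
  let u := min w (7 * m - w)
  match m with
  | 6 => if u < 18 then 0 else if u < 20 then 1 else 2
  | 8 => if u < 20 then 0 else if u < 22 then 1 else if u < 24 then 2 else if u < 28 then 3 else 4
  | 9 => if u < 20 then 0 else if u < 21 then 1 else if u < 22 then 3 else if u < 23 then 4 else 5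
  | 10 => if u < 20 then 0 else if u < 22 then 2 else 3
  | _ => 0

/-- The number of conditions imposed by `Z1` in degree `9` and weight `w + 9`. -/
def codTable1 : List ℕ :=
  [1, 1, 2, 3, 5, 7, 11, 14, 20, 26, 33, 40, 47, 54, 61, 68, 75, 82, 89, 96, 103, 110, 117, 124,
    131, 138, 145, 152, 159, 165, 171, 172, 173, 168, 162, 150, 138, 121, 107, 91, 78, 64, 54, 42,
    34, 26, 20, 14, 11, 7, 5, 3, 2, 1, 1]

/-- The number of conditions imposed by `Z2` in degree `9` and weight `w + 9`. -/
def codTable2 : List ℕ :=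
  [1, 1, 2, 3, 5, 7, 10, 13, 18, 23, 28, 33, 36, 40, 41, 42, 42, 42, 42, 42, 42, 42, 42]

def samples1 (w : ℕ) : ℕ :=
  codTable1.getD w 0 + if w < 34 then 6 else if w < 36 then 30 else 50

set_option maxRecDepth 100000 in
set_option maxHeartbeats 0 in
theorem cert_cod0 : ([(96, 6, 21, 92), (163, 7, 24, 159), (255, 8, 28, 251), (375, 9, 31, 363)].all
    fun x : ℕ × ℕ × ℕ × ℕ => check 0 x.1 0 x.2.1 x.2.2.1 x.2.2.2 [0]) = true := by
  decide +kernel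

set_option maxRecDepth 100000 in
set_option maxHeartbeats 0 in
theorem cert_cod1 : ((List.range 55).all
    fun w => check 1 (samples1 w) 0 9 (w + 9) (codTable1.getD w 0) [0]) = true := by
  decide +kernel

set_option maxRecDepth 100000 in
set_option maxHeartbeats 0 in
theorem cert_cod2 : ((List.range 23).all
    fun w => check 2 42 0 9 (w + 9) (codTable2.getD w 0) [0]) = true := by
  decide +kernel

set_option maxRecDepth 100000 in
set_option maxHeartbeats 0 in
theorem cert_Dec7 : ([(12, 24, 631), (4, 19, 472), (5, 20, 516), (7, 21, 558), (9, 22, 591),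
    (11, 23, 617)].all
    fun x : ℕ × ℕ × ℕ => check 0 96 x.1 6 x.2.1 x.2.2 [1, 2, 3, 4, 5, 6, 7]) = true := by
  decide +kernel

set_option maxRecDepth 100000 in
set_option maxHeartbeats 0 in
theorem cert_Dec8 : ([(5, 21, 776), (11, 23, 923), (19, 25, 1035), (25, 26, 1076), (27, 27, 1101),
    (31, 28, 1117)].all
    fun x : ℕ × ℕ × ℕ => check 0 163 x.1 7 x.2.1 x.2.2 [1, 2, 3, 4, 5, 6, 7]) = true := by
  decide +kernel

set_option maxRecDepth 100000 in
set_option maxHeartbeats 0 in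
theorem cert_Dec9_low : check 0 255 5 8 21 193 [1] = true := by decide +kernel

set_option maxRecDepth 100000 in
set_option maxHeartbeats 0 in
theorem cert_Dec9_mid : check 0 255 7 8 22 1089 [1, 2, 3, 4, 5, 6, 7] = true := by decide +kernel

set_option maxRecDepth 100000 in
set_option maxHeartbeats 0 in
theorem cert_Dec9 : check 0 255 74 8 31 1070 [1, 2, 3, 4] = true := by decide +kernel

set_option maxRecDepth 100000 in
set_option maxHeartbeats 0 in
theorem cert_Dec10_low : check 0 367 4 9 21 233 [1] = true := by decide +kernel

set_option maxRecDepth 100000 in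
set_option maxHeartbeats 0 in
theorem cert_Dec10 : check 0 371 155 9 35 1233 [1, 2, 3] = true := by decide +kernel

set_option maxRecDepth 100000 in
set_option maxHeartbeats 0 in
theorem cert_Z1_39 : check 1 163 275 10 39 866 [1, 2, 3, 4] = true := by decide +kernel

set_option maxRecDepth 100000 in
set_option maxHeartbeats 0 in
theorem cert_Z1_35 : check 1 135 207 10 35 686 [1, 2, 3, 4] = true := by decide +kernel

theorem Gen.of_forall {P : (Fin 7 → ℂ) → Prop} (h : ∀ ρ, P ρ) : Gen P :=
  gen_injective.mono fun ρ _ => h ρ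

theorem Gen.all {α : Type*} (l : List α) {P : α → (Fin 7 → ℂ) → Prop} (h : ∀ x ∈ l, Gen (P x)) :
    Gen fun ρ => ∀ x ∈ l, P x ρ := by
  induction l with
  | nil => exact Gen.of_forall fun ρ x hx => by simp at hx
  | cons a t ih =>
    refine ((h a List.mem_cons_self).and (ih fun x hx => h x (List.mem_cons_of_mem _ hx))).mono
      fun ρ hρ x hx => ?_
    rcases List.mem_cons.mp hx with rfl | hx
    · exact hρ.1
    · exact hρ.2 x hx

/-- The dimension of a piece of the ideal. -/
noncomputable def iv (ρ : Fin 7 → ℂ) (m w : ℕ) : ℕ := finrank ℂ (Van (Z0 ρ) m (w : ℤ))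

/-- The dimension of a piece of the decomposable part of the ideal. -/
noncomputable def jv (ρ : Fin 7 → ℂ) (m w : ℕ) : ℕ := finrank ℂ (Dec (Z0 ρ) m (w : ℤ))

/-- The number of generators. -/
noncomputable def gv (ρ : Fin 7 → ℂ) (m w : ℕ) : ℕ := gap (Z0 ρ) m (w : ℤ)

/-- The lower bounds used for the ranks of the multiplication maps. -/
def DecBound (ρ : Fin 7 → ℂ) (m w target : ℕ) (ks : List (Fin 8)) : Prop :=
  target + iv ρ m w ≤ (ks.map fun k : Fin 8 => cod (Z0 ρ) m (w - ((k : ℕ) : ℤ))).sum + jv ρ (m + 1) w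

/-- The lower bounds used for the ideal of the points with vanishing first coordinate. -/
def JointBound (ρ : Fin 7 → ℂ) (w target : ℕ) : Prop :=
  ∀ S : Submodule ℂ (MvPolynomial (Fin 8) ℂ), S ≤ Pol 10 w →
    target + finrank ℂ S ≤ (([1, 2, 3, 4] : List (Fin 8)).map fun k : Fin 8 =>
        cod (Z1 ρ) 10 (w - ((k : ℕ) : ℤ))).sum +
      finrank ℂ ↥(supL (fun k : Fin 8 => (Van (Z1 ρ) 10 (w - ((k : ℕ) : ℤ))).map (mulX k))
        ([1, 2, 3, 4] : List (Fin 8)) ⊔ S.map (mulX 0))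

/-- The generality conditions. -/
structure IsGood (ρ : Fin 7 → ℂ) : Prop where
  inj : Function.Injective ρ
  cod0 : ∀ x ∈ ([(96, 6, 21, 92), (163, 7, 24, 159), (255, 8, 28, 251), (375, 9, 31, 363)] :
    List (ℕ × ℕ × ℕ × ℕ)), x.2.2.2 ≤ cod (Z0 ρ) x.2.1 (x.2.2.1 : ℕ)
  cod1 : ∀ w ∈ List.range 55, codTable1.getD w 0 ≤ cod (Z1 ρ) 9 (w + 9 : ℕ)
  cod2 : ∀ w ∈ List.range 23, codTable2.getD w 0 ≤ cod (Z2 ρ) 9 (w + 9 : ℕ)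
  dec7 : ∀ x ∈ ([(12, 24, 631), (4, 19, 472), (5, 20, 516), (7, 21, 558), (9, 22, 591),
    (11, 23, 617)] : List (ℕ × ℕ × ℕ)), DecBound ρ 6 x.2.1 x.2.2 [1, 2, 3, 4, 5, 6, 7]
  dec8 : ∀ x ∈ ([(5, 21, 776), (11, 23, 923), (19, 25, 1035), (25, 26, 1076), (27, 27, 1101),
    (31, 28, 1117)] : List (ℕ × ℕ × ℕ)), DecBound ρ 7 x.2.1 x.2.2 [1, 2, 3, 4, 5, 6, 7]
  dec9_low : DecBound ρ 8 21 193 [1]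
  dec9_mid : DecBound ρ 8 22 1089 [1, 2, 3, 4, 5, 6, 7]
  dec9 : DecBound ρ 8 31 1070 [1, 2, 3, 4]
  dec10_low : DecBound ρ 9 21 233 [1]
  dec10 : DecBound ρ 9 35 1233 [1, 2, 3]
  joint39 : JointBound ρ 39 866
  joint35 : JointBound ρ 35 686

theorem gen_isGood : Gen IsGood := by
  have h0 := Gen.all _ fun x hx => gen_cod (List.all_eq_true.mp cert_cod0 x hx)
  have h1 := Gen.all _ fun x hx => gen_cod (List.all_eq_true.mp cert_cod1 x hx)
  have h2 := Gen.all _ fun x hx => gen_cod (List.all_eq_true.mp cert_cod2 x hx)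
  have h7 := Gen.all _ fun x hx => gen_Dec (by decide) (List.all_eq_true.mp cert_Dec7 x hx)
  have h8 := Gen.all _ fun x hx => gen_Dec (by decide) (List.all_eq_true.mp cert_Dec8 x hx)
  have a1 := gen_Dec (by decide) cert_Dec9_low
  have a2 := gen_Dec (by decide) cert_Dec9_mid
  have a3 := gen_Dec (by decide) cert_Dec9
  have a4 := gen_Dec (by decide) cert_Dec10_low
  have a5 := gen_Dec (by decide) cert_Dec10
  have a6 := gen_block (by decide) cert_Z1_39
  have a7 := gen_block (by decide) cert_Z1_35
  exact (((gen_injective.and h0).and (h1.and h2)).and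
    (((h7.and h8).and ((a1.and a2).and a3)).and ((a4.and a5).and (a6.and a7)))).mono
    fun ρ ⟨⟨⟨b0, b1⟩, b2, b3⟩, ⟨⟨b4, b5⟩, ⟨b6, b7⟩, b8⟩, ⟨b9, b10⟩, b11, b12⟩ =>
      ⟨b0, b1, b2, b3, b4, b5, b6, b7, b8, b9, b10, b11, b12⟩

section Basic
variable (ρ : Fin 7 → ℂ)

theorem gv_add (m w : ℕ) : gv ρ m w + jv ρ m w = iv ρ m w := gap_add _ _ _

theorem pig_nat (m w k : ℕ) (hm : m ≤ 12) (hk : 7 * m = 2 * (w + 1) + k) :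
    pv m (w + 1) + iv ρ m w ≤ pv m w + iv ρ m (w + 1) + (k + 1) := by
  have := pig ρ m k (w := w) (by omega)
  rw [finrank_Pol_eq_pv hm] at this
  have e := finrank_Pol_eq_pv hm (w + 1)
  push_cast at e
  rw [e] at this
  simpa [iv] using this

theorem iv_mono {m w : ℕ} (hw : 2 * w < 7 * m) : iv ρ m w ≤ iv ρ m (w + 1) := by
  have := (isSl2_Van ρ m).finrank_mono (w := w) (by omega)
  simpa [iv] using this

theorem jv_mono {m w : ℕ} (hw : 2 * w < 7 * m) : jv ρ m w ≤ jv ρ m (w + 1) := by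
  have := (isSl2_Dec ρ m).finrank_mono (w := w) (by omega)
  simpa [jv] using this

theorem gv_mono {m w : ℕ} (hw : 2 * w < 7 * m) : gv ρ m w ≤ gv ρ m (w + 1) := by
  have := gap_mono ρ m (w := w) (by omega)
  have h1 := gv_add ρ m w
  have h2 := gv_add ρ m (w + 1)
  rw [iv, jv, Nat.cast_add, Nat.cast_one] at h2
  rw [iv, jv] at h1
  omega

theorem iv_rev {m w : ℕ} (hw : w ≤ 7 * m) : iv ρ m (7 * m - w) = iv ρ m w := by
  have := finrank_Van_rev (isRevStable_Z0 ρ) m w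
  rw [iv, iv, ← this, Nat.cast_sub hw, Nat.cast_mul, Nat.cast_ofNat]

theorem jv_rev {m w : ℕ} (hw : w ≤ 7 * m) : jv ρ m (7 * m - w) = jv ρ m w := by
  have := finrank_Dec_rev (isRevStable_Z0 ρ) m w
  rw [jv, jv, ← this, Nat.cast_sub hw, Nat.cast_mul, Nat.cast_ofNat]

theorem gv_rev {m w : ℕ} (hw : w ≤ 7 * m) : gv ρ m (7 * m - w) = gv ρ m w := by
  have h1 := gv_add ρ m w
  have h2 := gv_add ρ m (7 * m - w)
  rw [iv_rev ρ hw, jv_rev ρ hw] at h2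
  omega

theorem iv_eq_zero {m w : ℕ} (hw : 7 * m < w) : iv ρ m w = 0 := by
  rw [iv, Van_eq_bot (Or.inr (by omega)), finrank_bot]

theorem gv_eq_zero {m w : ℕ} (hw : 7 * m < w) : gv ρ m w = 0 := by
  have h1 := gv_add ρ m w
  rw [iv_eq_zero ρ hw] at h1
  omega

theorem iv_le_jv (m w : ℕ) : iv ρ m w ≤ jv ρ (m + 1) w := by
  have h : (Van (Z0 ρ) m w).map (mulX 0) ≤ Dec (Z0 ρ) (m + 1) w := by
    rintro _ ⟨f, hf, rfl⟩
    exact X_mul_mem_Dec 0 (by simpa using hf)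
  have := Submodule.finrank_mono h
  rwa [finrank_map_mulX] at this

theorem iv_le_succ (m w : ℕ) : iv ρ m w ≤ iv ρ (m + 1) w :=
  (iv_le_jv ρ m w).trans (by have := gv_add ρ (m + 1) w; omega)

theorem cod_iv {m : ℕ} (hm : m ≤ 12) (w : ℕ) : cod (Z0 ρ) m (w : ℤ) + iv ρ m w = pv m w := by
  rw [← finrank_Pol_eq_pv hm]
  exact cod_add _ _ _

theorem jv_step {m w : ℕ} (hw : 2 * w < 7 * (m + 1)) (h7 : 7 ≤ w) :
    jv ρ (m + 1) (w + 1) + iv ρ m (w - 7) ≤ jv ρ (m + 1) w + iv ρ m (w + 1) := by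
  have := finrank_Dec_succ_le ρ m (w := w) (by push_cast; omega)
  rw [iv, iv, jv, jv, Nat.cast_sub h7, Nat.cast_add, Nat.cast_one, Nat.cast_ofNat]
  exact this

theorem jv_le_count (m w : ℕ) (hm : m ≤ 12) (G : ℕ → ℕ → ℕ)
    (hG : ∀ n < m, ∀ u ≤ w, gv ρ n u ≤ G n u) :
    jv ρ m w ≤ ((List.range m).map fun n => ((List.range (w + 1)).map fun u =>
      pv (m - n) (w - u) * G n u).sum).sum := by
  refine (finrank_Dec_le (Z0 ρ) m w).trans ?_
  rw [Finset.sum_product]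
  have key : ∀ (N : ℕ) (f : ℕ → ℕ), ∑ x ∈ Finset.range N, f x = ((List.range N).map f).sum := by
    intro N f
    induction N with
    | zero => rfl
    | succ N ih => simp [Finset.sum_range_succ, List.range_succ, ih]
  rw [← key]
  refine Finset.sum_le_sum fun n hn => ?_
  rw [← key]
  refine Finset.sum_le_sum fun u hu => ?_
  rw [Finset.mem_range] at hn hu
  have e := finrank_Pol_eq_pv (m := m - n) (by omega) (w - u)
  rw [Nat.cast_sub (by omega)] at e
  rw [e]
  exact Nat.mul_le_mul_left _ (hG n hn u (by omega))

end Basic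

section Good

theorem finrank_Pol_le_of_mem_Van {Z : Set (Fin 8 → ℂ)} {m n : ℕ} {u w : ℤ}
    {v : MvPolynomial (Fin 8) ℂ} (hv : v ∈ Van Z m u) (h0 : v ≠ 0) :
    finrank ℂ (Pol n w) ≤ finrank ℂ (Van Z (m + n) (u + w)) := by
  have h : (Pol n w).map (LinearMap.mulLeft ℂ v) ≤ Van Z (m + n) (u + w) := by
    rintro _ ⟨f, hf, rfl⟩
    refine ⟨fun z hz => ?_, mul_mem_Pol hv.2 hf⟩
    rw [LinearMap.mulLeft_apply, map_mul, hv.1 z hz, zero_mul]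
  have e := (Submodule.equivMapOfInjective (LinearMap.mulLeft ℂ v)
    (fun _ _ h => mul_left_cancel₀ h0 h) (Pol n w)).finrank_eq
  have := Submodule.finrank_mono h
  omega

theorem exists_mem_Pol_lowerD_eq_zero {m : ℕ} {w : ℤ}
    (h : finrank ℂ (Pol m (w - 1)) < finrank ℂ (Pol m w)) :
    ∃ v ∈ Pol m w, lowerD v = 0 ∧ v ≠ 0 := by
  by_contra! hc
  have h1 := finrank_eq_map_add_ker lowerL (Pol m w)
  have h2 : Pol m w ⊓ LinearMap.ker lowerL = ⊥ := by
    rw [eq_bot_iff]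
    rintro v ⟨hv, hv'⟩
    exact hc v hv hv'
  have h3 : (Pol m w).map lowerL ≤ Pol m (w - 1) := by
    rintro _ ⟨f, hf, rfl⟩
    exact (isSl2_Pol m).lower w f hf
  rw [h2, finrank_bot] at h1
  have := Submodule.finrank_mono h3
  omega

theorem finrank_Pol_of_eq {m : ℕ} (hm : m ≤ 12) {z : ℤ} (w : ℕ) (h : z = w) :
    finrank ℂ (Pol m z) = pv m w := by
  rw [h, finrank_Pol_eq_pv hm]

theorem finrank_Van_of_eq (ρ : Fin 7 → ℂ) {m : ℕ} {z : ℤ} (w : ℕ) (h : z = w) :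
    finrank ℂ (Van (Z0 ρ) m z) = iv ρ m w := by
  rw [h, iv]

/-- The slack in the estimates for the increments of the dimensions. -/
def slack (m w : ℕ) : ℕ :=
  7 * m - 2 * (w + 1) + 1 - if (m = 6 ∧ w = 17) ∨ (m = 9 ∧ w = 27) then 1 else 0

variable {ρ : Fin 7 → ℂ}

theorem iv_six_center (h : IsGood ρ) : iv ρ 6 21 ≤ 2 := by
  have h1 := h.cod0 (96, 6, 21, 92) (by simp)
  have h2 := cod_iv ρ (m := 6) (by norm_num) 21
  have : pv 6 21 = 94 := by decide +kernel
  simp only at h1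
  omega

theorem iv_four (h : IsGood ρ) : iv ρ 4 14 = 0 := by
  by_contra hne
  have h1 : Van (Z0 ρ) 4 (14 : ℕ) ≠ ⊥ := fun hb => hne (by rw [iv, hb, finrank_bot])
  obtain ⟨v, hv, hv0⟩ := Submodule.exists_mem_ne_zero_of_ne_bot h1
  have h2 := finrank_Pol_le_of_mem_Van (n := 2) (w := (7 : ℕ)) hv hv0
  rw [finrank_Pol_eq_pv (by norm_num), finrank_Van_of_eq ρ 21 (by norm_num)] at h2
  have h3 := iv_six_center h
  have : pv 2 7 = 4 := by decide +kernel
  have h4 : pv 2 7 ≤ iv ρ 6 21 := h2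
  omega

theorem lowerD_injective_ten (F : MvPolynomial (Fin 8) ℂ) (hF : F ∈ Pol 10 35)
    (h0 : lowerD F = 0) : F = 0 := by
  have e3 : pv 10 35 = pv 10 34 := by decide +kernel
  refine lowerD_injective_of_finrank_eq (m := 10) (w := 34) (by norm_num) ?_ F
    (by norm_num; exact hF) h0
  rw [finrank_Pol_of_eq (by norm_num) 35 (by norm_num),
    finrank_Pol_of_eq (by norm_num) 34 (by norm_num), e3]

theorem pig_slack (h : IsGood ρ) {m w : ℕ} (hm : m ≤ 12) (hw : 2 * (w + 1) ≤ 7 * m) :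
    pv m (w + 1) + iv ρ m w ≤ pv m w + iv ρ m (w + 1) + slack m w := by
  rw [slack]
  split_ifs with hc
  · rcases hc with ⟨rfl, rfl⟩ | ⟨rfl, rfl⟩
    · have a3 : pv 4 10 < pv 4 11 := by decide +kernel
      obtain ⟨v, hv, hv1, hv2⟩ := exists_mem_Pol_lowerD_eq_zero (m := 4) (w := 11) (by
        rwa [finrank_Pol_of_eq (by norm_num) 10 (by norm_num),
          finrank_Pol_of_eq (by norm_num) 11 (by norm_num)])
      have b0 := iv_four h
      have b1 : iv ρ 4 11 ≤ iv ρ 4 12 := iv_mono ρ (m := 4) (w := 11) (by norm_num)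
      have b2 : iv ρ 4 12 ≤ iv ρ 4 13 := iv_mono ρ (m := 4) (w := 12) (by norm_num)
      have b3 : iv ρ 4 13 ≤ iv ρ 4 14 := iv_mono ρ (m := 4) (w := 13) (by norm_num)
      have b5 : iv ρ 4 11 = 0 := by omega
      rw [iv, Submodule.finrank_eq_zero] at b5
      have := pig_pairing ρ (m := 6) (n := 4) (k := 6) (w := 17) (u := 11) (by norm_num)
        (by norm_num) hv hv1 (fun hv3 => hv2 (by
          have : v ∈ Van (Z0 ρ) 4 (11 : ℕ) := hv3
          rw [b5] at this
          exact this)) (fun F hF h0 => lowerD_injective_ten F (by norm_num at hF; exact hF) h0)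
      rw [finrank_Pol_of_eq (by norm_num) 18 (by norm_num),
        finrank_Pol_of_eq (by norm_num) 17 (by norm_num),
        finrank_Van_of_eq ρ 17 (by norm_num), finrank_Van_of_eq ρ 18 (by norm_num)] at this
      change pv 6 18 + iv ρ 6 17 ≤ pv 6 17 + iv ρ 6 18 + _
      omega
    · have := pig_pairing ρ (m := 9) (n := 1) (k := 7) (w := 27) (u := 0) (by norm_num)
        (by norm_num) (v := X 0) (X_mem_Pol 0) (by simp [lowerD_X]) (fun hv3 => by
          have := regular_Z0 ρ 1 (by simpa using hv3.1) (pt ρ 1 0 0 1) ⟨1, 0, 0, 1, rfl⟩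
          simp at this) (fun F hF h0 => lowerD_injective_ten F (by norm_num at hF; exact hF) h0)
      rw [finrank_Pol_of_eq (by norm_num) 28 (by norm_num),
        finrank_Pol_of_eq (by norm_num) 27 (by norm_num),
        finrank_Van_of_eq ρ 27 (by norm_num), finrank_Van_of_eq ρ 28 (by norm_num)] at this
      change pv 9 28 + iv ρ 9 27 ≤ pv 9 27 + iv ρ 9 28 + _
      omega
  · have := pig_nat ρ m w (7 * m - 2 * (w + 1)) hm (by omega)
    omega

theorem iTab_rev {m w : ℕ} (hw : w ≤ 7 * m) : iTab m (7 * m - w) = iTab m w := by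
  rw [iTab, iTab, Nat.sub_sub_self hw, min_comm]

/-- The condition under which the lower bounds propagate. -/
def lowerCheck (m : ℕ) (pr : ℕ → ℕ) : Bool :=
  (List.range (7 * m / 2 + 1)).all fun w => decide (iTab m w ≤ pr w) ||
    (decide (1 ≤ w) && (decide (iTab m w ≤ iTab m (w - 1)) ||
      decide (iTab m w + pv m (w - 1) + slack m (w - 1) ≤ pv m w + iTab m (w - 1))))

theorem iTab_le_iv (h : IsGood ρ) {m : ℕ} (hm : m ≤ 12) (pr : ℕ → ℕ) (hpr : ∀ w, pr w ≤ iv ρ m w)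
    (hc : lowerCheck m pr = true) (w : ℕ) : iTab m w ≤ iv ρ m w := by
  have key : ∀ w, 2 * w ≤ 7 * m → iTab m w ≤ iv ρ m w := by
    intro w
    induction w with
    | zero => intro _; simp [iTab]
    | succ w ih =>
      intro hw
      have h1 := List.all_eq_true.mp hc (w + 1) (List.mem_range.mpr (by omega))
      have h2 := iv_mono ρ (m := m) (w := w) (by omega)
      have h3 := pig_slack h hm hw
      have h4 := ih (by omega)
      have h5 := hpr (w + 1)
      simp only [Bool.or_eq_true, Bool.and_eq_true, decide_eq_true_eq, Nat.add_sub_cancel] at h1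
      omega
  rcases le_or_gt (2 * w) (7 * m) with h1 | h1
  · exact key w h1
  · rcases le_or_gt w (7 * m) with h2 | h2
    · rw [← iTab_rev h2, ← iv_rev ρ h2]
      exact key _ (by omega)
    · have : iTab m w = 0 := by
        rw [iTab, if_pos (Or.inr ?_)]
        omega
      omega

theorem iv_le_iTab (h : IsGood ρ) {m : ℕ} (hm : m ≤ 12) (s c : ℕ) (hcm : 2 * c ≤ 7 * m)
    (hcen : iv ρ m c ≤ iTab m c)
    (hc : ((List.range c).all fun w => decide (w < s) ||
      decide (iTab m (w + 1) + pv m w + slack m w ≤ pv m (w + 1) + iTab m w) ||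
      decide (iTab m (w + 1) ≤ iTab m w)) = true) :
    ∀ w, s ≤ w → w ≤ c → iv ρ m w ≤ iTab m w := by
  intro w hs hw
  obtain ⟨n, hn⟩ := Nat.exists_eq_add_of_le hw
  clear hw
  induction n generalizing w with
  | zero => rwa [hn] at hcen
  | succ n ih =>
    have ih := ih (w + 1) (by omega) (by omega)
    have h1 := List.all_eq_true.mp hc w (List.mem_range.mpr (by omega))
    have h3 := pig_slack h hm (w := w) (by omega)
    have h2 := iv_mono ρ (m := m) (w := w) (by omega)
    simp only [Bool.or_eq_true, decide_eq_true_eq] at h1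
    omega

theorem gv_le_gv {m a b : ℕ} (hab : a ≤ b) (hb : 2 * b ≤ 7 * m + 1) : gv ρ m a ≤ gv ρ m b := by
  induction b, hab using Nat.le_induction with
  | base => rfl
  | succ b hab ih => exact (ih (by omega)).trans (gv_mono ρ (by omega))

theorem gTab_rev {m w : ℕ} (hw : w ≤ 7 * m) : gTab m (7 * m - w) = gTab m w := by
  simp only [gTab, Nat.sub_sub_self hw, min_comm]

theorem gTab_eq_zero {m w : ℕ} (hw : 7 * m < w) : gTab m w = 0 := by
  have : min w (7 * m - w) = 0 := by omega
  simp only [gTab, this]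
  split <;> rfl

theorem gv_eq_gTab_of_half {m : ℕ} (h : ∀ w, 2 * w ≤ 7 * m → gv ρ m w = gTab m w) (w : ℕ) :
    gv ρ m w = gTab m w := by
  rcases le_or_gt (2 * w) (7 * m) with h1 | h1
  · exact h w h1
  · rcases le_or_gt w (7 * m) with h2 | h2
    · rw [← gTab_rev h2, ← gv_rev ρ h2]
      exact h _ (by omega)
    · rw [gTab_eq_zero h2, gv_eq_zero ρ h2]

theorem iTab_eq_zero {m w : ℕ} (hw : 7 * m < w) : iTab m w = 0 := by
  rw [iTab, if_pos (Or.inr (by omega))]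

theorem iv_eq_iTab_of_half {m : ℕ} (h : ∀ w, 2 * w ≤ 7 * m → iv ρ m w = iTab m w) (w : ℕ) :
    iv ρ m w = iTab m w := by
  rcases le_or_gt (2 * w) (7 * m) with h1 | h1
  · exact h w h1
  · rcases le_or_gt w (7 * m) with h2 | h2
    · rw [← iTab_rev h2, ← iv_rev ρ h2]
      exact h _ (by omega)
    · rw [iTab_eq_zero h2, iv_eq_zero ρ h2]

theorem iv_le_iv {m a b : ℕ} (hab : a ≤ b) (hb : 2 * b ≤ 7 * m + 1) : iv ρ m a ≤ iv ρ m b := by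
  induction b, hab using Nat.le_induction with
  | base => rfl
  | succ b hab ih => exact (ih (by omega)).trans (iv_mono ρ (by omega))

theorem iv_six (h : IsGood ρ) (w : ℕ) : iv ρ 6 w = iTab 6 w := by
  have low := iTab_le_iv h (m := 6) (by norm_num) (fun _ => 0) (fun _ => Nat.zero_le _)
    (by decide +kernel)
  have up := iv_le_iTab h (m := 6) (by norm_num) 17 21 (by norm_num) (iv_six_center h)
    (by decide +kernel)
  refine iv_eq_iTab_of_half (fun w hw => le_antisymm ?_ (low w)) w
  rcases le_or_gt 17 w with h1 | h1
  · exact up w h1 (by omega)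
  · exact (iv_le_iv h1.le (by norm_num)).trans ((up 17 le_rfl (by norm_num)).trans (Nat.zero_le _))

theorem iv_of_lt_six (h : IsGood ρ) {m : ℕ} (hm : m < 6) (w : ℕ) : iv ρ m w = 0 := by
  have key : ∀ n, n ≤ 6 → ∀ w, w ≤ 17 → iv ρ (6 - n) w = 0 := by
    intro n
    induction n with
    | zero =>
      intro _ w hw
      rw [Nat.sub_zero, iv_six h, iTab, if_pos (Or.inr (by omega))]
    | succ n ih =>
      intro hn w hw
      have h1 := iv_le_succ ρ (6 - (n + 1)) w
      rw [show 6 - (n + 1) + 1 = 6 - n by omega, ih (by omega) w hw] at h1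
      omega
  rw [← show iTab m w = 0 by rw [iTab, if_pos (Or.inl hm)]]
  refine iv_eq_iTab_of_half (fun w hw => ?_) w
  have := key (6 - m) (by omega) w (by omega)
  rwa [Nat.sub_sub_self hm.le, ← show iTab m w = 0 by rw [iTab, if_pos (Or.inl hm)]] at this

theorem gv_of_lt_six (h : IsGood ρ) {m : ℕ} (hm : m < 6) (w : ℕ) : gv ρ m w = 0 := by
  have h1 := gv_add ρ m w
  rw [iv_of_lt_six h hm] at h1
  omega

/-- The upper bound for the decomposable part given by the numbers of generators. -/
def decCount (m w : ℕ) : ℕ :=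
  ((List.range m).map fun n => ((List.range (w + 1)).map fun u =>
    pv (m - n) (w - u) * gTab n u).sum).sum

theorem jv_le_decCount {m w : ℕ} (hm : m ≤ 12) (hG : ∀ n < m, ∀ u, gv ρ n u ≤ gTab n u) :
    jv ρ m w ≤ decCount m w :=
  jv_le_count ρ m w hm gTab fun n hn u _ => hG n hn u

theorem le_jv_of_DecBound {m w t : ℕ} (hm : m ≤ 12) {ks : List (Fin 8)} (h : DecBound ρ m w t ks)
    (hI : ∀ u, iTab m u ≤ iv ρ m u) (j : ℕ)
    (hj : ((ks.all fun k => decide (k.val ≤ w)) && decide ((ks.map fun k : Fin 8 =>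
      pv m (w - k.val) - iTab m (w - k.val)).sum + j ≤ t + iTab m w)) = true) :
    j ≤ jv ρ (m + 1) w := by
  rw [Bool.and_eq_true, List.all_eq_true, decide_eq_true_eq] at hj
  have h1 : (ks.map fun k : Fin 8 => cod (Z0 ρ) m (w - ((k : ℕ) : ℤ))).sum ≤
      (ks.map fun k : Fin 8 => pv m (w - k.val) - iTab m (w - k.val)).sum := by
    refine List.sum_le_sum fun k hk => ?_
    have h2 := cod_iv ρ hm (w - k.val)
    have h3 := hI (w - k.val)
    rw [Nat.cast_sub (of_decide_eq_true (hj.1 k hk))] at h2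
    omega
  have h2 := hI w
  have h3 := hj.2
  rw [DecBound] at h
  omega

theorem gv_six (h : IsGood ρ) (w : ℕ) : gv ρ 6 w = gTab 6 w := by
  refine gv_eq_gTab_of_half (fun w hw => ?_) w
  have h1 := gv_add ρ 6 w
  have h2 := jv_le_count ρ 6 w (by norm_num) (fun _ _ => 0) fun n hn u _ =>
    (gv_of_lt_six h hn u).le
  have h3 : jv ρ 6 w = 0 := by simpa using h2
  have h4 := iv_six h w
  have h5 : ∀ w ≤ 21, iTab 6 w = gTab 6 w := by decide +kernel
  have h6 := h5 w (by omega)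
  omega

theorem gv_seven (h : IsGood ρ) (w : ℕ) : gv ρ 7 w = 0 := by
  refine (gv_eq_gTab_of_half (m := 7) (fun w hw => ?_) w).trans rfl
  have h1 := h.cod0 (163, 7, 24, 159) (by simp)
  have h2 := cod_iv ρ (m := 7) (by norm_num) 24
  have h3 : pv 7 24 = 169 := by decide +kernel
  have h4 : 10 ≤ jv ρ 7 24 := le_jv_of_DecBound (by norm_num) (h.dec7 (12, 24, 631) (by simp))
    (fun u => (iv_six h u).ge) 10 (by decide +kernel)
  have h5 := gv_add ρ 7 24
  have h6 := gv_le_gv (ρ := ρ) (m := 7) (a := w) (b := 24) (by omega) (by norm_num)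
  change _ = 0
  simp only at h1
  omega

theorem gv_le_gTab_of_lt_eight (h : IsGood ρ) {n : ℕ} (hn : n < 8) (u : ℕ) :
    gv ρ n u ≤ gTab n u := by
  rcases lt_or_ge n 6 with h6 | h6
  · rw [gv_of_lt_six h h6]
    exact Nat.zero_le _
  · interval_cases n
    · exact (gv_six h u).le
    · exact (gv_seven h u).trans_le (Nat.zero_le _)

theorem iv_seven (h : IsGood ρ) (w : ℕ) : iv ρ 7 w = iTab 7 w := by
  refine iv_eq_iTab_of_half (fun w hw => le_antisymm ?_ ?_) w
  · have h1 := jv_le_decCount (ρ := ρ) (m := 7) (w := w) (by norm_num)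
      fun n hn u => gv_le_gTab_of_lt_eight h (by omega) u
    have h2 := gv_add ρ 7 w
    have h3 := gv_seven h w
    have h4 : ∀ w ≤ 24, decCount 7 w ≤ iTab 7 w := by decide +kernel
    have h5 := h4 w (by omega)
    omega
  · have h2 := gv_add ρ 7 w
    have h3 := gv_seven h w
    rcases lt_or_ge w 18 with h18 | h18
    · rw [iTab, if_pos (Or.inr (by omega))]
      exact Nat.zero_le _
    have D := fun x hx => le_jv_of_DecBound (m := 6) (by norm_num) (h.dec7 x hx)
      (fun u => (iv_six h u).ge)
    have hw' : w ≤ 24 := by omega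
    suffices iTab 7 w ≤ jv ρ 7 w by omega
    interval_cases w
    · have h4 := iv_le_jv ρ 6 18
      rw [iv_six h] at h4
      exact h4
    · exact D (4, 19, 472) (by simp) _ (by decide +kernel)
    · exact D (5, 20, 516) (by simp) _ (by decide +kernel)
    · exact D (7, 21, 558) (by simp) _ (by decide +kernel)
    · exact D (9, 22, 591) (by simp) _ (by decide +kernel)
    · exact D (11, 23, 617) (by simp) _ (by decide +kernel)
    · exact D (12, 24, 631) (by simp) _ (by decide +kernel)

theorem gv_iv_eight_aux (h : IsGood ρ) :
    (∀ w, 18 ≤ w → w ≤ 28 → gv ρ 8 w = gTab 8 w ∧ iTab 8 w ≤ iv ρ 8 w) ∧ gv ρ 8 19 = 0 := by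
  have U : ∀ w, jv ρ 8 w ≤ decCount 8 w := fun w =>
    jv_le_decCount (by norm_num) fun n hn u => gv_le_gTab_of_lt_eight h hn u
  have P := fun w (hw : 2 * (w + 1) ≤ 7 * 8) => pig_slack h (m := 8) (w := w) (by norm_num) hw
  have G := fun w (hw : 2 * w < 7 * 8) => gv_mono ρ (m := 8) (w := w) hw
  have D := fun x hx => le_jv_of_DecBound (m := 7) (by norm_num) (h.dec8 x hx)
    (fun u => (iv_seven h u).ge)
  have u18 : jv ρ 8 18 ≤ 1 := (U 18).trans (by decide +kernel)
  have s18 := gv_add ρ 8 18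
  have p18 : 176 + iv ρ 8 18 ≤ 158 + iv ρ 8 19 + 19 := P 18 (by norm_num)
  have g18 : gv ρ 8 18 ≤ gv ρ 8 19 := G 18 (by norm_num)
  have u19 : jv ρ 8 19 ≤ 2 := (U 19).trans (by decide +kernel)
  have s19 := gv_add ρ 8 19
  have p19 : 197 + iv ρ 8 19 ≤ 176 + iv ρ 8 20 + 17 := P 19 (by norm_num)
  have g19 : gv ρ 8 19 ≤ gv ρ 8 20 := G 19 (by norm_num)
  have u20 : jv ρ 8 20 ≤ 5 := (U 20).trans (by decide +kernel)
  have s20 := gv_add ρ 8 20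
  have p20 : 214 + iv ρ 8 20 ≤ 197 + iv ρ 8 21 + 15 := P 20 (by norm_num)
  have g20 : gv ρ 8 20 ≤ gv ρ 8 21 := G 20 (by norm_num)
  have u21 : jv ρ 8 21 ≤ 8 := (U 21).trans (by decide +kernel)
  have s21 := gv_add ρ 8 21
  have p21 : 233 + iv ρ 8 21 ≤ 214 + iv ρ 8 22 + 13 := P 21 (by norm_num)
  have g21 : gv ρ 8 21 ≤ gv ρ 8 22 := G 21 (by norm_num)
  have u22 : jv ρ 8 22 ≤ 13 := (U 22).trans (by decide +kernel)
  have s22 := gv_add ρ 8 22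
  have p22 : 247 + iv ρ 8 22 ≤ 233 + iv ρ 8 23 + 11 := P 22 (by norm_num)
  have g22 : gv ρ 8 22 ≤ gv ρ 8 23 := G 22 (by norm_num)
  have u23 : jv ρ 8 23 ≤ 17 := (U 23).trans (by decide +kernel)
  have s23 := gv_add ρ 8 23
  have p23 : 263 + iv ρ 8 23 ≤ 247 + iv ρ 8 24 + 9 := P 23 (by norm_num)
  have g23 : gv ρ 8 23 ≤ gv ρ 8 24 := G 23 (by norm_num)
  have u24 : jv ρ 8 24 ≤ 23 := (U 24).trans (by decide +kernel)
  have s24 := gv_add ρ 8 24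
  have p24 : 272 + iv ρ 8 24 ≤ 263 + iv ρ 8 25 + 7 := P 24 (by norm_num)
  have g24 : gv ρ 8 24 ≤ gv ρ 8 25 := G 24 (by norm_num)
  have u25 : jv ρ 8 25 ≤ 27 := (U 25).trans (by decide +kernel)
  have s25 := gv_add ρ 8 25
  have p25 : 282 + iv ρ 8 25 ≤ 272 + iv ρ 8 26 + 5 := P 25 (by norm_num)
  have g25 : gv ρ 8 25 ≤ gv ρ 8 26 := G 25 (by norm_num)
  have u26 : jv ρ 8 26 ≤ 32 := (U 26).trans (by decide +kernel)
  have s26 := gv_add ρ 8 26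
  have p26 : 285 + iv ρ 8 26 ≤ 282 + iv ρ 8 27 + 3 := P 26 (by norm_num)
  have g26 : gv ρ 8 26 ≤ gv ρ 8 27 := G 26 (by norm_num)
  have u27 : jv ρ 8 27 ≤ 34 := (U 27).trans (by decide +kernel)
  have s27 := gv_add ρ 8 27
  have p27 : 289 + iv ρ 8 27 ≤ 285 + iv ρ 8 28 + 1 := P 27 (by norm_num)
  have g27 : gv ρ 8 27 ≤ gv ρ 8 28 := G 27 (by norm_num)
  have u28 : jv ρ 8 28 ≤ 36 := (U 28).trans (by decide +kernel)
  have s28 := gv_add ρ 8 28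
  have l21 : 8 ≤ jv ρ 8 21 := D (5, 21, 776) (by simp) _ (by decide +kernel)
  have l23 : 17 ≤ jv ρ 8 23 := D (11, 23, 923) (by simp) _ (by decide +kernel)
  have l25 : 26 ≤ jv ρ 8 25 := D (19, 25, 1035) (by simp) _ (by decide +kernel)
  have l26 : 31 ≤ jv ρ 8 26 := D (25, 26, 1076) (by simp) _ (by decide +kernel)
  have l27 : 32 ≤ jv ρ 8 27 := D (27, 27, 1101) (by simp) _ (by decide +kernel)
  have l28 : 34 ≤ jv ρ 8 28 := D (31, 28, 1117) (by simp) _ (by decide +kernel)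
  have l18 : iTab 7 18 ≤ jv ρ 8 18 := (iv_seven h 18).ge.trans (iv_le_jv ρ 7 18)
  have l19 : iTab 7 19 ≤ jv ρ 8 19 := (iv_seven h 19).ge.trans (iv_le_jv ρ 7 19)
  change 1 ≤ _ at l18
  change 2 ≤ _ at l19
  have center : iv ρ 8 28 ≤ 38 := by
    have h1 := h.cod0 (255, 8, 28, 251) (by simp)
    have h2 : _ = 289 := cod_iv ρ (m := 8) (by norm_num) 28
    simp only at h1
    omega
  have step : jv ρ 8 28 + 4 ≤ jv ρ 8 27 + 6 := by
    have := jv_step ρ (m := 7) (w := 27) (by norm_num) (by norm_num)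
    rw [iv_seven h, iv_seven h] at this
    exact this
  have b20 : 1 ≤ gv ρ 8 20 := by omega
  have b22 : 2 ≤ gv ρ 8 22 := by omega
  have b24 : 3 ≤ gv ρ 8 24 := by omega
  have i27 : iv ρ 8 27 ≤ 35 := by omega
  have b27 : gv ρ 8 27 ≤ 3 := by omega
  have b28 : 4 ≤ gv ρ 8 28 := by omega
  have i23 : iv ρ 8 23 ≤ 19 := by omega
  have b23 : gv ρ 8 23 ≤ 2 := by omega
  have i21 : iv ρ 8 21 ≤ 9 := by omega
  have b21 : gv ρ 8 21 ≤ 1 := by omega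
  have b19 : gv ρ 8 19 = 0 := by omega
  have b28' : gv ρ 8 28 ≤ 4 := by omega
  refine ⟨fun w h1 h2 => ?_, b19⟩
  interval_cases w
  · exact ⟨show _ = 0 by omega, show 1 ≤ _ by omega⟩
  · exact ⟨show _ = 0 by omega, show 2 ≤ _ by omega⟩
  · exact ⟨show _ = 1 by omega, show 6 ≤ _ by omega⟩
  · exact ⟨show _ = 1 by omega, show 9 ≤ _ by omega⟩
  · exact ⟨show _ = 2 by omega, show 15 ≤ _ by omega⟩
  · exact ⟨show _ = 2 by omega, show 19 ≤ _ by omega⟩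
  · exact ⟨show _ = 3 by omega, show 26 ≤ _ by omega⟩
  · exact ⟨show _ = 3 by omega, show 29 ≤ _ by omega⟩
  · exact ⟨show _ = 3 by omega, show 34 ≤ _ by omega⟩
  · exact ⟨show _ = 3 by omega, show 35 ≤ _ by omega⟩
  · exact ⟨show _ = 4 by omega, show 38 ≤ _ by omega⟩

theorem gv_eight (h : IsGood ρ) (w : ℕ) : gv ρ 8 w = gTab 8 w := by
  refine gv_eq_gTab_of_half (fun w hw => ?_) w
  rcases le_or_gt 18 w with h1 | h1
  · exact ((gv_iv_eight_aux h).1 w h1 (by omega)).1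
  · have h2 := gv_le_gv (ρ := ρ) (m := 8) (a := w) (b := 19) (by omega) (by norm_num)
    have h3 := (gv_iv_eight_aux h).2
    have h4 : ∀ w < 18, gTab 8 w = 0 := by decide +kernel
    have h5 := h4 w h1
    omega

theorem iTab_le_iv_of_half {m : ℕ} (h : ∀ w, 2 * w ≤ 7 * m → iTab m w ≤ iv ρ m w) (w : ℕ) :
    iTab m w ≤ iv ρ m w := by
  rcases le_or_gt (2 * w) (7 * m) with h1 | h1
  · exact h w h1
  · rcases le_or_gt w (7 * m) with h2 | h2
    · rw [← iTab_rev h2, ← iv_rev ρ h2]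
      exact h _ (by omega)
    · rw [iTab_eq_zero h2]
      exact Nat.zero_le _

theorem iTab_le_iv_eight (h : IsGood ρ) (w : ℕ) : iTab 8 w ≤ iv ρ 8 w := by
  refine iTab_le_iv_of_half (fun w hw => ?_) w
  rcases le_or_gt 18 w with h1 | h1
  · exact ((gv_iv_eight_aux h).1 w h1 (by omega)).2
  · rw [iTab, if_pos (Or.inr (by omega))]
    exact Nat.zero_le _

theorem gv_le_gTab_of_lt_nine (h : IsGood ρ) {n : ℕ} (hn : n < 9) (u : ℕ) :
    gv ρ n u ≤ gTab n u := by
  rcases Nat.lt_succ_iff_lt_or_eq.mp hn with h8 | rfl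
  · exact gv_le_gTab_of_lt_eight h h8 u
  · exact (gv_eight h u).le

theorem iTab_le_iv_nine (h : IsGood ρ) (w : ℕ) : iTab 9 w ≤ iv ρ 9 w :=
  iTab_le_iv h (by norm_num) (iTab 8)
    (fun w => (iTab_le_iv_eight h w).trans (iv_le_succ ρ 8 w)) (by decide +kernel) w

theorem iv_le_iTab_nine (h : IsGood ρ) {w : ℕ} (h1 : 19 ≤ w) (h2 : w ≤ 31) :
    iv ρ 9 w ≤ iTab 9 w := by
  refine iv_le_iTab h (by norm_num) 19 31 (by norm_num) ?_ (by decide +kernel) w h1 h2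
  have h1 := h.cod0 (375, 9, 31, 363) (by simp)
  have h2 : _ = 468 := cod_iv ρ (m := 9) (by norm_num) 31
  change _ ≤ 105
  simp only at h1
  omega

theorem gv_nine (h : IsGood ρ) (w : ℕ) : gv ρ 9 w = gTab 9 w := by
  refine gv_eq_gTab_of_half (fun w hw => ?_) w
  have U : ∀ w, jv ρ 9 w ≤ decCount 9 w := fun w =>
    jv_le_decCount (by norm_num) fun n hn u => gv_le_gTab_of_lt_nine h hn u
  have D := fun {w t ks} (hx : DecBound ρ 8 w t ks) => le_jv_of_DecBound (by norm_num) hx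
    (iTab_le_iv_eight h)
  have I := fun w => (iTab_le_iv_eight h w).trans (iv_le_jv ρ 8 w)
  have j19 : 2 ≤ jv ρ 9 19 := I 19
  have j20 : 6 ≤ jv ρ 9 20 := I 20
  have j21 : 11 ≤ jv ρ 9 21 := D h.dec9_low _ (by decide +kernel)
  have j22 : 19 ≤ jv ρ 9 22 := D h.dec9_mid _ (by decide +kernel)
  have j31 : 100 ≤ jv ρ 9 31 := D h.dec9 _ (by decide +kernel)
  have i19 : iv ρ 9 19 ≤ 2 := iv_le_iTab_nine h (by norm_num) (by norm_num)
  have i20 : iv ρ 9 20 ≤ 7 := iv_le_iTab_nine h (by norm_num) (by norm_num)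
  have i21 : iv ρ 9 21 ≤ 14 := iv_le_iTab_nine h (by norm_num) (by norm_num)
  have i22 : iv ρ 9 22 ≤ 23 := iv_le_iTab_nine h (by norm_num) (by norm_num)
  have i31 : iv ρ 9 31 ≤ 105 := iv_le_iTab_nine h (by norm_num) (by norm_num)
  have k20 : 7 ≤ iv ρ 9 20 := iTab_le_iv_nine h 20
  have k21 : 14 ≤ iv ρ 9 21 := iTab_le_iv_nine h 21
  have k22 : 23 ≤ iv ρ 9 22 := iTab_le_iv_nine h 22
  have k23 : 33 ≤ iv ρ 9 23 := iTab_le_iv_nine h 23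
  have u20 : jv ρ 9 20 ≤ 6 := (U 20).trans (by decide +kernel)
  have u21 : jv ρ 9 21 ≤ 11 := (U 21).trans (by decide +kernel)
  have u22 : jv ρ 9 22 ≤ 19 := (U 22).trans (by decide +kernel)
  have u23 : jv ρ 9 23 ≤ 28 := (U 23).trans (by decide +kernel)
  have s19 := gv_add ρ 9 19
  have s20 := gv_add ρ 9 20
  have s21 := gv_add ρ 9 21
  have s22 := gv_add ρ 9 22
  have s23 := gv_add ρ 9 23
  have s31 := gv_add ρ 9 31
  rcases lt_or_ge w 20 with h1 | h1
  · have h2 := gv_le_gv (ρ := ρ) (m := 9) (a := w) (b := 19) (by omega) (by norm_num)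
    have h4 : ∀ w < 20, gTab 9 w = 0 := by decide +kernel
    have h5 := h4 w h1
    omega
  rcases lt_or_ge w 23 with h2 | h2
  · interval_cases w
    · exact show _ = 1 by omega
    · exact show _ = 3 by omega
    · exact show _ = 4 by omega
  · have h3 := gv_le_gv (ρ := ρ) (m := 9) h2 (by omega)
    have h4 := gv_le_gv (ρ := ρ) (m := 9) (a := w) (b := 31) (by omega) (by norm_num)
    have h5 : ∀ w < 32, 23 ≤ w → gTab 9 w = 5 := by decide +kernel
    have h6 := h5 w (by omega) h2
    omega

theorem gv_le_gTab_of_lt_ten (h : IsGood ρ) {n : ℕ} (hn : n < 10) (u : ℕ) :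
    gv ρ n u ≤ gTab n u := by
  rcases Nat.lt_succ_iff_lt_or_eq.mp hn with h8 | rfl
  · exact gv_le_gTab_of_lt_nine h h8 u
  · exact (gv_nine h u).le

end Good

/-- Every form vanishing on the points with `a_0 = 0` lifts modulo `a_0`. -/
def Lift0 (ρ : Fin 7 → ℂ) (n : ℕ) (w : ℤ) : Prop :=
  Van (Z1 ρ) (n + 1) w ≤ Van (Z0 ρ) (n + 1) w ⊔ (Pol n w).map (mulX 0)

/-- Every form vanishing on the points with `a_0 = a_7 = 0` lifts modulo `a_7`. -/
def Lift1 (ρ : Fin 7 → ℂ) (n : ℕ) (w : ℤ) : Prop :=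
  Van (Z2 ρ) (n + 1) w ≤ Van (Z1 ρ) (n + 1) w ⊔ (Pol n (w - 7)).map (mulX 7)

theorem Z1_subset (ρ : Fin 7 → ℂ) : Z1 ρ ⊆ Z0 ρ := fun _ h => h.1

theorem Z2_subset (ρ : Fin 7 → ℂ) : Z2 ρ ⊆ Z1 ρ := fun _ h => h.1

section Chains
variable (ρ : Fin 7 → ℂ) (n : ℕ) (w : ℤ)

theorem chain_Z0 : cod (Z0 ρ) n w + cod (Z1 ρ) (n + 1) w ≤ cod (Z0 ρ) (n + 1) w ∧
    (cod (Z0 ρ) (n + 1) w ≤ cod (Z0 ρ) n w + cod (Z1 ρ) (n + 1) w → Lift0 ρ n w) := by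
  have := chain (Z1_subset ρ) (k := 0) (fun _ hz => hz.2) (n := n) (w := w) (regular_Z0 ρ)
  simpa [Lift0] using this

theorem chain_Z1 : cod (Z1 ρ) n (w - 7) + cod (Z2 ρ) (n + 1) w ≤ cod (Z1 ρ) (n + 1) w ∧
    (cod (Z1 ρ) (n + 1) w ≤ cod (Z1 ρ) n (w - 7) + cod (Z2 ρ) (n + 1) w → Lift1 ρ n w) :=
  chain (Z2_subset ρ) (k := 7) (fun _ hz => hz.2) (n := n) (w := w) (regular_Z1 ρ)

variable {ρ}

theorem chain_Z2 (hρ : Function.Injective ρ) :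
    cod (Z2 ρ) n (w - 1) ≤ cod (Z2 ρ) (n + 1) w ∧
    (cod (Z2 ρ) (n + 1) w ≤ cod (Z2 ρ) n (w - 1) →
      Pol (n + 1) w ≤ Van (Z2 ρ) (n + 1) w ⊔ (Pol n (w - 1)).map (mulX 1)) := by
  have := chain (Z' := ∅) (Set.empty_subset (Z2 ρ)) (k := 1) (fun _ hz => hz.elim) (n := n) (w := w)
    (regular_Z2 hρ)
  rw [cod_empty, Van_empty] at this
  exact this

end Chains

/-- The lower bound for the number of conditions imposed by `Z2` in degree `9`. -/
def codNine2 (w : ℤ) : ℕ :=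
  if min w (63 - w) < 9 then 0 else codTable2.getD (min w (63 - w) - 9).toNat 0

/-- The lower bound for the number of conditions imposed by `Z1` in degree `9`. -/
def codNine1 (w : ℤ) : ℕ := if w < 9 then 0 else codTable1.getD (w - 9).toNat 0

theorem codNine2_rev (w : ℤ) : codNine2 (63 - w) = codNine2 w := by
  rw [codNine2, codNine2, sub_sub_cancel, min_comm]

/-- The lower bound for the number of conditions imposed by `Z2` in degree `9 + j`. -/
def codLow2 (j : ℕ) (w : ℤ) : ℕ := max (codNine2 (w - j)) (codNine2 (w - 6 * j))

section Lift

variable {ρ : Fin 7 → ℂ}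

theorem codNine1_le (h : IsGood ρ) (w : ℤ) : codNine1 w ≤ cod (Z1 ρ) 9 w := by
  rw [codNine1]
  split_ifs with hw
  · exact Nat.zero_le _
  · rcases lt_or_ge (w - 9).toNat 55 with h1 | h1
    · have := h.cod1 _ (List.mem_range.mpr h1)
      rwa [show (((w - 9).toNat + 9 : ℕ) : ℤ) = w by omega] at this
    · rw [List.getD_eq_default _ _ (by simpa [codTable1] using h1)]
      exact Nat.zero_le _

theorem codNine2_le (h : IsGood ρ) (w : ℤ) : codNine2 w ≤ cod (Z2 ρ) 9 w := by
  have key : ∀ w : ℤ, 2 * w ≤ 63 → codNine2 w ≤ cod (Z2 ρ) 9 w := by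
    intro w hw
    rw [codNine2, min_eq_left (by omega)]
    split_ifs with hw'
    · exact Nat.zero_le _
    · have := h.cod2 _ (List.mem_range.mpr (show (w - 9).toNat < 23 by omega))
      rwa [show (((w - 9).toNat + 9 : ℕ) : ℤ) = w by omega] at this
  rcases le_or_gt (2 * w) 63 with h1 | h1
  · exact key w h1
  · have := key (63 - w) (by omega)
    rw [codNine2_rev] at this
    have e := cod_rev (isRevStable_Z2 ρ) 9 w
    norm_num at e
    rwa [e] at this

theorem codNine2_le_add (h : IsGood ρ) (j : ℕ) (w : ℤ) :
    codNine2 (w - j) ≤ cod (Z2 ρ) (9 + j) w := by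
  induction j generalizing w with
  | zero => simpa using codNine2_le h w
  | succ j ih =>
    have h1 := ih (w - 1)
    rw [show w - 1 - (j : ℤ) = w - (j + 1 : ℕ) by push_cast; ring] at h1
    exact h1.trans (chain_Z2 (9 + j) w h.inj).1

theorem codLow2_le (h : IsGood ρ) (j : ℕ) (w : ℤ) : codLow2 j w ≤ cod (Z2 ρ) (9 + j) w := by
  refine max_le (codNine2_le_add h j w) ?_
  have h1 := codNine2_le_add h j (7 * (9 + j : ℕ) - w)
  rw [cod_rev (isRevStable_Z2 ρ), ← codNine2_rev] at h1
  rwa [show (63 : ℤ) - (7 * (9 + j : ℕ) - w - j) = w - 6 * j by push_cast; ring] at h1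

/-- The lower bound for the number of conditions imposed by `Z1` in degree `9 + j`. -/
def codLow1 : ℕ → ℤ → ℕ
  | 0, w => codNine1 w
  | j + 1, w => codLow1 j (w - 7) + codLow2 (j + 1) w

theorem codLow1_le (h : IsGood ρ) (j : ℕ) (w : ℤ) : codLow1 j w ≤ cod (Z1 ρ) (9 + j) w := by
  induction j generalizing w with
  | zero => exact codNine1_le h w
  | succ j ih =>
    exact (Nat.add_le_add (ih (w - 7)) (codLow2_le h (j + 1) w)).trans (chain_Z1 ρ (9 + j) w).1

theorem iv_le_succ_of_codLow1 (h : IsGood ρ) {j w c : ℕ} (hj : j ≤ 2) (hc : iv ρ (9 + j) w ≤ c) :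
    iv ρ (10 + j) w + pv (9 + j) w + codLow1 (j + 1) w ≤ pv (10 + j) w + c := by
  have h1 := (chain_Z0 ρ (9 + j) w).1
  have h2 := codLow1_le h (j + 1) w
  have h3 := cod_iv ρ (m := 9 + j) (by omega) w
  have h4 := cod_iv ρ (m := 10 + j) (by omega) w
  have e : cod (Z0 ρ) (9 + j + 1) w = cod (Z0 ρ) (10 + j) w := by rw [show 9 + j + 1 = 10 + j by omega]
  have e' : cod (Z1 ρ) (9 + j + 1) w = cod (Z1 ρ) (9 + (j + 1)) w := rfl
  omega

theorem iv_eq_of_gv_eq {m w : ℕ} (hm : m ≤ 12) (hG : ∀ n < m, ∀ u, gv ρ n u ≤ gTab n u)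
    (hg : gv ρ m w = gTab m w) (hI : iTab m w ≤ iv ρ m w)
    (hc : decCount m w + gTab m w ≤ iTab m w) : iv ρ m w = iTab m w := by
  have h1 := jv_le_decCount (ρ := ρ) (w := w) hm hG
  have h2 := gv_add ρ m w
  omega

theorem iv_nine (h : IsGood ρ) (w : ℕ) : iv ρ 9 w = iTab 9 w := by
  refine iv_eq_iTab_of_half (fun w hw => ?_) w
  rcases le_or_gt 19 w with h1 | h1
  · exact (iv_le_iTab_nine h h1 (by omega)).antisymm (iTab_le_iv_nine h w)
  · refine iv_eq_of_gv_eq (by norm_num) (fun n hn u => gv_le_gTab_of_lt_nine h hn u) (gv_nine h w)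
      (iTab_le_iv_nine h w) ?_
    exact (by decide +kernel : ∀ w < 19, decCount 9 w + gTab 9 w ≤ iTab 9 w) w h1

theorem iTab_le_iv_ten (h : IsGood ρ) (w : ℕ) : iTab 10 w ≤ iv ρ 10 w :=
  iTab_le_iv h (by norm_num) (iTab 9)
    (fun w => (iTab_le_iv_nine h w).trans (iv_le_succ ρ 9 w)) (by decide +kernel) w

theorem iv_le_iTab_ten (h : IsGood ρ) {w : ℕ} (h1 : 19 ≤ w) (h2 : w ≤ 35) :
    iv ρ 10 w ≤ iTab 10 w := by
  refine iv_le_iTab h (by norm_num) 19 35 (by norm_num) ?_ (by decide +kernel) w h1 h2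
  have h1 := iv_le_succ_of_codLow1 h (j := 0) (by norm_num) (iv_nine h 35).le
  have h2 : pv 10 35 + iTab 9 35 ≤ iTab 10 35 + (pv 9 35 + codLow1 1 35) := by decide +kernel
  have h3 : iv ρ 10 35 + pv 9 35 + codLow1 1 35 ≤ pv 10 35 + iTab 9 35 := h1
  omega

theorem gv_ten (h : IsGood ρ) (w : ℕ) : gv ρ 10 w = gTab 10 w := by
  refine gv_eq_gTab_of_half (fun w hw => ?_) w
  have U : ∀ w, jv ρ 10 w ≤ decCount 10 w := fun w =>
    jv_le_decCount (by norm_num) fun n hn u => gv_le_gTab_of_lt_ten h hn u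
  have D := fun {w t ks} (hx : DecBound ρ 9 w t ks) => le_jv_of_DecBound (by norm_num) hx
    (iTab_le_iv_nine h)
  have I := fun w => (iTab_le_iv_nine h w).trans (iv_le_jv ρ 9 w)
  have j19 : 2 ≤ jv ρ 10 19 := I 19
  have j20 : 7 ≤ jv ρ 10 20 := I 20
  have j21 : 15 ≤ jv ρ 10 21 := D h.dec10_low _ (by decide +kernel)
  have j35 : 242 ≤ jv ρ 10 35 := D h.dec10 _ (by decide +kernel)
  have i19 : iv ρ 10 19 ≤ 2 := iv_le_iTab_ten h (by norm_num) (by norm_num)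
  have i20 : iv ρ 10 20 ≤ 9 := iv_le_iTab_ten h (by norm_num) (by norm_num)
  have i21 : iv ρ 10 21 ≤ 17 := iv_le_iTab_ten h (by norm_num) (by norm_num)
  have i35 : iv ρ 10 35 ≤ 245 := iv_le_iTab_ten h (by norm_num) (by norm_num)
  have k20 : 9 ≤ iv ρ 10 20 := iTab_le_iv_ten h 20
  have k21 : 17 ≤ iv ρ 10 21 := iTab_le_iv_ten h 21
  have k22 : 32 ≤ iv ρ 10 22 := iTab_le_iv_ten h 22
  have u20 : jv ρ 10 20 ≤ 7 := (U 20).trans (by decide +kernel)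
  have u21 : jv ρ 10 21 ≤ 15 := (U 21).trans (by decide +kernel)
  have u22 : jv ρ 10 22 ≤ 29 := (U 22).trans (by decide +kernel)
  have s19 := gv_add ρ 10 19
  have s20 := gv_add ρ 10 20
  have s21 := gv_add ρ 10 21
  have s22 := gv_add ρ 10 22
  have s35 := gv_add ρ 10 35
  rcases lt_or_ge w 20 with h1 | h1
  · have h2 := gv_le_gv (ρ := ρ) (m := 10) (a := w) (b := 19) (by omega) (by norm_num)
    have h4 : ∀ w < 20, gTab 10 w = 0 := by decide +kernel
    have h5 := h4 w h1
    omega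
  rcases lt_or_ge w 22 with h2 | h2
  · interval_cases w
    · exact show _ = 2 by omega
    · exact show _ = 2 by omega
  · have h3 := gv_le_gv (ρ := ρ) (m := 10) h2 (by omega)
    have h4 := gv_le_gv (ρ := ρ) (m := 10) (a := w) (b := 35) (by omega) (by norm_num)
    have h5 : ∀ w < 36, 22 ≤ w → gTab 10 w = 3 := by decide +kernel
    have h6 := h5 w (by omega) h2
    omega

theorem gv_le_gTab_of_lt_eleven (h : IsGood ρ) {n : ℕ} (hn : n < 11) (u : ℕ) :
    gv ρ n u ≤ gTab n u := by
  rcases Nat.lt_succ_iff_lt_or_eq.mp hn with h8 | rfl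
  · exact gv_le_gTab_of_lt_ten h h8 u
  · exact (gv_ten h u).le

theorem iv_ten (h : IsGood ρ) (w : ℕ) : iv ρ 10 w = iTab 10 w := by
  refine iv_eq_iTab_of_half (fun w hw => ?_) w
  rcases le_or_gt 19 w with h1 | h1
  · exact (iv_le_iTab_ten h h1 (by omega)).antisymm (iTab_le_iv_ten h w)
  · refine iv_eq_of_gv_eq (by norm_num) (fun n hn u => gv_le_gTab_of_lt_ten h hn u) (gv_ten h w)
      (iTab_le_iv_ten h w) ?_
    exact (by decide +kernel : ∀ w < 19, decCount 10 w + gTab 10 w ≤ iTab 10 w) w h1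

theorem iTab_le_iv_eleven (h : IsGood ρ) (w : ℕ) : iTab 11 w ≤ iv ρ 11 w :=
  iTab_le_iv h (by norm_num) (iTab 10)
    (fun w => (iTab_le_iv_ten h w).trans (iv_le_succ ρ 10 w)) (by decide +kernel) w

theorem iTab_le_iv_twelve (h : IsGood ρ) (w : ℕ) : iTab 12 w ≤ iv ρ 12 w :=
  iTab_le_iv h (by norm_num) (iTab 11)
    (fun w => (iTab_le_iv_eleven h w).trans (iv_le_succ ρ 11 w)) (by decide +kernel) w

theorem iv_le_iTab_eleven (h : IsGood ρ) {w : ℕ} (h1 : 20 ≤ w) (h2 : w ≤ 38) :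
    iv ρ 11 w ≤ iTab 11 w := by
  refine iv_le_iTab h (by norm_num) 20 38 (by norm_num) ?_ (by decide +kernel) w h1 h2
  have h1 := iv_le_succ_of_codLow1 h (j := 1) (by norm_num) (iv_ten h 38).le
  have h2 : pv 11 38 + iTab 10 38 ≤ iTab 11 38 + (pv 10 38 + codLow1 2 38) := by decide +kernel
  have h3 : iv ρ 11 38 + pv 10 38 + codLow1 2 38 ≤ pv 11 38 + iTab 10 38 := h1
  omega

theorem X_mul_mem_Pol_sub {m : ℕ} {w : ℤ} (k : Fin 8) {f : MvPolynomial (Fin 8) ℂ}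
    (hf : f ∈ Pol m (w - (k : ℕ))) : X k * f ∈ Pol (m + 1) w := by
  simpa using X_mul_mem_Pol k hf

theorem Van_anti {Z Z' : Set (Fin 8 → ℂ)} (h : Z' ⊆ Z) (m : ℕ) (w : ℤ) : Van Z m w ≤ Van Z' m w :=
  fun _ hf => ⟨fun z hz => hf.1 z (h hz), hf.2⟩

theorem map_mulX_Van_le {Z Z' : Set (Fin 8 → ℂ)} {j k : Fin 8} {n : ℕ} {w : ℤ}
    (h : Van Z' (n + 1) (w - (k : ℕ)) ≤
      Van Z (n + 1) (w - (k : ℕ)) ⊔ (Pol n (w - (k : ℕ) - (j : ℕ))).map (mulX j)) :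
    (Van Z' (n + 1) (w - (k : ℕ))).map (mulX k) ≤
      Dec Z (n + 2) w ⊔ (Pol (n + 1) (w - (j : ℕ))).map (mulX j) := by
  rintro _ ⟨f, hf, rfl⟩
  obtain ⟨g, hg, _, ⟨q, hq, rfl⟩, rfl⟩ := Submodule.mem_sup.mp (h hf)
  rw [map_add]
  refine Submodule.add_mem_sup (X_mul_mem_Dec k hg) ⟨X k * q, X_mul_mem_Pol_sub k ?_, ?_⟩
  · rwa [sub_right_comm]
  · rw [mulX_apply, mulX_apply, mulX_apply, mul_left_comm]

theorem Dec_succ_le {Z : Set (Fin 8 → ℂ)} {n : ℕ} {w : ℤ}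
    {U : Submodule ℂ (MvPolynomial (Fin 8) ℂ)}
    (h : ∀ k : Fin 8, (Van Z n (w - (k : ℕ))).map (mulX k) ≤ U) : Dec Z (n + 1) w ≤ U := by
  intro f hf
  obtain ⟨g, hg, rfl⟩ := mem_Dec_succ.mp hf
  exact Submodule.sum_mem _ fun k _ => h k ⟨g k, hg k, rfl⟩

theorem Van_le_Dec_of_le_sup {Z : Set (Fin 8 → ℂ)} {k : Fin 8} {n : ℕ} {w : ℤ}
    (hreg : ∀ f : MvPolynomial (Fin 8) ℂ, (∀ z ∈ Z, aeval z (X k * f) = 0) → ∀ z ∈ Z, aeval z f = 0)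
    (h : Van Z (n + 1) w ≤ Dec Z (n + 1) w ⊔ (Pol n (w - (k : ℕ))).map (mulX k)) :
    Van Z (n + 1) w ≤ Dec Z (n + 1) w := by
  intro f hf
  obtain ⟨g, hg, _, ⟨q, hq, rfl⟩, rfl⟩ := Submodule.mem_sup.mp (h hf)
  have hq' : q ∈ Van Z n (w - (k : ℕ)) := by
    refine ⟨hreg q fun z hz => ?_, hq⟩
    have h1 := hf.1 z hz
    rwa [map_add, (Dec_le_Van _ _ _ hg).1 z hz, zero_add] at h1
  exact add_mem hg (X_mul_mem_Dec k hq')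

theorem step_of_lift {Z Z' : Set (Fin 8 → ℂ)} {j : Fin 8} {n : ℕ} {w : ℤ} (hZ : Z' ⊆ Z)
    (hreg : ∀ f : MvPolynomial (Fin 8) ℂ, (∀ z ∈ Z, aeval z (X j * f) = 0) → ∀ z ∈ Z, aeval z f = 0)
    (hdec : Van Z' (n + 2) w ≤ Dec Z' (n + 2) w)
    (hl : ∀ k : Fin 8, Van Z' (n + 1) (w - (k : ℕ)) ≤
      Van Z (n + 1) (w - (k : ℕ)) ⊔ (Pol n (w - (k : ℕ) - (j : ℕ))).map (mulX j)) :
    Van Z (n + 2) w ≤ Dec Z (n + 2) w ∧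
      Van Z' (n + 2) w ≤ Van Z (n + 2) w ⊔ (Pol (n + 1) (w - (j : ℕ))).map (mulX j) := by
  have h := hdec.trans (Dec_succ_le fun k => map_mulX_Van_le (hl k))
  exact ⟨Van_le_Dec_of_le_sup hreg ((Van_anti hZ _ _).trans h),
    h.trans (sup_le_sup_right (Dec_le_Van _ _ _) _)⟩

theorem step_Z0 {ρ : Fin 7 → ℂ} {n : ℕ} {w : ℤ} (hdec : Van (Z1 ρ) (n + 2) w ≤ Dec (Z1 ρ) (n + 2) w)
    (hl : ∀ k : Fin 8, Lift0 ρ n (w - (k : ℕ))) :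
    Van (Z0 ρ) (n + 2) w ≤ Dec (Z0 ρ) (n + 2) w ∧ Lift0 ρ (n + 1) w := by
  have := step_of_lift (j := 0) (Z1_subset ρ) (regular_Z0 ρ) hdec (fun k => by
    have := hl k
    simpa [Lift0] using this)
  simpa [Lift0] using this

theorem step_Z1 {ρ : Fin 7 → ℂ} {n : ℕ} {w : ℤ} (hdec : Van (Z2 ρ) (n + 2) w ≤ Dec (Z2 ρ) (n + 2) w)
    (hl : ∀ k : Fin 8, Lift1 ρ n (w - (k : ℕ))) :
    Van (Z1 ρ) (n + 2) w ≤ Dec (Z1 ρ) (n + 2) w ∧ Lift1 ρ (n + 1) w :=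
  step_of_lift (j := 7) (Z2_subset ρ) (regular_Z1 ρ) hdec hl

theorem lift0_of_tab (h : IsGood ρ) {j : ℕ} (hj : j ≤ 2) {w : ℕ}
    (hi : iv ρ (9 + j) w ≤ iTab (9 + j) w) (hl : iTab (10 + j) w ≤ iv ρ (10 + j) w)
    (hc : pv (10 + j) w + iTab (9 + j) w ≤ iTab (10 + j) w + (pv (9 + j) w + codLow1 (j + 1) w)) :
    Lift0 ρ (9 + j) w := by
  have h2 := codLow1_le h (j + 1) w
  have h3 := cod_iv ρ (m := 9 + j) (by omega) w
  have h4 := cod_iv ρ (m := 10 + j) (by omega) w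
  have e : cod (Z0 ρ) (9 + j + 1) w = cod (Z0 ρ) (10 + j) w := by rw [show 9 + j + 1 = 10 + j by omega]
  have e' : cod (Z1 ρ) (9 + j + 1) w = cod (Z1 ρ) (9 + (j + 1)) w := rfl
  refine (chain_Z0 ρ (9 + j) w).2 ?_
  omega

theorem map_Pol_le_Van_Z1 (ρ : Fin 7 → ℂ) (n : ℕ) (w : ℤ) :
    (Pol n w).map (mulX 0) ≤ Van (Z1 ρ) (n + 1) w := by
  rintro _ ⟨q, hq, rfl⟩
  refine ⟨fun z hz => ?_, X_mul_mem_Pol_sub 0 (by simpa using hq)⟩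
  rw [mulX_apply, map_mul, aeval_X, hz.2, zero_mul]

theorem Van_Z1_eleven_le (h : IsGood ρ) {w t : ℕ} (hJ : JointBound ρ w t) (C : Fin 8 → ℕ)
    (hC : ∀ k ∈ ([1, 2, 3, 4] : List (Fin 8)), cod (Z1 ρ) 10 (w - ((k : ℕ) : ℤ)) ≤ C k)
    (hc : pv 11 w + (([1, 2, 3, 4] : List (Fin 8)).map C).sum ≤ codLow1 2 w + (t + pv 10 w)) :
    Van (Z1 ρ) 11 w ≤
      supL (fun k : Fin 8 => (Van (Z1 ρ) 10 (w - ((k : ℕ) : ℤ))).map (mulX k))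
        ([1, 2, 3, 4] : List (Fin 8)) ⊔ (Pol 10 w).map (mulX 0) := by
  set R := supL (fun k : Fin 8 => (Van (Z1 ρ) 10 (w - ((k : ℕ) : ℤ))).map (mulX k))
        ([1, 2, 3, 4] : List (Fin 8)) ⊔ (Pol 10 w).map (mulX 0) with hR
  have hle : R ≤ Van (Z1 ρ) 11 w := by
    refine sup_le (supL_le.mpr fun k _ => ?_) (map_Pol_le_Van_Z1 ρ 10 w)
    rintro _ ⟨q, hq, rfl⟩
    exact X_mul_mem_Van k hq
  have h1 := hJ (Pol 10 w) le_rfl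
  rw [← hR, finrank_Pol_eq_pv (by norm_num)] at h1
  have h2 := List.sum_le_sum hC
  have h3 := cod_add (Z1 ρ) 11 w
  rw [finrank_Pol_eq_pv (by norm_num)] at h3
  have h4 := codLow1_le h 2 w
  have h5 : codLow1 2 w ≤ cod (Z1 ρ) 11 w := h4
  exact (Submodule.eq_of_le_of_finrank_le hle (by omega)).ge

theorem cod_Z1_ten_le (h : IsGood ρ) (w : ℕ) :
    cod (Z1 ρ) 10 w + iTab 10 w + pv 9 w ≤ pv 10 w + iTab 9 w := by
  have h1 := (chain_Z0 ρ 9 w).1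
  have h3 := cod_iv ρ (m := 9) (by norm_num) w
  have h4 := cod_iv ρ (m := 10) (by norm_num) w
  have h5 := iv_nine h w
  have h6 := iv_ten h w
  have e : cod (Z0 ρ) (9 + 1) w = cod (Z0 ρ) 10 w := rfl
  have e' : cod (Z1 ρ) (9 + 1) w = cod (Z1 ρ) 10 w := rfl
  omega

theorem gv_eleven (h : IsGood ρ) (w : ℕ) : gv ρ 11 w = 0 := by
  have C : ∀ k ∈ ([1, 2, 3, 4] : List (Fin 8)),
      cod (Z1 ρ) 10 ((39 : ℕ) - ((k : ℕ) : ℤ)) ≤ 166 - 7 * (k : ℕ) := by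
    intro k hk
    have hk' : k.val ≤ 4 ∧ 1 ≤ k.val := by
      revert hk; revert k; decide
    have h1 := cod_Z1_ten_le h (39 - k.val)
    rw [Nat.cast_sub (by omega)] at h1
    have h2 : ∀ k : Fin 8, k.val ≤ 4 → 1 ≤ k.val → pv 10 (39 - k.val) + iTab 9 (39 - k.val) ≤
      166 - 7 * k.val + (iTab 10 (39 - k.val) + pv 9 (39 - k.val)) := by decide +kernel
    have h3 := h2 k hk'.1 hk'.2
    omega
  have h1 := Van_Z1_eleven_le h h.joint39 _ C (by decide +kernel)
  have h2 : Van (Z0 ρ) 11 (39 : ℕ) ≤ Dec (Z0 ρ) 11 (39 : ℕ) := by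
    refine Van_le_Dec_of_le_sup (k := 0) (n := 10) (regular_Z0 ρ) ((Van_anti (Z1_subset ρ) _ _).trans
      (h1.trans (sup_le (supL_le.mpr fun k hk => map_mulX_Van_le ?_) ?_)))
    · have hk' : k.val ≤ 4 ∧ 1 ≤ k.val := by
        revert hk; revert k; decide
      have hL := lift0_of_tab h (j := 0) (by norm_num) (iv_nine h (39 - k.val)).le
        (iv_ten h (39 - k.val)).ge (by
          have h2 : ∀ k : Fin 8, k.val ≤ 4 → 1 ≤ k.val → pv (10 + 0) (39 - k.val) +
              iTab (9 + 0) (39 - k.val) ≤ iTab (10 + 0) (39 - k.val) +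
                (pv (9 + 0) (39 - k.val) + codLow1 (0 + 1) (39 - k.val : ℕ)) := by decide +kernel
          exact h2 k hk'.1 hk'.2)
      rw [Nat.cast_sub (by omega)] at hL
      simpa [Lift0] using hL
    · simp
  have h3 := (Submodule.finrank_mono h2).antisymm (Submodule.finrank_mono (Dec_le_Van _ _ _))
  have h4 := gv_add ρ 11 39
  have h5 := gv_rev ρ (m := 11) (w := 38) (by norm_num)
  have h6 : gv ρ 11 38 = 0 := by
    rw [← h5]
    change gv ρ 11 39 = 0
    rw [iv, jv] at h4
    omega
  refine (gv_eq_gTab_of_half (m := 11) (fun w hw => ?_) w).trans rfl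
  change _ = 0
  have := gv_le_gv (ρ := ρ) (m := 11) (a := w) (b := 38) (by omega) (by norm_num)
  omega

theorem iv_eleven (h : IsGood ρ) (w : ℕ) : iv ρ 11 w = iTab 11 w := by
  refine iv_eq_iTab_of_half (fun w hw => ?_) w
  rcases le_or_gt 20 w with h1 | h1
  · exact (iv_le_iTab_eleven h h1 (by omega)).antisymm (iTab_le_iv_eleven h w)
  · refine iv_eq_of_gv_eq (by norm_num) (fun n hn u => gv_le_gTab_of_lt_eleven h hn u)
      (gv_eleven h w) (iTab_le_iv_eleven h w) ?_
    exact (by decide +kernel : ∀ w < 20, decCount 11 w + gTab 11 w ≤ iTab 11 w) w h1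

theorem cod_eq_zero (Z : Set (Fin 8 → ℂ)) {m : ℕ} {w : ℤ} (h : w < 0 ∨ 7 * m < w) :
    cod Z m w = 0 := by
  have := cod_add Z m w
  rw [Pol_eq_bot h, finrank_bot] at this
  omega

theorem cod_Z1_twelve_le (h : IsGood ρ) (w : ℤ) :
    cod (Z1 ρ) 12 w ≤ codLow1 3 w ∧ Lift0 ρ 11 w := by
  by_cases hw : w < 0 ∨ 7 * (12 : ℕ) < w
  · rw [cod_eq_zero _ hw, Lift0, Van_eq_bot hw]
    exact ⟨Nat.zero_le _, bot_le⟩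
  · lift w to ℕ using by omega
    have h1 := chain_Z0 ρ 11 w
    have h2 : codLow1 3 w ≤ cod (Z1 ρ) (11 + 1) w := codLow1_le h 3 w
    have h3 := cod_iv ρ (m := 11) (by norm_num) w
    have h4 : cod (Z0 ρ) (11 + 1) w + iv ρ 12 w = pv 12 w := cod_iv ρ (by norm_num) w
    have h5 := iv_eleven h w
    have h6 := iTab_le_iv_twelve h w
    have h7 : ∀ w < 85, pv 12 w + iTab 11 w ≤ iTab 12 w + (pv 11 w + codLow1 3 (w : ℕ)) := by
      decide +kernel
    have h8 := h7 w (by omega)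
    refine ⟨?_, h1.2 (by omega)⟩
    change cod (Z1 ρ) (11 + 1) w ≤ _
    omega

theorem cod_Z1_descent (h : IsGood ρ) {j : ℕ}
    (H : ∀ w, cod (Z1 ρ) (9 + (j + 1)) w ≤ codLow1 (j + 1) w) (w : ℤ) :
    cod (Z1 ρ) (9 + j) w ≤ codLow1 j w ∧ cod (Z2 ρ) (9 + j + 1) w ≤ codLow2 (j + 1) w ∧
      Lift1 ρ (9 + j) w := by
  have key : ∀ w, cod (Z1 ρ) (9 + j) (w - 7) ≤ codLow1 j (w - 7) ∧
      cod (Z2 ρ) (9 + j + 1) w ≤ codLow2 (j + 1) w ∧ Lift1 ρ (9 + j) w := by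
    intro w
    have h1 := chain_Z1 ρ (9 + j) w
    have h2 : cod (Z1 ρ) (9 + j + 1) w ≤ codLow1 j (w - 7) + codLow2 (j + 1) w := H w
    have h3 := codLow1_le h j (w - 7)
    have h4 : codLow2 (j + 1) w ≤ cod (Z2 ρ) (9 + j + 1) w := codLow2_le h (j + 1) w
    exact ⟨by omega, by omega, h1.2 (by omega)⟩
  refine ⟨?_, (key w).2⟩
  have := (key (w + 7)).1
  rwa [add_sub_cancel_right] at this

theorem cod_Z1_ten_le_codLow1 (h : IsGood ρ) (w : ℤ) : cod (Z1 ρ) 10 w ≤ codLow1 1 w :=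
  (cod_Z1_descent h (j := 1) (fun w =>
    (cod_Z1_descent h (j := 2) (fun w => (cod_Z1_twelve_le h w).1) w).1) w).1

theorem lift1_nine (h : IsGood ρ) (w : ℤ) : Lift1 ρ 9 w :=
  (cod_Z1_descent h (j := 0) (cod_Z1_ten_le_codLow1 h) w).2.2

theorem cod_Z2_ten_le (h : IsGood ρ) (w : ℤ) : cod (Z2 ρ) 10 w ≤ codLow2 1 w :=
  (cod_Z1_descent h (j := 0) (cod_Z1_ten_le_codLow1 h) w).2.1

theorem Pol_le_map_one_ten (h : IsGood ρ) {w : ℤ} (hw : w ≤ 40) :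
    Pol 10 w ≤ Van (Z2 ρ) 10 w ⊔ (Pol 9 (w - 1)).map (mulX 1) := by
  by_cases hw' : w < 0
  · rw [Pol_eq_bot (Or.inl hw')]
    exact bot_le
  · refine (chain_Z2 9 w h.inj).2 ((cod_Z2_ten_le h w).trans (le_trans ?_ (codNine2_le h (w - 1))))
    lift w to ℕ using by omega
    exact (by decide +kernel : ∀ w < 41, codLow2 1 (w : ℕ) ≤ codNine2 ((w : ℕ) - 1)) w (by omega)

theorem map_Pol_le_Van_Z2 (ρ : Fin 7 → ℂ) {k : Fin 8} (hk : k = 0 ∨ k = 7) (n : ℕ) (w : ℤ) :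
    (Pol n (w - (k : ℕ))).map (mulX k) ≤ Van (Z2 ρ) (n + 1) w := by
  rintro _ ⟨q, hq, rfl⟩
  refine ⟨fun z hz => ?_, X_mul_mem_Pol_sub k hq⟩
  have : z k = 0 := by
    rcases hk with rfl | rfl
    exacts [hz.1.2, hz.2]
  rw [mulX_apply, map_mul, aeval_X, this, zero_mul]

/-- A monomial of weight at most four times its degree is divisible by a variable whose removal
preserves the bound on the weight. -/
theorem exists_sub_single {m : ℕ} {w : ℤ} {d : Fin 8 →₀ ℕ} (hd : d ∈ monSet (m + 1) w)
    (hw : w ≤ 4 * (m + 1 : ℕ)) : ∃ k : Fin 8, ∃ e ∈ monSet m (w - (k : ℕ)), w - (k : ℕ) ≤ 4 * m ∧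
      d = e + Finsupp.single k 1 := by
  obtain ⟨h1, h2⟩ := mem_monSet.1 hd
  obtain ⟨k, hk, hkw⟩ : ∃ k, 0 < d k ∧ w - (k : ℕ) ≤ 4 * m := by
    by_contra! hcon
    have h3 : ∀ k, (d k : ℤ) * ((k : ℕ) : ℤ) ≤ d k * (w - 4 * m - 1) := by
      intro k
      rcases Nat.eq_zero_or_pos (d k) with h0 | h0
      · simp [h0]
      · have := hcon k h0
        exact mul_le_mul_of_nonneg_left (by omega) (by positivity)
    have h4 := Finset.sum_le_sum fun k (_ : k ∈ Finset.univ) => h3 k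
    rw [h2, ← Finset.sum_mul, ← Nat.cast_sum, h1] at h4
    push_cast at h4 hw
    nlinarith
  obtain ⟨e, rfl⟩ := exists_add_of_le (Finsupp.single_le_iff.2 (Nat.succ_le_of_lt hk))
  refine ⟨k, e, ?_, hkw, add_comm _ _⟩
  simp only [Finsupp.add_apply, Finset.sum_add_distrib, Nat.cast_add, add_mul] at h1 h2
  simp [Finsupp.single_apply] at h1 h2
  exact mem_monSet.2 ⟨by omega, by linarith⟩

theorem Pol_le_map_one (h : IsGood ρ) {n : ℕ} (hn : 9 ≤ n) {w : ℤ} (hw : w ≤ 4 * (n + 1 : ℕ)) :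
    Pol (n + 1) w ≤ Van (Z2 ρ) (n + 1) w ⊔ (Pol n (w - 1)).map (mulX 1) := by
  induction n, hn using Nat.le_induction generalizing w with
  | base => exact Pol_le_map_one_ten h (by simpa using hw)
  | succ n hn ih =>
    intro f hf
    refine Pol_induction (P := fun f => f ∈ Van (Z2 ρ) (n + 1 + 1) w ⊔
      (Pol (n + 1) (w - 1)).map (mulX 1)) (zero_mem _) (fun _ _ => add_mem) (fun d hd c => ?_) hf
    obtain ⟨k, e, he, hk, rfl⟩ := exists_sub_single hd hw
    obtain ⟨u, hu, _, ⟨q, hq, rfl⟩, he'⟩ := Submodule.mem_sup.1 (ih hk (monomial_mem_Pol he c))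
    have : monomial (e + Finsupp.single k 1) c = X k * u + mulX 1 (X k * q) := by
      rw [mulX_apply, mul_left_comm, ← mul_add, ← mulX_apply 1 q, he', X, monomial_mul, one_mul,
        add_comm]
    rw [this]
    refine Submodule.add_mem_sup (X_mul_mem_Van k hu) ⟨X k * q, X_mul_mem_Pol_sub k ?_, rfl⟩
    rwa [sub_right_comm]

theorem Pol_succ_le_Dec_empty (n : ℕ) (w : ℤ) : Pol (n + 1) w ≤ Dec ∅ (n + 1) w := by
  intro f hf
  refine Pol_induction (P := fun f => f ∈ Dec ∅ (n + 1) w) (zero_mem _) (fun _ _ => add_mem)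
    (fun d hd c => ?_) hf
  obtain ⟨h1, h2⟩ := mem_monSet.1 hd
  obtain ⟨k, -, hk⟩ : ∃ k ∈ Finset.univ, d k ≠ 0 :=
    Finset.exists_ne_zero_of_sum_ne_zero (by rw [h1]; omega)
  obtain ⟨e, rfl⟩ := exists_add_of_le (Finsupp.single_le_iff.2 (Nat.succ_le_of_lt (Nat.pos_of_ne_zero hk)))
  simp only [Finsupp.add_apply, Finset.sum_add_distrib, Nat.cast_add, add_mul] at h1 h2
  simp [Finsupp.single_apply] at h1 h2
  have : monomial (Finsupp.single k 1 + e) c = X k * monomial e c := by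
    rw [X, monomial_mul, one_mul]
  rw [this]
  refine X_mul_mem_Dec k ?_
  rw [Van_empty]
  exact monomial_mem_Pol (mem_monSet.2 ⟨by omega, by linarith⟩) c

theorem Van_Z2_le_Dec (h : IsGood ρ) {n : ℕ} (hn : 9 ≤ n) (w : ℤ) :
    Van (Z2 ρ) (n + 2) w ≤ Dec (Z2 ρ) (n + 2) w := by
  have key : ∀ w : ℤ, 2 * w ≤ 7 * (n + 2 : ℕ) → Van (Z2 ρ) (n + 2) w ≤ Dec (Z2 ρ) (n + 2) w := by
    intro w hw
    refine Van_le_Dec_of_le_sup (k := 1) (regular_Z2 h.inj) ((Van_le_Pol _ _ _).trans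
      ((Pol_succ_le_Dec_empty _ _).trans (Dec_succ_le fun k => map_mulX_Van_le ?_)))
    rw [Van_empty]
    exact Pol_le_map_one h hn (by push_cast at hw ⊢; omega)
  rcases le_or_gt (2 * w) (7 * (n + 2 : ℕ)) with h1 | h1
  · exact key w h1
  · have h2 := key (7 * (n + 2 : ℕ) - w) (by omega)
    have h3 := Submodule.finrank_mono h2
    rw [finrank_Van_rev (isRevStable_Z2 ρ), finrank_Dec_rev (isRevStable_Z2 ρ)] at h3
    exact (Submodule.eq_of_le_of_finrank_le (Dec_le_Van _ _ _) h3).ge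

theorem lift1_of_le (h : IsGood ρ) {n : ℕ} (hn : 9 ≤ n) (w : ℤ) : Lift1 ρ n w := by
  induction n, hn using Nat.le_induction generalizing w with
  | base => exact lift1_nine h w
  | succ n hn ih => exact (step_Z1 (Van_Z2_le_Dec h hn w) fun k => ih _).2

theorem Van_Z1_le_Dec (h : IsGood ρ) {n : ℕ} (hn : 9 ≤ n) (w : ℤ) :
    Van (Z1 ρ) (n + 2) w ≤ Dec (Z1 ρ) (n + 2) w :=
  (step_Z1 (Van_Z2_le_Dec h hn w) fun _ => lift1_of_le h hn _).1

theorem lift0_of_le (h : IsGood ρ) {n : ℕ} (hn : 11 ≤ n) (w : ℤ) : Lift0 ρ n w := by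
  induction n, hn using Nat.le_induction generalizing w with
  | base => exact (cod_Z1_twelve_le h w).2
  | succ n hn ih => exact (step_Z0 (Van_Z1_le_Dec h (by omega) w) fun k => ih _).2

theorem Van_Z0_le_Dec (h : IsGood ρ) {n : ℕ} (hn : 11 ≤ n) (w : ℤ) :
    Van (Z0 ρ) (n + 2) w ≤ Dec (Z0 ρ) (n + 2) w :=
  (step_Z0 (Van_Z1_le_Dec h (by omega) w) fun _ => lift0_of_le h hn _).1

theorem lift0_ten (h : IsGood ρ) {w : ℕ} (h1 : 36 ≤ w) (h2 : w ≤ 42) : Lift0 ρ 10 w := by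
  refine lift0_of_tab h (j := 1) (by norm_num) (iv_ten h w).le (iv_eleven h w).ge ?_
  have : ∀ w < 43, 36 ≤ w → pv (10 + 1) w + iTab (9 + 1) w ≤
      iTab (10 + 1) w + (pv (9 + 1) w + codLow1 (1 + 1) (w : ℕ)) := by decide +kernel
  exact this w (by omega) h1

theorem lift0_ten' (h : IsGood ρ) {w : ℤ} (h1 : 36 ≤ w) (h2 : w ≤ 42) : Lift0 ρ 10 w := by
  lift w to ℕ using by omega
  exact lift0_ten h (by omega) (by omega)

theorem Van_Z0_twelve_le_Dec (h : IsGood ρ) :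
    Van (Z0 ρ) 12 (42 : ℕ) ≤ Dec (Z0 ρ) 12 (42 : ℕ) := by
  have lift : ∀ (f : Submodule ℂ (MvPolynomial (Fin 8) ℂ)) (k : Fin 8), k.val ≤ 6 → 1 ≤ k.val →
      f ≤ Van (Z1 ρ) 11 ((42 : ℕ) - ((k : ℕ) : ℤ)) →
      f.map (mulX k) ≤ Dec (Z0 ρ) 12 (42 : ℕ) ⊔ (Pol 11 (42 : ℕ)).map (mulX 0) := by
    intro f k h1 h2 hf
    have := map_mulX_Van_le (Z := Z0 ρ) (Z' := Z1 ρ) (j := 0) (k := k) (n := 10) (w := (42 : ℕ)) (by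
      have := lift0_ten' h (w := (42 : ℕ) - ((k : ℕ) : ℤ)) (by omega) (by omega)
      simpa [Lift0] using this)
    exact (Submodule.map_mono hf).trans (by simpa using this)
  have C : ∀ k ∈ ([1, 2, 3, 4] : List (Fin 8)),
      cod (Z1 ρ) 10 ((35 : ℕ) - ((k : ℕ) : ℤ)) ≤ codLow1 1 ((35 : ℕ) - ((k : ℕ) : ℤ)) :=
    fun k _ => cod_Z1_ten_le_codLow1 h _
  have h7 := Van_Z1_eleven_le h h.joint35 _ C (by decide +kernel)
  refine Van_le_Dec_of_le_sup (k := 0) (n := 11) (regular_Z0 ρ) ?_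
  refine ((Van_anti (Z1_subset ρ) _ _).trans ((Van_Z1_le_Dec h (n := 10) (by norm_num) _).trans
    (Dec_succ_le fun k => ?_)))
  rcases Nat.eq_zero_or_pos k.val with h0 | h0
  · obtain rfl : k = 0 := Fin.ext h0
    refine le_sup_of_le_right ?_
    simpa using Submodule.map_mono (Van_le_Pol (Z1 ρ) 11 42)
  rcases le_or_gt k.val 6 with h6 | h6
  · simpa using lift _ k h6 h0 le_rfl
  · obtain rfl : k = 7 := Fin.ext (by omega)
    have e : ((42 : ℕ) : ℤ) - (((7 : Fin 8) : ℕ) : ℤ) = (35 : ℕ) := rfl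
    rw [e]
    refine (Submodule.map_mono h7).trans ?_
    rw [Submodule.map_sup, map_supL]
    refine sup_le (supL_le.mpr fun k hk => ?_) ?_
    · have hk' : k.val ≤ 4 ∧ 1 ≤ k.val := by
        revert hk; revert k; decide
      refine le_trans ?_ (lift ((Van (Z1 ρ) 10 ((35 : ℕ) - ((k : ℕ) : ℤ))).map (mulX 7)) k
        (by omega) hk'.2 ?_)
      · rintro _ ⟨_, ⟨f, hf, rfl⟩, rfl⟩
        exact ⟨mulX 7 f, ⟨f, hf, rfl⟩, by simp only [mulX_apply]; ring⟩
      · rintro _ ⟨f, hf, rfl⟩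
        refine X_mul_mem_Van 7 (m := 10) (w := (42 : ℕ) - ((k : ℕ) : ℤ)) ?_
        rwa [sub_right_comm, e]
    · refine le_sup_of_le_right ?_
      rintro _ ⟨_, ⟨f, hf, rfl⟩, rfl⟩
      exact ⟨mulX 7 f, X_mul_mem_Pol_sub 7 hf, by simp only [mulX_apply]; ring⟩

theorem gv_of_Van_le {m w : ℕ} (h : Van (Z0 ρ) m w ≤ Dec (Z0 ρ) m w) : gv ρ m w = 0 := by
  have h3 := (Submodule.finrank_mono h).antisymm (Submodule.finrank_mono (Dec_le_Van _ _ _))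
  have h4 := gv_add ρ m w
  rw [iv, jv] at h4
  omega

theorem gv_of_le (h : IsGood ρ) {m : ℕ} (hm : 12 ≤ m) (w : ℕ) : gv ρ m w = 0 := by
  rcases Nat.lt_or_eq_of_le hm with h1 | rfl
  · obtain ⟨n, rfl⟩ := Nat.exists_eq_add_of_le' (show 2 ≤ m by omega)
    exact gv_of_Van_le (Van_Z0_le_Dec h (by omega) w)
  · refine (gv_eq_gTab_of_half (m := 12) (fun w hw => ?_) w).trans rfl
    change _ = 0
    have := gv_le_gv (ρ := ρ) (m := 12) (a := w) (b := 42) (by omega) (by norm_num)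
    have := gv_of_Van_le (Van_Z0_twelve_le_Dec h)
    omega

end Lift

theorem betti_eq_sum (ρ : Fin 7 → ℂ) {c : ℂ} (hc : c ≠ 0) (m : ℕ) :
    betti 7 m (fun k => c * pt ρ 1 0 0 1 k) = ∑ w ∈ Finset.range (7 * m + 1), gv ρ m w := by
  have h := betti_add (isTorusStable_Z0 ρ) (orbitIdeal_eq ρ hc) m
  have h2 : ∑ w ∈ Finset.range (7 * m + 1), gv ρ m w + ∑ w ∈ Finset.range (7 * m + 1), jv ρ m w =
      ∑ w ∈ Finset.range (7 * m + 1), iv ρ m w := by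
    rw [← Finset.sum_add_distrib]
    exact Finset.sum_congr rfl fun w _ => gv_add ρ m w
  exact Nat.add_right_cancel (h.trans h2.symm)

theorem betti_of_isGood {ρ : Fin 7 → ℂ} (h : IsGood ρ) {c : ℂ} (hc : c ≠ 0) :
    betti 7 6 (fun k => c * pt ρ 1 0 0 1 k) = 10 ∧ betti 7 8 (fun k => c * pt ρ 1 0 0 1 k) = 40 ∧
    betti 7 9 (fun k => c * pt ρ 1 0 0 1 k) = 106 ∧ betti 7 10 (fun k => c * pt ρ 1 0 0 1 k) = 89 ∧
    ∀ m : ℕ, m ∉ ([6, 8, 9, 10] : List ℕ) →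
      Subsingleton (minGenSpace 7 m (fun k => c * pt ρ 1 0 0 1 k)) := by
  refine ⟨?_, ?_, ?_, ?_, fun m hm => subsingleton_of_betti_eq_zero ?_⟩
  all_goals rw [betti_eq_sum ρ hc]
  · rw [Finset.sum_congr rfl fun w _ => gv_six h w]
    decide +kernel
  · rw [Finset.sum_congr rfl fun w _ => gv_eight h w]
    decide +kernel
  · rw [Finset.sum_congr rfl fun w _ => gv_nine h w]
    decide +kernel
  · rw [Finset.sum_congr rfl fun w _ => gv_ten h w]
    decide +kernel
  · refine Finset.sum_eq_zero fun w _ => ?_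
    simp only [List.mem_cons, List.not_mem_nil, or_false, not_or] at hm
    rcases lt_or_ge m 6 with h1 | h1
    · exact gv_of_lt_six h h1 w
    rcases lt_or_ge m 12 with h2 | h2
    · obtain rfl | rfl : m = 7 ∨ m = 11 := by omega
      exacts [gv_seven h w, gv_eleven h w]
    · exact gv_of_le h h2 w

theorem pt_eq_esymm (ρ : Fin 7 → ℂ) (k : Fin 8) :
    pt ρ 1 0 0 1 k = nrm k * ((-1) ^ (k : ℕ) * (Finset.univ.val.map ρ).esymm k) := by
  rw [pt, septic, coeff_linProd, Finset.esymm_map_val]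
  congr 1
  rw [Finset.mul_sum]
  refine Finset.sum_congr rfl fun S hS => ?_
  rw [Finset.mem_powersetCard] at hS
  simp [Finset.prod_neg, hS.2]

theorem pt_zero (ρ : Fin 7 → ℂ) : pt ρ 1 0 0 1 0 = 105 := by
  simp [pt, septic_zero]

theorem choose_mul_pt (ρ : Fin 7 → ℂ) (c : ℂ) (k : Fin 8) :
    (Nat.choose 7 k : ℂ) * (c * pt ρ 1 0 0 1 k) =
      105 * c * ((-1) ^ (k : ℕ) * (Finset.univ.val.map ρ).esymm k) := by
  have h : (nrm k : ℂ) * (Nat.choose 7 k : ℂ) = 105 := by exact_mod_cast nrm_mul_choose k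
  rw [pt_eq_esymm]
  linear_combination c * ((-1) ^ (k : ℕ) * (Finset.univ.val.map ρ).esymm k) * h

theorem exists_roots (P : Polynomial ℂ) (hP : P.natDegree = 7) :
    ∃ ρ : Fin 7 → ℂ, Finset.univ.val.map ρ = P.roots := by
  have hc : P.roots.card = 7 := by rw [IsAlgClosed.card_roots_eq_natDegree, hP]
  have hl : P.roots.toList.length = 7 := by rw [Multiset.length_toList, hc]
  refine ⟨fun i => P.roots.toList.get (i.cast hl.symm), ?_⟩
  conv_rhs => rw [← Multiset.coe_toList P.roots, ← List.ofFn_get P.roots.toList]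
  rw [Fin.univ_val_map, List.ofFn_congr hl]

theorem exists_pt_eq {E : Fin 8 → ℂ} (hE : E 0 ≠ 0) :
    ∃ ρ : Fin 7 → ℂ, E = fun k => E 0 / 105 * pt ρ 1 0 0 1 k := by
  set P : Polynomial ℂ := ∑ k : Fin 8, Polynomial.C (Nat.choose 7 k * E k) * Polynomial.X ^ (7 - (k : ℕ)) with hPdef
  have hco : ∀ k : Fin 8, P.coeff (7 - (k : ℕ)) = Nat.choose 7 k * E k := by
    intro k
    rw [hPdef, Polynomial.finsetSum_coeff, Finset.sum_eq_single k]
    · rw [Polynomial.coeff_C_mul_X_pow, if_pos rfl]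
    · intro j _ hj
      rw [Polynomial.coeff_C_mul_X_pow, if_neg]
      intro h
      exact hj (Fin.ext (by omega))
    · simp
  have hlead : P.coeff 7 = E 0 := by simpa using hco 0
  have hdeg : P.natDegree = 7 := by
    refine Polynomial.natDegree_eq_of_le_of_coeff_ne_zero ?_ (by rwa [hlead])
    refine Polynomial.natDegree_sum_le_of_forall_le _ _ fun k _ =>
      (Polynomial.natDegree_C_mul_X_pow_le _ _).trans (by omega)
  obtain ⟨ρ, hρ⟩ := exists_roots P hdeg
  refine ⟨ρ, funext fun k => ?_⟩
  have h1 := Polynomial.coeff_eq_esymm_roots_of_card (p := P) (k := 7 - (k : ℕ))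
    (IsAlgClosed.card_roots_eq_natDegree) (by omega)
  rw [hco, hdeg, Polynomial.leadingCoeff, hdeg, hlead, show 7 - (7 - (k : ℕ)) = k by omega,
    ← hρ] at h1
  have h2 := choose_mul_pt ρ (E 0 / 105) k
  have h3 : (Nat.choose 7 k : ℂ) ≠ 0 := by
    exact_mod_cast (Nat.choose_pos (by omega)).ne'
  refine mul_left_cancel₀ h3 ?_
  rw [h1, h2]
  ring

theorem exists_homogenization (b : Fin 7 → ℂ) (q : MvPolynomial (Fin 7) ℂ) :
    ∃ (H : MvPolynomial (Fin 8) ℂ) (N : ℕ), ∀ E : Fin 8 → ℂ, E 0 ≠ 0 →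
      eval E H = E 0 ^ N * eval (fun i => b i * (E i.succ / E 0)) q := by
  induction q using MvPolynomial.induction_on with
  | C a => exact ⟨C a, 0, fun E _ => by simp⟩
  | add p q hp hq =>
    obtain ⟨H, N, hH⟩ := hp
    obtain ⟨H', N', hH'⟩ := hq
    refine ⟨X 0 ^ N' * H + X 0 ^ N * H', N + N', fun E hE => ?_⟩
    simp only [map_add, map_mul, map_pow, eval_X, hH E hE, hH' E hE]
    ring
  | mul_X p i hp =>
    obtain ⟨H, N, hH⟩ := hp
    refine ⟨H * (C (b i) * X i.succ), N + 1, fun E hE => ?_⟩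
    simp only [map_mul, eval_X, eval_C, hH E hE, pow_succ]
    field_simp

theorem exists_of_gen {P : (Fin 7 → ℂ) → Prop} (hP : Gen P) :
    ∃ G : MvPolynomial (Fin 8) ℂ, G ≠ 0 ∧ ∀ E, eval E G ≠ 0 →
      ∃ ρ c, c ≠ 0 ∧ P ρ ∧ E = fun k => c * pt ρ 1 0 0 1 k := by
  obtain ⟨f, hf, hfP⟩ := hP
  set F : MvPolynomial (Fin 7) ℂ := map (Int.castRingHom ℂ) f with hF
  have hF0 : F ≠ 0 := fun h => hf (map_injective _ (RingHom.injective_int _) (by rw [← hF, h, map_zero]))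
  have hFe : ∀ ρ, eval ρ F = aeval ρ f := by
    intro ρ
    rw [hF, eval_map, aeval_def]
    rfl
  set g : MvPolynomial (Fin 7) ℂ := ∏ σ : Equiv.Perm (Fin 7), rename σ F with hg
  have hg0 : g ≠ 0 := Finset.prod_ne_zero_iff.mpr fun σ _ h => hF0 (rename_injective _ σ.injective (by rw [h, map_zero]))
  have hsymm : g.IsSymmetric := by
    intro τ
    rw [hg, map_prod]
    simp only [rename_rename]
    exact Fintype.prod_equiv (Equiv.mulLeft τ) _ _ fun σ => rfl
  obtain ⟨q, hq⟩ := (esymmAlgEquiv (Fin 7) ℂ (Fintype.card_fin 7)).surjective ⟨g, hsymm⟩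
  have hq' : aeval (fun i : Fin 7 => esymm (Fin 7) ℂ (i + 1)) q = g := by
    rw [← esymmAlgHom_apply]
    exact congrArg Subtype.val hq
  obtain ⟨H, N, hH⟩ := exists_homogenization
    (fun i => (-1) ^ ((i : ℕ) + 1) * (Nat.choose 7 ((i : ℕ) + 1) : ℂ)) q
  have key : ∀ (ρ : Fin 7 → ℂ) (c : ℂ), c ≠ 0 →
      eval (fun k => c * pt ρ 1 0 0 1 k) H = (105 * c) ^ N * eval ρ g := by
    intro ρ c hc
    have h0 : c * pt ρ 1 0 0 1 0 = 105 * c := by rw [pt_zero, mul_comm]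
    have hc' : 105 * c ≠ 0 := by simpa using hc
    rw [hH _ (by rwa [h0]), h0, ← hq', ← coe_aeval_eq_eval, ← coe_aeval_eq_eval, RingHom.coe_coe, RingHom.coe_coe, ← AlgHom.comp_apply,
      comp_aeval]
    congr 3
    ext i
    rw [aeval_esymm_eq_multiset_esymm]
    have h1 := choose_mul_pt ρ c i.succ
    rw [Fin.val_succ] at h1
    rw [mul_assoc, ← mul_div_assoc, h1, mul_div_cancel_left₀ _ hc', ← mul_assoc, ← mul_pow]
    norm_num
  refine ⟨X 0 * H, ?_, fun E hE => ?_⟩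
  · obtain ⟨ρ, hρ⟩ : ∃ ρ, eval ρ g ≠ 0 := by
      by_contra! h
      exact hg0 (MvPolynomial.funext fun x => by rw [h, map_zero])
    intro h
    have h1 := key ρ 1 one_ne_zero
    have h2 := congrArg (eval fun k => 1 * pt ρ 1 0 0 1 k) h
    rw [map_mul, eval_X, pt_zero, h1, map_zero] at h2
    simp [hρ] at h2
  · rw [map_mul, eval_X] at hE
    have hE0 := left_ne_zero_of_mul hE
    obtain ⟨ρ, hρ⟩ := exists_pt_eq hE0
    have hc : E 0 / 105 ≠ 0 := by simpa using hE0
    refine ⟨ρ, E 0 / 105, hc, hfP ρ ?_, hρ⟩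
    have h1 := right_ne_zero_of_mul hE
    rw [hρ, key ρ _ hc, hg, map_prod] at h1
    have h2 := Finset.prod_ne_zero_iff.mp (right_ne_zero_of_mul h1) 1 (Finset.mem_univ _)
    rw [← hFe]
    simpa [eval_rename] using h2

theorem forGeneral_of_ne_zero {P : (Fin 8 → ℂ) → Prop} {G : MvPolynomial (Fin 8) ℂ} (hG : G ≠ 0)
    (h : ∀ E, eval E G ≠ 0 → P E) : ForGeneral 7 P := by
  refine ⟨{E | eval E G ≠ 0}, ⟨{G}, by simp⟩, ?_, h⟩
  refine Set.eq_univ_of_forall fun v f hf => ?_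
  have : f * G = 0 := by
    refine MvPolynomial.funext fun x => ?_
    rw [map_mul, map_zero]
    by_cases hx : eval x G = 0
    · rw [hx, mul_zero]
    · rw [hf x hx, zero_mul]
  rw [(mul_eq_zero.mp this).resolve_right hG, map_zero]

end Septimic

/-- For a general binary septimic `E` (`d = 7`), the minimal generator
dimensions of `I_E` are `β_6 = 10`, `β_8 = 40`, `β_9 = 106`, `β_10 = 89`, and `β_m = 0`
(i.e. `B(0,m) = 0`) for all other `m`. -/
theorem septimic_betti_numbers :
    ForGeneral 7 fun E =>
      betti 7 6 E = 10 ∧ betti 7 8 E = 40 ∧ betti 7 9 E = 106 ∧ betti 7 10 E = 89 ∧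
      ∀ m : ℕ, m ∉ ([6, 8, 9, 10] : List ℕ) → Subsingleton (minGenSpace 7 m E) := by
  obtain ⟨G, hG, h⟩ := Septimic.exists_of_gen Septimic.gen_isGood
  refine Septimic.forGeneral_of_ne_zero hG fun E hE => ?_
  obtain ⟨ρ, c, hc, hρ, rfl⟩ := h E hE
  exact Septimic.betti_of_isGood hρ hc
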